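/- Let K ⊂ ℝⁿ be a convex body of class C²₊ with Gauss map ν_K. For every function ψ ∈ C¹(∂K), if ∫_{∂K} ψ dℋ^{n-1} = 0, then ∫_{∂K} tr(Dν_K) ψ² dℋ^{n-1} ≤ ∫_{∂K} ((Dν_K)^{-1} ∇ψ, ∇ψ) dℋ^{n-1}. -/

import Mathlib

open MeasureTheory Metric
open scoped RealInnerProductSpace ENNReal

noncomputable section

/-- Euclidean `n`-space. -/
abbrev E (n : ℕ) : Type := EuclideanSpace ℝ (Fin n)

/-- Orthogonal projection onto the hyperplane orthogonal to the unit vector `u`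
(the tangent space at a boundary point with outer unit normal `u`). -/
noncomputable def tproj {n : ℕ} (u : E n) : E n →L[ℝ] E n :=
  ContinuousLinearMap.id ℝ (E n) - (innerSL ℝ u).smulRight u

section BrunnMinkowski

open Set Filter Topology

/-- One-dimensional Brunn–Minkowski inequality: a set containing `A + B` has measure at least
`|A| + |B|`. -/
theorem Real.volume_add_volume_le {A B D : Set ℝ} (hA : MeasurableSet A) (hB : MeasurableSet B)
    (hA0 : A.Nonempty) (hB0 : B.Nonempty) (hD : ∀ x ∈ A, ∀ y ∈ B, x + y ∈ D) :
    volume A + volume B ≤ volume D := by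
  have key : ∀ A' ⊆ A, IsCompact A' → ∀ B' ⊆ B, IsCompact B' →
      volume A' + volume B' ≤ volume D := by
    intro A' hA' cA B' hB' cB
    rcases A'.eq_empty_or_nonempty with rfl | nA
    · obtain ⟨a, ha⟩ := hA0
      have : volume ((fun y => a + y) '' B') = volume B' := by
        simp [measure_preimage_add]
      rw [measure_empty, zero_add, ← this]
      refine measure_mono ?_
      rintro _ ⟨y, hy, rfl⟩
      exact hD a ha y (hB' hy)
    rcases B'.eq_empty_or_nonempty with rfl | nB
    · obtain ⟨b, hb⟩ := hB0
      have : volume ((fun y => y + b) '' A') = volume A' := by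
        simp
      rw [measure_empty, add_zero, ← this]
      refine measure_mono ?_
      rintro _ ⟨y, hy, rfl⟩
      exact hD y (hA' hy) b hb
    obtain ⟨a, haA, ha⟩ := cA.exists_isGreatest nA
    obtain ⟨b, hbB, hb⟩ := cB.exists_isLeast nB
    have h1 : volume ((fun y => y + b) '' A') = volume A' := by simp
    have h2 : volume ((fun y => a + y) '' B') = volume B' := by simp
    rw [← h1, ← h2]
    have hd : AEDisjoint volume ((fun y => y + b) '' A') ((fun y => a + y) '' B') := by
      refine measure_mono_null (t := {a + b}) ?_ (by simp)
      rintro _ ⟨⟨x, hx, rfl⟩, ⟨y, hy, hxy⟩⟩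
      have := ha hx
      have := hb hy
      simp only at hxy
      simp only [mem_singleton_iff]
      linarith
    have hm : NullMeasurableSet ((fun y => a + y) '' B') :=
      (cB.image (by fun_prop)).measurableSet.nullMeasurableSet
    rw [← measure_union₀ hm hd]
    refine measure_mono (union_subset ?_ ?_)
    · rintro _ ⟨y, hy, rfl⟩
      exact hD y (hA' hy) b (hB' hbB)
    · rintro _ ⟨y, hy, rfl⟩
      exact hD a (hA' haA) y (hB' hy)
  rw [hA.measure_eq_iSup_isCompact, hB.measure_eq_iSup_isCompact]
  simp only [iSup_and']
  refine ENNReal.biSup_add_biSup_le' (p := fun K => K ⊆ A ∧ IsCompact K)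
    (q := fun K => K ⊆ B ∧ IsCompact K) ⟨∅, by simp⟩ ⟨∅, by simp⟩ ?_
  rintro A' ⟨h1, h2⟩ B' ⟨h3, h4⟩
  exact key A' h1 h2 B' h3 h4

theorem ENNReal.mul_le_sq_of_add_le_two_mul {a b c : ℝ≥0∞} (h : a + b ≤ 2 * c) :
    a * b ≤ c ^ 2 := by
  rcases eq_or_ne c ∞ with rfl | hc
  · simp
  have h2 : 2 * c ≠ ∞ := ENNReal.mul_ne_top (by simp) hc
  have ha : a ≠ ∞ := ne_top_of_le_ne_top h2 (le_self_add.trans h)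
  have hb : b ≠ ∞ := ne_top_of_le_ne_top h2 (le_add_self.trans h)
  lift a to NNReal using ha
  lift b to NNReal using hb
  lift c to NNReal using hc
  norm_cast at h ⊢
  rw [← NNReal.coe_le_coe] at h ⊢
  push_cast at h ⊢
  nlinarith [sq_nonneg ((a : ℝ) - b), a.2, b.2, c.2]

/-- The Prékopa–Leindler inequality (at the midpoint, in multiplicative form) as a property of a
measured vector space. -/
def PrekopaLeindler (V : Type*) [AddCommGroup V] [Module ℝ V] [MeasureSpace V] : Prop :=
  ∀ f g h : V → ℝ≥0∞, Measurable f → Measurable g → Measurable h →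
    (∀ x y, f x * g y ≤ h ((2⁻¹ : ℝ) • (x + y)) ^ 2) →
    (∫⁻ x, f x) * (∫⁻ x, g x) ≤ (∫⁻ x, h x) ^ 2

theorem Real.lintegral_add_lintegral_le_of_le_one {f g h : ℝ → ℝ}
    (hf : Measurable f) (hg : Measurable g) (hh : Measurable h)
    (f0 : ∀ x, 0 ≤ f x) (g0 : ∀ x, 0 ≤ g x) (h0 : ∀ x, 0 ≤ h x)
    (f1 : ∀ x, f x ≤ 1) (g1 : ∀ x, g x ≤ 1)
    (fs : ∀ r < 1, ∃ x, r < f x) (gs : ∀ r < 1, ∃ x, r < g x)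
    (H : ∀ x y, f x * g y ≤ h ((2⁻¹ : ℝ) • (x + y)) ^ 2) :
    (∫⁻ x, ENNReal.ofReal (f x)) + ∫⁻ x, ENNReal.ofReal (g x)
      ≤ 2 * ∫⁻ x, ENNReal.ofReal (h x) := by
  have cut : ∀ f : ℝ → ℝ, Measurable f → (∀ x, 0 ≤ f x) → (∀ x, f x ≤ 1) →
      ∫⁻ x, ENNReal.ofReal (f x) = ∫⁻ t in Ioo 0 1, volume {a : ℝ | t < f a} := by
    intro f hf f0 f1
    rw [lintegral_eq_lintegral_meas_lt _ (Eventually.of_forall f0) hf.aemeasurable]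
    have hs : Ioo (0 : ℝ) 1 = Ioo 0 1 ∩ Ioi 0 := by
      ext t
      simp +contextual
    rw [hs, ← setLIntegral_indicator measurableSet_Ioo]
    refine setLIntegral_congr_fun measurableSet_Ioi fun t ht => ?_
    by_cases h1 : t < 1
    · simp [indicator_of_mem (show t ∈ Ioo (0 : ℝ) 1 from ⟨ht, h1⟩)]
    · have : {a : ℝ | t < f a} = ∅ := by
        ext a
        simp only [mem_ofPred_eq, mem_empty_iff_false, iff_false, not_lt]
        exact (f1 a).trans (not_lt.1 h1)
      simp [this, h1]
  have hmeas : ∀ f : ℝ → ℝ, Measurable (fun t : ℝ => volume {a : ℝ | t < f a}) := by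
    intro f
    refine Antitone.measurable ?_
    intro s t hst
    exact measure_mono fun a ha => lt_of_le_of_lt hst ha
  rw [cut f hf f0 f1, cut g hg g0 g1,
    lintegral_eq_lintegral_meas_lt _ (Eventually.of_forall h0) hh.aemeasurable,
    ← lintegral_add_left (hmeas f), ← lintegral_const_mul _ (hmeas h)]
  refine le_trans ?_ (lintegral_mono_set (fun x (hx : x ∈ Ioo (0 : ℝ) 1) => hx.1))
  refine setLIntegral_mono ((hmeas h).const_mul 2) ?_
  rintro t ⟨t0, t1⟩
  have e : 2 * volume {a : ℝ | t < h a}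
      = volume ((fun x : ℝ => (2⁻¹ : ℝ) • x) ⁻¹' {a : ℝ | t < h a}) := by
    rw [Measure.addHaar_preimage_smul _ (by norm_num)]
    simp
  rw [e]
  refine Real.volume_add_volume_le (measurableSet_lt measurable_const hf)
    (measurableSet_lt measurable_const hg) (fs t t1) (gs t t1) ?_
  intro x hx y hy
  simp only [mem_ofPred_eq, mem_preimage] at hx hy ⊢
  have := H x y
  have h3 : t ^ 2 < h ((2⁻¹ : ℝ) • (x + y)) ^ 2 := by
    refine lt_of_lt_of_le ?_ this
    nlinarith
  exact lt_of_pow_lt_pow_left₀ 2 (h0 _) h3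

theorem prekopaLeindler_real_of_bounded {f g h : ℝ → ℝ≥0∞}
    (hf : Measurable f) (hg : Measurable g) (hh : Measurable h)
    (fb : ⨆ x, f x ≠ ∞) (gb : ⨆ x, g x ≠ ∞)
    (H : ∀ x y, f x * g y ≤ h ((2⁻¹ : ℝ) • (x + y)) ^ 2) :
    (∫⁻ x, f x) * (∫⁻ x, g x) ≤ (∫⁻ x, h x) ^ 2 := by
  set α := ⨆ x, f x with hα
  set β := ⨆ x, g x with hβ
  have fα : ∀ x, f x ≤ α := le_iSup f
  have gβ : ∀ x, g x ≤ β := le_iSup g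
  rcases eq_or_ne α 0 with a0 | a0
  · have : ∀ x, f x = 0 := fun x => le_antisymm (by simpa [a0] using fα x) bot_le
    simp [this]
  rcases eq_or_ne β 0 with b0 | b0
  · have : ∀ x, g x = 0 := fun x => le_antisymm (by simpa [b0] using gβ x) bot_le
    simp [this]
  obtain ⟨γ, hγ⟩ : ∃ γ : ℝ≥0∞, γ ^ 2 = α * β := by
    refine ⟨(α * β) ^ (2⁻¹ : ℝ), ?_⟩
    rw [← ENNReal.rpow_natCast, ← ENNReal.rpow_mul]
    simp
  have g0 : γ ≠ 0 := by
    rintro rfl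
    simp [eq_comm, a0, b0] at hγ
  have gt : γ ≠ ∞ := by
    rintro rfl
    simp only [ne_eq, OfNat.ofNat_ne_zero, not_false_eq_true, ENNReal.top_pow] at hγ
    exact ENNReal.mul_ne_top fb gb hγ.symm
  have sup1 : ∀ (f : ℝ → ℝ≥0∞) (α : ℝ≥0∞), (∀ x, f x ≤ α) → α ≠ 0 → α ≠ ∞ → α = ⨆ x, f x →
      ∀ r < 1, ∃ x, r < (f x / α).toReal := by
    intro f α hf a0 at' ha r hr
    rcases lt_or_ge r 0 with h0 | h0
    · exact ⟨0, h0.trans_le ENNReal.toReal_nonneg⟩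
    have : ENNReal.ofReal r * α < ⨆ x, f x := by
      rw [← ha]
      calc ENNReal.ofReal r * α < 1 * α := by
            refine ENNReal.mul_lt_mul_left a0 at' ?_
            simpa using hr
        _ = α := one_mul _
    obtain ⟨x, hx⟩ := lt_iSup_iff.1 this
    refine ⟨x, ?_⟩
    have hfx : f x / α ≠ ∞ := ENNReal.div_ne_top (ne_top_of_le_ne_top at' (hf x)) a0
    rw [← ENNReal.ofReal_lt_iff_lt_toReal h0 hfx]
    rwa [ENNReal.lt_div_iff_mul_lt (Or.inl a0) (Or.inl at')]
  have le1 : ∀ (f : ℝ → ℝ≥0∞) (α : ℝ≥0∞), (∀ x, f x ≤ α) → ∀ x, f x / α ≤ 1 :=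
    fun f α hf x => ENNReal.div_le_of_le_mul (by simpa using hf x)
  have main := Real.lintegral_add_lintegral_le_of_le_one
    (f := fun x => (f x / α).toReal) (g := fun x => (g x / β).toReal)
    (h := fun x => (min (h x / γ) 1).toReal)
    (hf.div_const α).ennreal_toReal (hg.div_const β).ennreal_toReal
    ((hh.div_const γ).min measurable_const).ennreal_toReal
    (fun _ => ENNReal.toReal_nonneg) (fun _ => ENNReal.toReal_nonneg)
    (fun _ => ENNReal.toReal_nonneg)
    (fun x => ENNReal.toReal_le_of_le_ofReal zero_le_one (by simpa using le1 f α fα x))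
    (fun x => ENNReal.toReal_le_of_le_ofReal zero_le_one (by simpa using le1 g β gβ x))
    (sup1 f α fα a0 fb hα) (sup1 g β gβ b0 gb hβ) ?_
  · have fin : ∀ {a : ℝ≥0∞}, a ≤ 1 → ENNReal.ofReal a.toReal = a :=
      fun ha => ENNReal.ofReal_toReal (ne_top_of_le_ne_top (by simp) ha)
    simp only [fin (le1 f α fα _), fin (le1 g β gβ _), fin (min_le_right _ _)] at main
    have main2 := ENNReal.mul_le_sq_of_add_le_two_mul main
    have e1 : ∫⁻ x, f x = α * ∫⁻ x, f x / α := by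
      rw [← lintegral_const_mul _ (hf.div_const α)]
      simp only [ENNReal.mul_div_cancel a0 fb]
    have e2 : ∫⁻ x, g x = β * ∫⁻ x, g x / β := by
      rw [← lintegral_const_mul _ (hg.div_const β)]
      simp only [ENNReal.mul_div_cancel b0 gb]
    have e3 : γ * ∫⁻ x, min (h x / γ) 1 ≤ ∫⁻ x, h x := by
      rw [← lintegral_const_mul _ ((hh.div_const γ).min measurable_const)]
      refine lintegral_mono fun x => ?_
      calc γ * min (h x / γ) 1 ≤ γ * (h x / γ) := by gcongr; exact min_le_left _ _
        _ = h x := ENNReal.mul_div_cancel g0 gt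
    calc (∫⁻ x, f x) * (∫⁻ x, g x)
        = γ ^ 2 * ((∫⁻ x, f x / α) * ∫⁻ x, g x / β) := by rw [e1, e2, hγ]; ring
      _ ≤ γ ^ 2 * (∫⁻ x, min (h x / γ) 1) ^ 2 := by gcongr
      _ = (γ * ∫⁻ x, min (h x / γ) 1) ^ 2 := by ring
      _ ≤ _ := by gcongr
  · intro x y
    rw [← ENNReal.toReal_mul, ← ENNReal.toReal_pow]
    refine ENNReal.toReal_mono (ENNReal.pow_ne_top
      (ne_top_of_le_ne_top (by simp) (min_le_right _ _))) ?_
    rcases le_total (h ((2⁻¹ : ℝ) • (x + y)) / γ) 1 with hc | hc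
    · rw [min_eq_left hc]
      calc f x / α * (g y / β) = (f x * g y) / γ ^ 2 := by
            rw [hγ, div_eq_mul_inv, div_eq_mul_inv, div_eq_mul_inv,
              ENNReal.mul_inv (Or.inl a0) (Or.inl fb)]
            ring
        _ ≤ h ((2⁻¹ : ℝ) • (x + y)) ^ 2 / γ ^ 2 := by gcongr; exact H x y
        _ = _ := by rw [div_eq_mul_inv, div_eq_mul_inv, mul_pow, ENNReal.inv_pow]
    · rw [min_eq_right hc, one_pow]
      calc f x / α * (g y / β) ≤ 1 * 1 := mul_le_mul' (le1 f α fα x) (le1 g β gβ y)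
        _ = 1 := one_mul 1

theorem prekopaLeindler_real : PrekopaLeindler ℝ := by
  intro f g h hf hg hh H
  have approx : ∀ f : ℝ → ℝ≥0∞, Measurable f →
      ∫⁻ x, f x = ⨆ n : ℕ, ∫⁻ x, min (f x) n := by
    intro f hf
    have mono : Monotone fun (n : ℕ) (x : ℝ) => min (f x) (n : ℝ≥0∞) := by
      intro m n hmn x
      simp only
      gcongr
    rw [← lintegral_iSup (fun n => hf.min measurable_const) mono]
    congr with x
    rw [← inf_iSup_eq (f x) (fun n : ℕ => (n : ℝ≥0∞)), ENNReal.iSup_natCast]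
    simp
  rw [approx f hf, approx g hg]
  simp only [ENNReal.iSup_mul, ENNReal.mul_iSup]
  refine iSup_le fun n => iSup_le fun m => ?_
  have fin : ∀ (f : ℝ → ℝ≥0∞) (n : ℕ), ⨆ x, min (f x) (n : ℝ≥0∞) ≠ ∞ := fun f n =>
    ne_top_of_le_ne_top (ENNReal.natCast_ne_top n) (iSup_le fun x => min_le_right _ _)
  refine prekopaLeindler_real_of_bounded (hf.min measurable_const) (hg.min measurable_const) hh
    (fin f _) (fin g _) fun x y => le_trans ?_ (H x y)
  gcongr <;> exact min_le_left _ _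

theorem PrekopaLeindler.prod {V W : Type*} [AddCommGroup V] [Module ℝ V] [MeasureSpace V]
    [AddCommGroup W] [Module ℝ W] [MeasureSpace W] [SFinite (volume : Measure V)]
    [SFinite (volume : Measure W)]
    (hV : PrekopaLeindler V) (hW : PrekopaLeindler W) : PrekopaLeindler (V × W) := by
  intro f g h hf hg hh H
  rw [Measure.volume_eq_prod, lintegral_prod _ hf.aemeasurable, lintegral_prod _ hg.aemeasurable,
    lintegral_prod _ hh.aemeasurable]
  refine hV _ _ _ hf.lintegral_prod_right' hg.lintegral_prod_right' hh.lintegral_prod_right' ?_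
  intro x y
  exact hW _ _ _ (hf.comp measurable_prodMk_left) (hg.comp measurable_prodMk_left)
    (hh.comp measurable_prodMk_left) fun a b => by simpa using H (x, a) (y, b)

theorem PrekopaLeindler.of_measurePreserving {V W : Type*} [AddCommGroup V] [Module ℝ V]
    [MeasureSpace V] [AddCommGroup W] [Module ℝ W] [MeasureSpace W] (e : V →ₗ[ℝ] W)
    (he : MeasurePreserving e) (hV : PrekopaLeindler V) : PrekopaLeindler W := by
  intro f g h hf hg hh H
  rw [← he.lintegral_comp hf, ← he.lintegral_comp hg, ← he.lintegral_comp hh]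
  exact hV _ _ _ (hf.comp he.measurable) (hg.comp he.measurable) (hh.comp he.measurable)
    fun x y => by simpa using H (e x) (e y)

theorem prekopaLeindler_pi (n : ℕ) : PrekopaLeindler (Fin n → ℝ) := by
  induction n with
  | zero =>
    intro f g h hf hg hh H
    rw [volume_pi, Measure.pi_of_empty, lintegral_dirac, lintegral_dirac, lintegral_dirac]
    convert H isEmptyElim isEmptyElim
  | succ n ih =>
    let e : (ℝ × (Fin n → ℝ)) →ₗ[ℝ] (Fin (n + 1) → ℝ) :=
      { toFun := fun p => Fin.cons p.1 p.2
        map_add' := fun p q => by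
          ext i
          refine Fin.cases ?_ (fun j => ?_) i <;> simp
        map_smul' := fun c p => by
          ext i
          refine Fin.cases ?_ (fun j => ?_) i <;> simp }
    refine PrekopaLeindler.of_measurePreserving e ?_ (prekopaLeindler_real.prod ih)
    have := (volume_preserving_piFinSuccAbove (fun _ : Fin (n + 1) => ℝ) 0).symm
    convert! this using 1
    ext p i
    simp [e, Fin.insertNthEquiv]

theorem prekopaLeindler_euclideanSpace (n : ℕ) : PrekopaLeindler (EuclideanSpace ℝ (Fin n)) :=
  (prekopaLeindler_pi n).of_measurePreserving
    (WithLp.linearEquiv 2 ℝ (Fin n → ℝ)).symm.toLinearMap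
    (PiLp.volume_preserving_toLp (Fin n))

/-- Multiplicative **Brunn–Minkowski inequality** for midpoints. -/
theorem volume_mul_volume_le_sq {n : ℕ} {A B C : Set (EuclideanSpace ℝ (Fin n))}
    (hA : MeasurableSet A) (hB : MeasurableSet B) (hC : MeasurableSet C)
    (H : ∀ x ∈ A, ∀ y ∈ B, (2⁻¹ : ℝ) • (x + y) ∈ C) :
    volume A * volume B ≤ volume C ^ 2 := by
  have := prekopaLeindler_euclideanSpace n (A.indicator 1) (B.indicator 1) (C.indicator 1)
    (measurable_one.indicator hA) (measurable_one.indicator hB) (measurable_one.indicator hC) ?_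
  · simpa [lintegral_indicator_one, hA, hB, hC] using this
  · intro x y
    by_cases hx : x ∈ A
    · by_cases hy : y ∈ B
      · rw [indicator_of_mem (H x hx y hy)]
        simp [hx, hy]
      · simp [hy]
    · simp [hx]

/-- A convex body with nonempty interior whose outer unit normal field `ν` is `C¹` near the
boundary, with positive definite differential on the tangent spaces. -/
structure SmoothBody {V : Type*} [NormedAddCommGroup V] [InnerProductSpace ℝ V]
    (K : Set V) (ν : V → V) : Prop where
  conv : Convex ℝ K
  compact : IsCompact K
  int : (interior K).Nonempty
  smooth : ∀ x ∈ frontier K, ContDiffAt ℝ 1 ν x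
  unit : ∀ x ∈ frontier K, ‖ν x‖ = 1
  outer : ∀ x ∈ frontier K, ∀ y ∈ K, ⟪y - x, ν x⟫ ≤ 0
  curv : ∀ x ∈ frontier K, ∀ v, ⟪v, ν x⟫ = 0 → v ≠ 0 → 0 < ⟪fderiv ℝ ν x v, v⟫

section Gauge

variable {V : Type*} [NormedAddCommGroup V] [InnerProductSpace ℝ V]
  {K : Set V} {ν : V → V}

/-- A function with a continuous selection of subgradients is differentiable. -/
theorem hasFDerivAt_of_subgradient {g : V → ℝ} {N : V → V} {y : V}
    (hsub : ∀ᶠ z in 𝓝 y, g z + ⟪y - z, N z⟫ ≤ g y)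
    (hsub' : ∀ᶠ z in 𝓝 y, g y + ⟪z - y, N y⟫ ≤ g z)
    (hN : ContinuousAt N y) : HasFDerivAt g (innerSL ℝ (N y)) y := by
  rw [hasFDerivAt_iff_isLittleO, Asymptotics.isLittleO_iff]
  intro c hc
  have h1 : ∀ᶠ z in 𝓝 y, ‖N z - N y‖ < c := by
    have := (Metric.tendsto_nhds.1 hN) c hc
    simpa [dist_eq_norm] using this
  filter_upwards [hsub, hsub', h1] with z h2 h3 h4
  have h5 : ⟪z - y, N z - N y⟫ ≤ ‖z - y‖ * ‖N z - N y‖ := real_inner_le_norm _ _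
  have h6 : ‖z - y‖ * ‖N z - N y‖ ≤ c * ‖z - y‖ := by
    rw [mul_comm]; gcongr
  have h7 : ⟪y - z, N z⟫ = - ⟪z - y, N z⟫ := by rw [← inner_neg_left, neg_sub]
  rw [inner_sub_right] at h5
  rw [Real.norm_eq_abs, innerSL_apply_apply, real_inner_comm, abs_le]
  constructor <;> nlinarith [norm_nonneg (z - y)]

theorem SmoothBody.isClosed (h : SmoothBody K ν) : IsClosed K := h.compact.isClosed

theorem SmoothBody.frontier_subset (h : SmoothBody K ν) : frontier K ⊆ K :=
  h.isClosed.frontier_subset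

theorem SmoothBody.continuousOn (h : SmoothBody K ν) : ContinuousOn ν (frontier K) :=
  fun x hx => (h.smooth x hx).continuousAt.continuousWithinAt

/-- The support value is positive when the origin is interior. -/
theorem SmoothBody.support_pos (h : SmoothBody K ν) (h0 : (0 : V) ∈ interior K) {x : V}
    (hx : x ∈ frontier K) : 0 < ⟪x, ν x⟫ := by
  obtain ⟨r, hr, hrK⟩ := Metric.isOpen_iff.1 isOpen_interior 0 h0
  have hmem : (r / 2) • ν x ∈ K := by
    apply interior_subset
    apply hrK
    rw [mem_ball_zero_iff, norm_smul, h.unit x hx, Real.norm_eq_abs, abs_of_pos (by positivity)]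
    linarith
  have := h.outer x hx _ hmem
  rw [inner_sub_left, real_inner_smul_left, real_inner_self_eq_norm_sq, h.unit x hx] at this
  linarith

/-- Radial projection to the boundary. -/
def radial (K : Set V) (y : V) : V := (gauge K y)⁻¹ • y

/-- The gradient of the gauge. -/
def gaugeGrad (K : Set V) (ν : V → V) (y : V) : V :=
  (⟪radial K y, ν (radial K y)⟫)⁻¹ • ν (radial K y)

theorem SmoothBody.gauge_pos (h : SmoothBody K ν) (h0 : (0 : V) ∈ interior K) {y : V}
    (hy : y ≠ 0) : 0 < gauge K y :=
  (_root_.gauge_pos (absorbent_nhds_zero (mem_interior_iff_mem_nhds.1 h0))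
    ((NormedSpace.isVonNBounded_iff ℝ).2 h.compact.isBounded)).2 hy

theorem SmoothBody.radial_mem (h : SmoothBody K ν) (h0 : (0 : V) ∈ interior K) {y : V}
    (hy : y ≠ 0) : radial K y ∈ frontier K := by
  have hp := h.gauge_pos h0 hy
  rw [← gauge_eq_one_iff_mem_frontier h.conv (mem_interior_iff_mem_nhds.1 h0), radial,
    gauge_smul_of_nonneg (inv_nonneg.2 hp.le), smul_eq_mul, inv_mul_cancel₀ hp.ne']

theorem SmoothBody.gauge_eq_one (h : SmoothBody K ν) (h0 : (0 : V) ∈ interior K) {x : V}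
    (hx : x ∈ frontier K) : gauge K x = 1 :=
  (gauge_eq_one_iff_mem_frontier h.conv (mem_interior_iff_mem_nhds.1 h0)).2 hx

theorem SmoothBody.radial_eq (h : SmoothBody K ν) (h0 : (0 : V) ∈ interior K) {x : V}
    (hx : x ∈ frontier K) : radial K x = x := by
  rw [radial, h.gauge_eq_one h0 hx, inv_one, one_smul]

theorem SmoothBody.ne_zero (_h : SmoothBody K ν) (h0 : (0 : V) ∈ interior K) {x : V}
    (hx : x ∈ frontier K) : x ≠ 0 := by
  rintro rfl
  exact hx.2 h0

/-- If `u` is normal at `x` then `u / ⟪x, u⟫` is a subgradient of the gauge. -/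
theorem SmoothBody.inner_le_gauge (h : SmoothBody K ν) (h0 : (0 : V) ∈ interior K)
    {x u : V} (hu : ∀ y ∈ K, ⟪y - x, u⟫ ≤ 0) (hpos : 0 < ⟪x, u⟫) (y : V) :
    ⟪y, (⟪x, u⟫)⁻¹ • u⟫ ≤ gauge K y := by
  by_cases hy : y = 0
  · subst hy; simp
  have hp := h.gauge_pos h0 hy
  have := hu _ (h.frontier_subset (h.radial_mem h0 hy))
  rw [inner_sub_left, radial, real_inner_smul_left] at this
  rw [real_inner_smul_right, inv_mul_le_iff₀ hpos]
  have h2 : (gauge K y)⁻¹ * ⟪y, u⟫ ≤ ⟪x, u⟫ := by linarith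
  rw [inv_mul_le_iff₀ hp] at h2
  linarith [mul_comm (gauge K y) ⟪x, u⟫]

theorem SmoothBody.gaugeGrad_le (h : SmoothBody K ν) (h0 : (0 : V) ∈ interior K)
    {y : V} (hy : y ≠ 0) (y' : V) : ⟪y', gaugeGrad K ν y⟫ ≤ gauge K y' :=
  h.inner_le_gauge h0 (h.outer _ (h.radial_mem h0 hy))
    (h.support_pos h0 (h.radial_mem h0 hy)) y'

theorem SmoothBody.gaugeGrad_self (h : SmoothBody K ν) (h0 : (0 : V) ∈ interior K)
    {y : V} (hy : y ≠ 0) : ⟪y, gaugeGrad K ν y⟫ = gauge K y := by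
  have hp := h.gauge_pos h0 hy
  have h1 := h.support_pos h0 (h.radial_mem h0 hy)
  have h2 : y = gauge K y • radial K y := by
    rw [radial, smul_smul, mul_inv_cancel₀ hp.ne', one_smul]
  conv_lhs => rw [h2, gaugeGrad]
  rw [real_inner_smul_left]
  have h3 : radial K (gauge K y • radial K y) = radial K y := by rw [← h2]
  rw [h3, real_inner_smul_right, inv_mul_cancel₀ h1.ne', mul_one]

theorem SmoothBody.continuousAt_radial (h : SmoothBody K ν) (h0 : (0 : V) ∈ interior K)
    {y : V} (hy : y ≠ 0) : ContinuousAt (radial K) y := by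
  have hc : Continuous (gauge K) := continuous_gauge h.conv (mem_interior_iff_mem_nhds.1 h0)
  exact (hc.continuousAt.inv₀ (h.gauge_pos h0 hy).ne').smul continuousAt_id

theorem SmoothBody.continuousAt_gaugeGrad (h : SmoothBody K ν) (h0 : (0 : V) ∈ interior K)
    {y : V} (hy : y ≠ 0) : ContinuousAt (gaugeGrad K ν) y := by
  have h1 := h.continuousAt_radial h0 hy
  have h2 : ContinuousAt (fun y => ν (radial K y)) y :=
    ContinuousAt.comp (h.smooth _ (h.radial_mem h0 hy)).continuousAt h1
  exact ((ContinuousAt.inner h1 h2 (𝕜 := ℝ)).inv₀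
    (h.support_pos h0 (h.radial_mem h0 hy)).ne').smul h2

theorem SmoothBody.hasFDerivAt_gauge (h : SmoothBody K ν) (h0 : (0 : V) ∈ interior K)
    {y : V} (hy : y ≠ 0) : HasFDerivAt (gauge K) (innerSL ℝ (gaugeGrad K ν y)) y := by
  apply hasFDerivAt_of_subgradient _ _ (h.continuousAt_gaugeGrad h0 hy)
  · filter_upwards [isOpen_ne.mem_nhds hy] with z hz
    rw [inner_sub_left, h.gaugeGrad_self h0 hz]
    linarith [h.gaugeGrad_le h0 hz y]
  · filter_upwards with z
    rw [inner_sub_left, h.gaugeGrad_self h0 hy]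
    linarith [h.gaugeGrad_le h0 hy z]

theorem SmoothBody.contDiffAt_gauge (h : SmoothBody K ν) (h0 : (0 : V) ∈ interior K)
    {y : V} (hy : y ≠ 0) : ContDiffAt ℝ 1 (gauge K) y := by
  rw [contDiffAt_one_iff]
  refine ⟨fun z => innerSL ℝ (gaugeGrad K ν z), {z | z ≠ 0}, isOpen_ne.mem_nhds hy, ?_,
    fun z hz => h.hasFDerivAt_gauge h0 hz⟩
  intro z hz
  exact ((innerSL ℝ).continuous.continuousAt.comp
    (h.continuousAt_gaugeGrad h0 hz)).continuousWithinAt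

theorem SmoothBody.contDiffAt_radial (h : SmoothBody K ν) (h0 : (0 : V) ∈ interior K)
    {y : V} (hy : y ≠ 0) : ContDiffAt ℝ 1 (radial K) y :=
  ((h.contDiffAt_gauge h0 hy).inv (h.gauge_pos h0 hy).ne').smul contDiffAt_id

theorem SmoothBody.contDiffAt_normal_radial (h : SmoothBody K ν) (h0 : (0 : V) ∈ interior K)
    {y : V} (hy : y ≠ 0) : ContDiffAt ℝ 1 (fun y => ν (radial K y)) y :=
  (h.smooth _ (h.radial_mem h0 hy)).comp y (h.contDiffAt_radial h0 hy)

theorem SmoothBody.contDiffAt_gaugeGrad (h : SmoothBody K ν) (h0 : (0 : V) ∈ interior K)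
    {y : V} (hy : y ≠ 0) : ContDiffAt ℝ 1 (gaugeGrad K ν) y :=
  (((h.contDiffAt_radial h0 hy).inner ℝ (h.contDiffAt_normal_radial h0 hy)).inv
    (h.support_pos h0 (h.radial_mem h0 hy)).ne').smul (h.contDiffAt_normal_radial h0 hy)

/-- The radial extension of the normal has the same tangential derivative as `ν`. -/
theorem SmoothBody.fderiv_normal_radial (h : SmoothBody K ν) (h0 : (0 : V) ∈ interior K)
    {x : V} (hx : x ∈ frontier K) {v : V} (hv : ⟪v, ν x⟫ = 0) :
    fderiv ℝ (fun y => ν (radial K y)) x v = fderiv ℝ ν x v := by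
  have hx0 := h.ne_zero h0 hx
  have hr := h.radial_eq h0 hx
  have h1 : HasFDerivAt (radial K) (fderiv ℝ (radial K) x) x :=
    ((h.contDiffAt_radial h0 hx0).differentiableAt one_ne_zero).hasFDerivAt
  have h2 : HasFDerivAt ν (fderiv ℝ ν x) (radial K x) := by
    rw [hr]; exact ((h.smooth x hx).differentiableAt one_ne_zero).hasFDerivAt
  have h3 := (h2.comp x h1).fderiv
  change fderiv ℝ (ν ∘ radial K) x v = _
  rw [h3, ContinuousLinearMap.comp_apply]
  congr 1
  have hg : HasFDerivAt (fun y => (gauge K y)⁻¹) _ x :=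
    (hasFDerivAt_inv (h.gauge_pos h0 hx0).ne').comp x (h.hasFDerivAt_gauge h0 hx0)
  have h4 : HasFDerivAt (radial K) _ x := hg.smul (hasFDerivAt_id x)
  rw [h4.fderiv]
  have h5 : ⟪gaugeGrad K ν x, v⟫ = 0 := by
    rw [gaugeGrad, hr, real_inner_smul_left, real_inner_comm v, hv, mul_zero]
  simp [h.gauge_eq_one h0 hx, h5]

theorem SmoothBody.inner_fderiv_gaugeGrad (h : SmoothBody K ν) (h0 : (0 : V) ∈ interior K)
    {x : V} (hx : x ∈ frontier K) {v w : V} (hv : ⟪v, ν x⟫ = 0) (hw : ⟪w, ν x⟫ = 0) :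
    ⟪x, ν x⟫ * ⟪fderiv ℝ (gaugeGrad K ν) x v, w⟫ = ⟪fderiv ℝ ν x v, w⟫ := by
  have hx0 := h.ne_zero h0 hx
  have hr := h.radial_eq h0 hx
  have hd : DifferentiableAt ℝ (fun y => ν (radial K y)) x :=
    (h.contDiffAt_normal_radial h0 hx0).differentiableAt one_ne_zero
  have hb : DifferentiableAt ℝ (fun y => (⟪radial K y, ν (radial K y)⟫)⁻¹) x :=
    (((h.contDiffAt_radial h0 hx0).inner ℝ (h.contDiffAt_normal_radial h0 hx0)).inv
    (h.support_pos h0 (h.radial_mem h0 hx0)).ne').differentiableAt one_ne_zero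
  have hN : HasFDerivAt (gaugeGrad K ν) _ x := hb.hasFDerivAt.smul hd.hasFDerivAt
  rw [hN.fderiv]
  have hw' : ⟪ν x, w⟫ = 0 := by rw [real_inner_comm]; exact hw
  have hp := h.support_pos h0 hx
  simp only [_root_.add_apply, _root_.smul_apply,
    ContinuousLinearMap.smulRight_apply, inner_add_left, real_inner_smul_left, hr, hw',
    h.fderiv_normal_radial h0 hx hv]
  field_simp
  ring

theorem SmoothBody.gaugeGrad_symm (h : SmoothBody K ν) (h0 : (0 : V) ∈ interior K)
    {x : V} (hx : x ≠ 0) (v w : V) :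
    ⟪fderiv ℝ (gaugeGrad K ν) x v, w⟫ = ⟪fderiv ℝ (gaugeGrad K ν) x w, v⟫ := by
  have h1 : ∀ᶠ y in 𝓝 x, HasFDerivAt (gauge K) (innerSL ℝ (gaugeGrad K ν y)) y := by
    filter_upwards [isOpen_ne.mem_nhds hx] with z hz using h.hasFDerivAt_gauge h0 hz
  have h2 : HasFDerivAt (gaugeGrad K ν) (fderiv ℝ (gaugeGrad K ν) x) x :=
    ((h.contDiffAt_gaugeGrad h0 hx).differentiableAt one_ne_zero).hasFDerivAt
  have h3 : HasFDerivAt (fun y => innerSL ℝ (gaugeGrad K ν y))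
      ((innerSL ℝ (E := V)).comp (fderiv ℝ (gaugeGrad K ν) x)) x :=
    (innerSL ℝ (E := V)).hasFDerivAt.comp x h2
  have := second_derivative_symmetric_of_eventually h1 h3 v w
  simpa using this

theorem SmoothBody.normal_unique_zero (h : SmoothBody K ν) (h0 : (0 : V) ∈ interior K)
    {x u : V} (hx : x ∈ frontier K) (hu1 : ‖u‖ = 1) (hu : ∀ y ∈ K, ⟪y - x, u⟫ ≤ 0) :
    u = ν x := by
  have hx0 := h.ne_zero h0 hx
  have hpos : 0 < ⟪x, u⟫ := by
    obtain ⟨r, hr, hrK⟩ := Metric.isOpen_iff.1 isOpen_interior 0 h0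
    have hmem : (r / 2) • u ∈ K := by
      apply interior_subset
      apply hrK
      rw [mem_ball_zero_iff, norm_smul, hu1, Real.norm_eq_abs, abs_of_pos (by positivity)]
      linarith
    have := hu _ hmem
    rw [inner_sub_left, real_inner_smul_left, real_inner_self_eq_norm_sq, hu1] at this
    linarith
  have hmin : IsLocalMin (fun y => gauge K y - ⟪(⟪x, u⟫)⁻¹ • u, y⟫) x := by
    filter_upwards with y
    have := h.inner_le_gauge h0 hu hpos y
    rw [real_inner_comm] at this
    rw [h.gauge_eq_one h0 hx, real_inner_smul_left _ x, real_inner_comm x u,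
      inv_mul_cancel₀ hpos.ne']
    linarith
  have hd : HasFDerivAt (fun y => gauge K y - ⟪(⟪x, u⟫)⁻¹ • u, y⟫) _ x :=
    (h.hasFDerivAt_gauge h0 hx0).sub (innerSL ℝ ((⟪x, u⟫)⁻¹ • u)).hasFDerivAt
  have he := hmin.hasFDerivAt_eq_zero hd
  have he2 : gaugeGrad K ν x = (⟪x, u⟫)⁻¹ • u := by
    apply ext_inner_right ℝ
    intro w
    have := DFunLike.congr_fun he w
    simp only [_root_.sub_apply, innerSL_apply_apply, _root_.zero_apply] at this
    linarith
  rw [gaugeGrad, h.radial_eq h0 hx] at he2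
  have hp := h.support_pos h0 hx
  have hn := congrArg norm he2
  rw [norm_smul, norm_smul, hu1, h.unit x hx, norm_inv, norm_inv, Real.norm_eq_abs,
    Real.norm_eq_abs, abs_of_pos hp, abs_of_pos hpos, mul_one, mul_one] at hn
  rw [hn] at he2
  exact (smul_right_injective V (inv_pos.2 hpos).ne' he2).symm

theorem SmoothBody.fderiv_symm_zero (h : SmoothBody K ν) (h0 : (0 : V) ∈ interior K)
    {x : V} (hx : x ∈ frontier K) {v w : V} (hv : ⟪v, ν x⟫ = 0) (hw : ⟪w, ν x⟫ = 0) :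
    ⟪fderiv ℝ ν x v, w⟫ = ⟪fderiv ℝ ν x w, v⟫ := by
  rw [← h.inner_fderiv_gaugeGrad h0 hx hv hw, ← h.inner_fderiv_gaugeGrad h0 hx hw hv,
    h.gaugeGrad_symm h0 (h.ne_zero h0 hx)]

theorem SmoothBody.fderiv_tangent_zero (h : SmoothBody K ν) (h0 : (0 : V) ∈ interior K)
    {x : V} (hx : x ∈ frontier K) {v : V} (hv : ⟪v, ν x⟫ = 0) :
    ⟪fderiv ℝ ν x v, ν x⟫ = 0 := by
  have hx0 := h.ne_zero h0 hx
  have hd := ((h.contDiffAt_normal_radial h0 hx0).differentiableAt one_ne_zero).hasFDerivAt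
  have h1 := HasFDerivAt.inner ℝ hd hd
  have h2 : (fun y => ⟪ν (radial K y), ν (radial K y)⟫) =ᶠ[𝓝 x] fun _ => (1 : ℝ) := by
    filter_upwards [isOpen_ne.mem_nhds hx0] with z hz
    rw [real_inner_self_eq_norm_sq, h.unit _ (h.radial_mem h0 hz), one_pow]
  have h3 := (h1.congr_of_eventuallyEq h2.symm).unique (hasFDerivAt_const (1 : ℝ) x)
  have h4 := DFunLike.congr_fun h3 v
  simp [h.radial_eq h0 hx, h.fderiv_normal_radial h0 hx hv, fderivInnerCLM_apply] at h4
  rw [real_inner_comm] at h4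
  linarith

end Gauge

section Taylor

variable {V : Type*} [NormedAddCommGroup V] [InnerProductSpace ℝ V]
  {K : Set V} {ν : V → V}

/-- Orthogonal projection onto the orthogonal complement of the unit vector `u`. -/
def tp (u : V) : V →L[ℝ] V :=
  ContinuousLinearMap.id ℝ V - (innerSL ℝ u).smulRight u

theorem tp_apply (u v : V) : tp u v = v - ⟪u, v⟫ • u := by
  simp [tp]

theorem tp_inner {u : V} (hu : ‖u‖ = 1) (v : V) : ⟪tp u v, u⟫ = 0 := by
  rw [tp_apply, inner_sub_left, real_inner_smul_left, real_inner_self_eq_norm_sq, hu,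
    real_inner_comm]
  ring

theorem tp_of_inner {u v : V} (h : ⟪v, u⟫ = 0) : tp u v = v := by
  rw [tp_apply, real_inner_comm, h, zero_smul, sub_zero]

theorem tp_self {u : V} (hu : ‖u‖ = 1) : tp u u = 0 := by
  rw [tp_apply, real_inner_self_eq_norm_sq, hu]; simp

theorem norm_sq_tp {u : V} (hu : ‖u‖ = 1) (v : V) : ‖v‖ ^ 2 = ‖tp u v‖ ^ 2 + ⟪u, v⟫ ^ 2 := by
  have h : v = tp u v + ⟪u, v⟫ • u := by rw [tp_apply]; abel
  have h2 : ‖tp u v + ⟪u, v⟫ • u‖ ^ 2 = ‖tp u v‖ ^ 2 + ⟪u, v⟫ ^ 2 := by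
    rw [norm_add_sq_real, real_inner_smul_right, tp_inner hu, norm_smul, hu, Real.norm_eq_abs,
      mul_one, sq_abs]
    ring
  rw [← h] at h2
  exact h2

theorem norm_tp_le {u : V} (hu : ‖u‖ = 1) (v : V) : ‖tp u v‖ ≤ ‖v‖ := by
  have := norm_sq_tp hu v
  exact le_of_sq_le_sq (by nlinarith [sq_nonneg ⟪u, v⟫]) (norm_nonneg _)

/-- Second order Taylor expansion, uniformly in the base point. -/
theorem taylor_isLittleO_sq {g : V → ℝ} {N : V → V} {D : V →L[ℝ] V} {x₀ : V}
    (hg : ∀ᶠ y in 𝓝 x₀, HasFDerivAt g (innerSL ℝ (N y)) y) (hN : HasStrictFDerivAt N D x₀) :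
    (fun p : V × V => g p.1 - g p.2 - ⟪p.1 - p.2, N p.2⟫ - 2⁻¹ * ⟪D (p.1 - p.2), p.1 - p.2⟫)
      =o[𝓝 (x₀, x₀)] fun p => ‖p.1 - p.2‖ ^ 2 := by
  rw [Asymptotics.isLittleO_iff]
  intro c hc
  have h1 := (Asymptotics.isLittleO_iff.1 hN.isLittleO) hc
  rw [nhds_prod_eq] at h1 ⊢
  obtain ⟨U, hU, hU'⟩ := (Filter.eventually_prod_self_iff
    (r := fun x z => ‖N x - N z - D (x - z)‖ ≤ c * ‖x - z‖)).1 h1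
  obtain ⟨r, hr, hrU⟩ := Metric.mem_nhds_iff.1 (Filter.inter_mem hU hg)
  refine (Filter.eventually_prod_self_iff (r := fun x z => ‖g x - g z - ⟪x - z, N z⟫
    - 2⁻¹ * ⟪D (x - z), x - z⟫‖ ≤ c * ‖‖x - z‖ ^ 2‖)).2 ⟨ball x₀ r, ball_mem_nhds _ hr, ?_⟩
  intro x hx z hz
  have hseg : ∀ θ ∈ Icc (0 : ℝ) 1, z + θ • (x - z) ∈ ball x₀ r := fun θ hθ =>
    (convex_ball x₀ r).add_smul_sub_mem hz hx hθ
  have hder : ∀ θ ∈ Icc (0 : ℝ) 1, HasDerivWithinAt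
      (fun θ : ℝ => g (z + θ • (x - z)) - θ * ⟪x - z, N z⟫
        - θ ^ 2 * (2⁻¹ * ⟪D (x - z), x - z⟫))
      (⟪N (z + θ • (x - z)), x - z⟫ - ⟪x - z, N z⟫ - 2 * θ * (2⁻¹ * ⟪D (x - z), x - z⟫))
      (Icc 0 1) θ := by
    intro θ hθ
    have hl : HasDerivAt (fun θ : ℝ => z + θ • (x - z)) (x - z) θ := by
      simpa using ((hasDerivAt_id θ).smul_const (x - z)).const_add z
    have h1' : HasFDerivAt g (innerSL ℝ (N (z + θ • (x - z)))) (z + θ • (x - z)) :=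
      (hrU (hseg θ hθ)).2
    have h2 : HasDerivAt (fun θ : ℝ => g (z + θ • (x - z))) ⟪N (z + θ • (x - z)), x - z⟫ θ := by
      have := h1'.comp_hasDerivAt θ hl
      rwa [innerSL_apply_apply] at this
    have h3 : HasDerivAt (fun θ : ℝ => θ * ⟪x - z, N z⟫) (⟪x - z, N z⟫) θ := by
      simpa using (hasDerivAt_id θ).mul_const ⟪x - z, N z⟫
    have h4 : HasDerivAt (fun θ : ℝ => θ ^ 2 * (2⁻¹ * ⟪D (x - z), x - z⟫))
        (2 * θ * (2⁻¹ * ⟪D (x - z), x - z⟫)) θ := by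
      simpa using (hasDerivAt_pow 2 θ).mul_const (2⁻¹ * ⟪D (x - z), x - z⟫)
    exact ((h2.sub h3).sub h4).hasDerivWithinAt
  have hb := norm_image_sub_le_of_norm_deriv_le_segment_01' (C := c * ‖x - z‖ ^ 2) hder ?_
  · have e : g (z + (1 : ℝ) • (x - z)) - 1 * ⟪x - z, N z⟫
        - 1 ^ 2 * (2⁻¹ * ⟪D (x - z), x - z⟫) -
        (g (z + (0 : ℝ) • (x - z)) - 0 * ⟪x - z, N z⟫
        - 0 ^ 2 * (2⁻¹ * ⟪D (x - z), x - z⟫)) =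
        g x - g z - ⟪x - z, N z⟫ - 2⁻¹ * ⟪D (x - z), x - z⟫ := by
      rw [one_smul, zero_smul, add_zero, add_sub_cancel]; ring
    rw [e] at hb
    simpa using hb
  · intro θ hθ
    have hθ' : θ ∈ Icc (0 : ℝ) 1 := ⟨hθ.1, hθ.2.le⟩
    have h2 := hU' _ (hrU (hseg θ hθ')).1 _ (hrU hz).1
    simp only [add_sub_cancel_left, map_smul] at h2
    have e : ⟪N (z + θ • (x - z)), x - z⟫ - ⟪x - z, N z⟫
        - 2 * θ * (2⁻¹ * ⟪D (x - z), x - z⟫) =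
        ⟪N (z + θ • (x - z)) - N z - θ • D (x - z), x - z⟫ := by
      rw [inner_sub_left (_ - _), inner_sub_left (N _), real_inner_smul_left,
        real_inner_comm (x - z) (N z)]
      ring
    rw [e]
    refine (norm_inner_le_norm _ _).trans ?_
    have h5 : ‖θ • (x - z)‖ ≤ ‖x - z‖ := by
      rw [norm_smul, Real.norm_eq_abs, abs_of_nonneg hθ.1]
      exact mul_le_of_le_one_left (norm_nonneg _) hθ.2.le
    calc _ ≤ (c * ‖θ • (x - z)‖) * ‖x - z‖ := by gcongr
      _ ≤ (c * ‖x - z‖) * ‖x - z‖ := by gcongr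
      _ = _ := by ring

theorem SmoothBody.taylor_aux (h : SmoothBody K ν) (h0 : (0 : V) ∈ interior K)
    {x₀ : V} (hx : x₀ ∈ frontier K) :
    ((fun p : V × V => ⟪p.1 - p.2, ν p.2⟫ +
        2⁻¹ * ⟪fderiv ℝ ν x₀ (tp (ν x₀) (p.1 - p.2)), tp (ν x₀) (p.1 - p.2)⟫)
      =o[𝓝[frontier K ×ˢ frontier K] (x₀, x₀)] fun p => ‖p.1 - p.2‖ ^ 2) ∧
    ((fun p : V × V => ⟪ν x₀, p.1 - p.2⟫)
      =o[𝓝[frontier K ×ˢ frontier K] (x₀, x₀)] fun p => ‖p.1 - p.2‖) := by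
  have hx0 := h.ne_zero h0 hx
  set F := 𝓝[frontier K ×ˢ frontier K] (x₀, x₀) with hF
  have hFle : F ≤ 𝓝 (x₀, x₀) := nhdsWithin_le_nhds
  set N := gaugeGrad K ν with hNdef
  set D := fderiv ℝ N x₀ with hD
  have hN : HasStrictFDerivAt N D x₀ :=
    (h.contDiffAt_gaugeGrad h0 hx0).hasStrictFDerivAt one_ne_zero
  have hg : ∀ᶠ y in 𝓝 x₀, HasFDerivAt (gauge K) (innerSL ℝ (N y)) y := by
    filter_upwards [isOpen_ne.mem_nhds hx0] with z hz using h.hasFDerivAt_gauge h0 hz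
  have hmem : ∀ᶠ p in F, p.1 ∈ frontier K ∧ p.2 ∈ frontier K := self_mem_nhdsWithin
  have t1 : (fun p : V × V => ⟪p.1 - p.2, N p.2⟫ + 2⁻¹ * ⟪D (p.1 - p.2), p.1 - p.2⟫)
      =o[F] fun p => ‖p.1 - p.2‖ ^ 2 := by
    refine ((taylor_isLittleO_sq hg hN).mono hFle).neg_left.congr' ?_ EventuallyEq.rfl
    filter_upwards [hmem] with p hp
    rw [h.gauge_eq_one h0 hp.1, h.gauge_eq_one h0 hp.2]
    ring
  have tend1 : Tendsto (fun p : V × V => p.1 - p.2) F (𝓝 0) := by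
    have : Tendsto (fun p : V × V => p.1 - p.2) (𝓝 (x₀, x₀)) (𝓝 (x₀ - x₀)) :=
      (continuous_fst.sub continuous_snd).continuousAt
    rw [sub_self] at this
    exact this.mono_left hFle
  have tendh : Tendsto (fun p : V × V => ⟪p.2, ν p.2⟫) F (𝓝 ⟪x₀, ν x₀⟫) := by
    have h2 : Tendsto (fun p : V × V => p.2) F (𝓝 x₀) := continuousAt_snd.mono_left hFle
    exact h2.inner ((h.smooth _ hx).continuousAt.tendsto.comp h2)
  have tendν : Tendsto (fun p : V × V => ν p.2 - ν x₀) F (𝓝 0) := by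
    have h2 : Tendsto (fun p : V × V => p.2) F (𝓝 x₀) := continuousAt_snd.mono_left hFle
    have := ((h.smooth _ hx).continuousAt.tendsto.comp h2).sub_const (ν x₀)
    simpa using this
  have quadO : ∀ (A : V →L[ℝ] V), (fun p : V × V => ⟪A (p.1 - p.2), p.1 - p.2⟫)
      =O[F] fun p => ‖p.1 - p.2‖ ^ 2 := by
    intro A
    refine Asymptotics.IsBigO.of_bound ‖A‖ (Eventually.of_forall fun p => ?_)
    refine (norm_inner_le_norm _ _).trans ?_
    rw [norm_pow, norm_norm, sq, ← mul_assoc]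
    gcongr
    exact A.le_opNorm _
  have t2 : (fun p : V × V => ⟪p.1 - p.2, ν p.2⟫ +
      2⁻¹ * (⟪x₀, ν x₀⟫ * ⟪D (p.1 - p.2), p.1 - p.2⟫)) =o[F] fun p => ‖p.1 - p.2‖ ^ 2 := by
    have a1 : (fun p : V × V => ⟪p.2, ν p.2⟫ *
        (⟪p.1 - p.2, N p.2⟫ + 2⁻¹ * ⟪D (p.1 - p.2), p.1 - p.2⟫))
        =o[F] fun p => ‖p.1 - p.2‖ ^ 2 := by
      have := (tendh.isBigO_one ℝ).mul_isLittleO t1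
      simpa using this
    have a2 : (fun p : V × V => (⟪p.2, ν p.2⟫ - ⟪x₀, ν x₀⟫) * ⟪D (p.1 - p.2), p.1 - p.2⟫)
        =o[F] fun p => ‖p.1 - p.2‖ ^ 2 := by
      have hz : Tendsto (fun p : V × V => ⟪p.2, ν p.2⟫ - ⟪x₀, ν x₀⟫) F (𝓝 0) := by
        simpa using tendh.sub_const ⟪x₀, ν x₀⟫
      have := ((Asymptotics.isLittleO_one_iff ℝ).2 hz).mul_isBigO (quadO D)
      simpa using this
    refine (a1.sub (a2.const_mul_left 2⁻¹)).congr' ?_ EventuallyEq.rfl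
    filter_upwards [hmem] with p hp
    have hp2 := h.support_pos h0 hp.2
    have : ⟪p.1 - p.2, ν p.2⟫ = ⟪p.2, ν p.2⟫ * ⟪p.1 - p.2, N p.2⟫ := by
      rw [hNdef, gaugeGrad, h.radial_eq h0 hp.2, real_inner_smul_right,
        mul_inv_cancel_left₀ hp2.ne']
    rw [this]
    ring
  have sq_o : (fun p : V × V => ‖p.1 - p.2‖ ^ 2) =o[F] fun p => ‖p.1 - p.2‖ := by
    have := ((Asymptotics.isLittleO_one_iff ℝ).2 (tendsto_norm_zero.comp tend1)).mul_isBigO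
      (Asymptotics.isBigO_refl (fun p : V × V => ‖p.1 - p.2‖) F)
    simpa [sq] using this
  have t3 : (fun p : V × V => ⟪ν x₀, p.1 - p.2⟫) =o[F] fun p => ‖p.1 - p.2‖ := by
    have b1 : (fun p : V × V => ⟪p.1 - p.2, ν p.2⟫) =o[F] fun p => ‖p.1 - p.2‖ := by
      have := (t2.isBigO.sub (((quadO D).const_mul_left ⟪x₀, ν x₀⟫).const_mul_left 2⁻¹))
      refine (this.congr_left ?_).trans_isLittleO sq_o
      intro p; ring
    have b2 : (fun p : V × V => ⟪p.1 - p.2, ν p.2 - ν x₀⟫) =o[F] fun p => ‖p.1 - p.2‖ := by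
      have : (fun p : V × V => ⟪p.1 - p.2, ν p.2 - ν x₀⟫) =O[F]
          fun p => ‖p.1 - p.2‖ * ‖ν p.2 - ν x₀‖ :=
        Asymptotics.IsBigO.of_bound 1 (Eventually.of_forall fun p => by
          rw [one_mul, norm_mul, norm_norm, norm_norm]; exact norm_inner_le_norm _ _)
      refine this.trans_isLittleO ?_
      have := (Asymptotics.isBigO_refl (fun p : V × V => ‖p.1 - p.2‖) F).mul_isLittleO
        ((Asymptotics.isLittleO_one_iff ℝ).2 (tendsto_norm_zero.comp tendν))
      simpa using this
    refine (b1.sub b2).congr_left ?_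
    intro p
    rw [inner_sub_right, real_inner_comm (p.1 - p.2) (ν x₀)]
    ring
  refine ⟨?_, t3⟩
  have u1 : (fun p : V × V => ⟪ν x₀, p.1 - p.2⟫ * ⟪D (ν x₀), p.1 - p.2⟫)
      =o[F] fun p => ‖p.1 - p.2‖ ^ 2 := by
    have : (fun p : V × V => ⟪D (ν x₀), p.1 - p.2⟫) =O[F] fun p => ‖p.1 - p.2‖ :=
      Asymptotics.IsBigO.of_bound ‖D (ν x₀)‖ (Eventually.of_forall fun p => by
        rw [norm_norm]; exact norm_inner_le_norm _ _)
    simpa [sq] using t3.mul_isBigO this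
  have u2 : (fun p : V × V => ⟪ν x₀, p.1 - p.2⟫ * ⟪D (tp (ν x₀) (p.1 - p.2)), ν x₀⟫)
      =o[F] fun p => ‖p.1 - p.2‖ ^ 2 := by
    have : (fun p : V × V => ⟪D (tp (ν x₀) (p.1 - p.2)), ν x₀⟫) =O[F]
        fun p => ‖p.1 - p.2‖ :=
      Asymptotics.IsBigO.of_bound (‖D‖ * ‖ν x₀‖) (Eventually.of_forall fun p => by
        rw [norm_norm]
        refine (norm_inner_le_norm _ _).trans ?_
        have := D.le_opNorm (tp (ν x₀) (p.1 - p.2))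
        have h2 := norm_tp_le (h.unit _ hx) (p.1 - p.2)
        calc _ ≤ (‖D‖ * ‖p.1 - p.2‖) * ‖ν x₀‖ := by
              gcongr; exact this.trans (by gcongr)
          _ = _ := by ring)
    simpa [sq] using t3.mul_isBigO this
  refine ((t2.sub (u1.const_mul_left (2⁻¹ * ⟪x₀, ν x₀⟫))).sub
    (u2.const_mul_left (2⁻¹ * ⟪x₀, ν x₀⟫))).congr_left ?_
  intro p
  have ht := tp_inner (h.unit _ hx) (p.1 - p.2)
  rw [← h.inner_fderiv_gaugeGrad h0 hx ht ht]
  generalize hw : p.1 - p.2 = w at *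
  have e : w = tp (ν x₀) w + ⟪ν x₀, w⟫ • ν x₀ := by rw [tp_apply]; abel
  have e2 : ⟪D w, w⟫ = ⟪D (tp (ν x₀) w), tp (ν x₀) w⟫ + ⟪ν x₀, w⟫ * ⟪D (ν x₀), w⟫
      + ⟪ν x₀, w⟫ * ⟪D (tp (ν x₀) w), ν x₀⟫ := by
    have : D w = D (tp (ν x₀) w) + ⟪ν x₀, w⟫ • D (ν x₀) := by
      conv_lhs => rw [e]
      rw [map_add, map_smul]
    rw [this, inner_add_left, real_inner_smul_left]
    have : ⟪D (tp (ν x₀) w), w⟫ = ⟪D (tp (ν x₀) w), tp (ν x₀) w⟫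
      + ⟪ν x₀, w⟫ * ⟪D (tp (ν x₀) w), ν x₀⟫ := by
      conv_lhs => rw [e]
      rw [inner_add_right, real_inner_smul_right]
      simp [← e]
    rw [this]; ring
  rw [e2]
  ring

end Taylor

section Translate

variable {V : Type*} [NormedAddCommGroup V] [InnerProductSpace ℝ V]
  {K : Set V} {ν : V → V}

theorem frontier_preimage_add_right {V : Type*} [NormedAddCommGroup V] (K : Set V) (o : V) :
    frontier ((fun x => x + o) ⁻¹' K) = (fun x => x + o) ⁻¹' frontier K :=
  ((Homeomorph.addRight o).preimage_frontier K).symm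

theorem SmoothBody.translate (h : SmoothBody K ν) (o : V) :
    SmoothBody ((fun x => x + o) ⁻¹' K) (fun x => ν (x + o)) where
  conv := h.conv.translate_preimage_left o
  compact := (Homeomorph.addRight o).isCompact_preimage.2 h.compact
  int := by
    obtain ⟨x, hx⟩ := h.int
    refine ⟨x - o, ?_⟩
    have := (Homeomorph.addRight o).preimage_interior K
    change x - o ∈ interior ((Homeomorph.addRight o) ⁻¹' K)
    rw [← this]
    simpa using hx
  smooth := by
    intro x hx
    rw [frontier_preimage_add_right] at hx
    exact (h.smooth _ hx).comp x (contDiffAt_id.add contDiffAt_const)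
  unit := by
    intro x hx
    rw [frontier_preimage_add_right] at hx
    exact h.unit _ hx
  outer := by
    intro x hx y hy
    rw [frontier_preimage_add_right] at hx
    simpa using h.outer _ hx _ hy
  curv := by
    intro x hx v hv hv0
    rw [frontier_preimage_add_right] at hx
    rw [fderiv_comp_add_right]
    exact h.curv _ hx v hv hv0

theorem SmoothBody.exists_zero_mem (h : SmoothBody K ν) :
    ∃ o : V, (0 : V) ∈ interior ((fun x => x + o) ⁻¹' K) := by
  obtain ⟨o, ho⟩ := h.int
  refine ⟨o, ?_⟩
  have := (Homeomorph.addRight o).preimage_interior K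
  change (0 : V) ∈ interior ((Homeomorph.addRight o) ⁻¹' K)
  rw [← this]
  simpa using ho

/-- Uniqueness of the outer unit normal. -/
theorem SmoothBody.normal_unique (h : SmoothBody K ν)
    {x u : V} (hx : x ∈ frontier K) (hu1 : ‖u‖ = 1) (hu : ∀ y ∈ K, ⟪y - x, u⟫ ≤ 0) :
    u = ν x := by
  obtain ⟨o, ho⟩ := h.exists_zero_mem
  have := (h.translate o).normal_unique_zero ho (x := x - o) (u := u)
    (by rw [frontier_preimage_add_right]; simpa using hx) hu1
    (by
      intro y hy
      have := hu _ hy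
      rwa [show y - (x - o) = y + o - x by abel])
  simpa using this

/-- Symmetry of the Weingarten map. -/
theorem SmoothBody.fderiv_symm (h : SmoothBody K ν)
    {x : V} (hx : x ∈ frontier K) {v w : V} (hv : ⟪v, ν x⟫ = 0) (hw : ⟪w, ν x⟫ = 0) :
    ⟪fderiv ℝ ν x v, w⟫ = ⟪fderiv ℝ ν x w, v⟫ := by
  obtain ⟨o, ho⟩ := h.exists_zero_mem
  have := (h.translate o).fderiv_symm_zero ho (x := x - o) (v := v) (w := w)
    (by rw [frontier_preimage_add_right]; simpa using hx) (by simpa using hv) (by simpa using hw)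
  rw [fderiv_comp_add_right] at this
  simpa using this

theorem SmoothBody.fderiv_tangent (h : SmoothBody K ν)
    {x : V} (hx : x ∈ frontier K) {v : V} (hv : ⟪v, ν x⟫ = 0) :
    ⟪fderiv ℝ ν x v, ν x⟫ = 0 := by
  obtain ⟨o, ho⟩ := h.exists_zero_mem
  have := (h.translate o).fderiv_tangent_zero ho (x := x - o) (v := v)
    (by rw [frontier_preimage_add_right]; simpa using hx) (by simpa using hv)
  rw [fderiv_comp_add_right] at this
  simpa using this

theorem SmoothBody.tendsto_sub (_h : SmoothBody K ν) (o : V) {x₀ : V} :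
    Tendsto (fun p : V × V => (p.1 - o, p.2 - o)) (𝓝[frontier K ×ˢ frontier K] (x₀, x₀))
      (𝓝[frontier ((fun x => x + o) ⁻¹' K) ×ˢ frontier ((fun x => x + o) ⁻¹' K)]
        (x₀ - o, x₀ - o)) := by
  have hc : Continuous (fun p : V × V => (p.1 - o, p.2 - o)) := by fun_prop
  refine hc.continuousWithinAt.tendsto_nhdsWithin ?_
  intro p hp
  rw [frontier_preimage_add_right]
  simpa using hp

/-- Second order expansion of the boundary. -/
theorem SmoothBody.taylor (h : SmoothBody K ν) {x₀ : V} (hx : x₀ ∈ frontier K) :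
    (fun p : V × V => ⟪p.1 - p.2, ν p.2⟫ +
        2⁻¹ * ⟪fderiv ℝ ν x₀ (tp (ν x₀) (p.1 - p.2)), tp (ν x₀) (p.1 - p.2)⟫)
      =o[𝓝[frontier K ×ˢ frontier K] (x₀, x₀)] fun p => ‖p.1 - p.2‖ ^ 2 := by
  obtain ⟨o, ho⟩ := h.exists_zero_mem
  have := (((h.translate o).taylor_aux ho (x₀ := x₀ - o)
    (by rw [frontier_preimage_add_right]; simpa using hx)).1).comp_tendsto (h.tendsto_sub o)
  rw [fderiv_comp_add_right] at this
  simpa [Function.comp_def] using this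

theorem SmoothBody.normal_isLittleO (h : SmoothBody K ν) {x₀ : V} (hx : x₀ ∈ frontier K) :
    (fun p : V × V => ⟪ν x₀, p.1 - p.2⟫)
      =o[𝓝[frontier K ×ˢ frontier K] (x₀, x₀)] fun p => ‖p.1 - p.2‖ := by
  obtain ⟨o, ho⟩ := h.exists_zero_mem
  have := (((h.translate o).taylor_aux ho (x₀ := x₀ - o)
    (by rw [frontier_preimage_add_right]; simpa using hx)).2).comp_tendsto (h.tendsto_sub o)
  simpa [Function.comp_def] using this

end Translate

section Support

variable {V : Type*} [NormedAddCommGroup V] [InnerProductSpace ℝ V]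
  {K : Set V} {ν : V → V}

theorem mem_frontier_of_normal {x u : V} (hx : x ∈ K) (hu1 : ‖u‖ = 1)
    (hu : ∀ y ∈ K, ⟪y - x, u⟫ ≤ 0) : x ∈ frontier K := by
  refine ⟨subset_closure hx, fun hi => ?_⟩
  obtain ⟨r, hr, hrK⟩ := Metric.isOpen_iff.1 isOpen_interior x hi
  have hmem : x + (r / 2) • u ∈ K := by
    apply interior_subset
    apply hrK
    rw [mem_ball_iff_norm, add_sub_cancel_left, norm_smul, hu1, Real.norm_eq_abs,
      abs_of_pos (by positivity)]
    linarith
  have := hu _ hmem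
  rw [add_sub_cancel_left, real_inner_smul_left, real_inner_self_eq_norm_sq, hu1] at this
  linarith

/-- Strict convexity. -/
theorem SmoothBody.eq_of_inner_eq_zero (h : SmoothBody K ν) {x z : V} (hx : x ∈ K)
    (hz : z ∈ frontier K) (h0 : ⟪x - z, ν z⟫ = 0) : x = z := by
  by_contra hne
  have hzK := h.frontier_subset hz
  have hconst : ∀ θ ∈ Icc (0 : ℝ) 1, ν (z + θ • (x - z)) = ν z := by
    intro θ hθ
    have hm : z + θ • (x - z) ∈ K := h.conv.add_smul_sub_mem hzK hx hθ
    have hn : ∀ y ∈ K, ⟪y - (z + θ • (x - z)), ν z⟫ ≤ 0 := by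
      intro y hy
      have := h.outer z hz y hy
      rw [← sub_sub, inner_sub_left _ (θ • _), real_inner_smul_left, h0]
      linarith
    exact (h.normal_unique (mem_frontier_of_normal hm (h.unit z hz) hn) (h.unit z hz) hn).symm
  have hd : HasFDerivAt ν (fderiv ℝ ν z) (z + (0 : ℝ) • (x - z)) := by
    rw [zero_smul, add_zero]
    exact ((h.smooth z hz).differentiableAt one_ne_zero).hasFDerivAt
  have hl : HasDerivAt (fun θ : ℝ => z + θ • (x - z)) (x - z) 0 := by
    simpa using ((hasDerivAt_id (0 : ℝ)).smul_const (x - z)).const_add z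
  have h1 := (hd.comp_hasDerivAt (0 : ℝ) hl).hasDerivWithinAt (s := Icc 0 1)
  have h2 : HasDerivWithinAt (ν ∘ fun θ : ℝ => z + θ • (x - z)) 0 (Icc 0 1) 0 := by
    refine (hasDerivWithinAt_const (0 : ℝ) (Icc (0 : ℝ) 1) (ν z)).congr ?_ ?_
    · intro θ hθ; exact hconst θ hθ
    · exact hconst 0 ⟨le_rfl, zero_le_one⟩
  have h3 : fderiv ℝ ν z (x - z) = 0 :=
    (uniqueDiffOn_Icc (zero_lt_one (α := ℝ)) 0 ⟨le_rfl, zero_le_one⟩).eq_deriv _ h1 h2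
  have := h.curv z hz (x - z) h0 (sub_ne_zero.2 hne)
  rw [h3, inner_zero_left] at this
  exact lt_irrefl _ this

theorem SmoothBody.inner_neg (h : SmoothBody K ν) {x z : V} (hx : x ∈ K)
    (hz : z ∈ frontier K) (hne : x ≠ z) : ⟪x - z, ν z⟫ < 0 :=
  lt_of_le_of_ne (h.outer z hz x hx) fun h0 => hne (h.eq_of_inner_eq_zero hx hz h0)

theorem SmoothBody.isCompact_frontier (h : SmoothBody K ν) : IsCompact (frontier K) :=
  h.compact.of_isClosed_subset isClosed_frontier h.frontier_subset

/-- Coercivity of the second fundamental form. -/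
theorem SmoothBody.coercive [FiniteDimensional ℝ V] (h : SmoothBody K ν) {x : V}
    (hx : x ∈ frontier K) :
    ∃ c > 0, ∀ v, ⟪v, ν x⟫ = 0 → c * ‖v‖ ^ 2 ≤ ⟪fderiv ℝ ν x v, v⟫ := by
  set S : Set V := sphere 0 1 ∩ {v | ⟪v, ν x⟫ = 0} with hS
  have hSc : IsCompact S := (isCompact_sphere 0 1).inter_right
    (isClosed_eq (by fun_prop) continuous_const)
  obtain ⟨c, hc, hcS⟩ : ∃ c > 0, ∀ v ∈ S, c ≤ ⟪fderiv ℝ ν x v, v⟫ := by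
    rcases S.eq_empty_or_nonempty with he | hne
    · exact ⟨1, one_pos, by simp [he]⟩
    · obtain ⟨v, hv, hmin⟩ := hSc.exists_isMinOn hne
        (f := fun v => ⟪fderiv ℝ ν x v, v⟫) (by fun_prop)
      refine ⟨_, h.curv x hx v hv.2 ?_, hmin⟩
      rintro rfl
      simpa using hv.1
  refine ⟨c, hc, fun v hv => ?_⟩
  by_cases hv0 : v = 0
  · subst hv0; simp
  have hn : 0 < ‖v‖ := norm_pos_iff.2 hv0
  have := hcS (‖v‖⁻¹ • v) ⟨by simp [norm_smul, hn.ne'], by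
    change ⟪_, _⟫ = (0 : ℝ)
    rw [real_inner_smul_left, hv, mul_zero]⟩
  rw [map_smul, real_inner_smul_left, real_inner_smul_right, ← mul_assoc, ← sq, inv_pow,
    le_inv_mul_iff₀ (by positivity)] at this
  linarith

theorem support_local_aux {c₀ η δ Lc M t s a ψx ψz gv nw nv q₀ qz ε Dv : ℝ}
    {ip nn : ℝ} (hη : 0 < η) (hη1 : η < 1)
    (hδ : 0 < δ) (hδη : 9 * δ ≤ 2⁻¹ * η * c₀) (ht : 0 < t)
    (htM : t * M * Lc ^ 2 / 2 ≤ δ) (hs : s ≤ t * ψx) (hsM : |s| ≤ t * M)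
    (hA : a ≤ -(2⁻¹ * Dv) + δ * nw ^ 2)
    (hip : ip = 1 - nn ^ 2 / 2) (hnn0 : 0 ≤ nn) (hnn : nn ≤ Lc * nw)
    (hC : ψx ≤ ψz + gv + δ * nw) (hnw : nw ≤ 2 * nv) (hnw0 : 0 ≤ nw)
    (hco : c₀ * nv ^ 2 ≤ Dv)
    (hsq : 0 ≤ (1 - η) * Dv - 2 * t * gv + t ^ 2 / (1 - η) * q₀)
    (hq : q₀ / (1 - η) ≤ q₀ + ε / 2) (hqz : q₀ - ε / 2 ≤ qz) (hδε : δ ≤ ε / 2) :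
    a + s * ip ≤ t * ψz + t ^ 2 * (qz / 2 + ε) := by
  have h1 : nn ^ 2 ≤ Lc ^ 2 * nw ^ 2 := by
    rw [← mul_pow]; exact pow_le_pow_left₀ hnn0 hnn 2
  have h2 : s * ip ≤ t * ψx + δ * nw ^ 2 := by
    have e1 : -(s * (nn ^ 2 / 2)) ≤ t * M * (nn ^ 2 / 2) := by
      have := neg_abs_le s
      have h3 : 0 ≤ nn ^ 2 / 2 := by positivity
      nlinarith
    have htM0 : 0 ≤ t * M := (abs_nonneg s).trans hsM
    have e2 : t * M * (nn ^ 2 / 2) ≤ t * M * Lc ^ 2 / 2 * nw ^ 2 := by nlinarith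
    have e3 : t * M * Lc ^ 2 / 2 * nw ^ 2 ≤ δ * nw ^ 2 := by gcongr
    rw [hip]; nlinarith
  have hnv : 0 ≤ nv := by linarith
  have h4 : nw ^ 2 ≤ 4 * nv ^ 2 := by nlinarith
  have h5 : t * ψx ≤ t * (ψz + gv + δ * nw) := by gcongr
  have h6 : t * nw ≤ t ^ 2 + nv ^ 2 := by nlinarith [sq_nonneg (t - nv)]
  have h7 : δ * (t * nw) ≤ δ * (t ^ 2 + nv ^ 2) := by gcongr
  have h8 : δ * nw ^ 2 ≤ δ * (4 * nv ^ 2) := by gcongr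
  have h9 : 9 * δ * nv ^ 2 ≤ 2⁻¹ * η * Dv := by
    calc _ ≤ 2⁻¹ * η * c₀ * nv ^ 2 := by gcongr
      _ = 2⁻¹ * η * (c₀ * nv ^ 2) := by ring
      _ ≤ _ := by gcongr
  have h10 : t ^ 2 / (1 - η) * q₀ = t ^ 2 * (q₀ / (1 - η)) := by ring
  have h11 : t ^ 2 * (q₀ / (1 - η)) ≤ t ^ 2 * (q₀ + ε / 2) := by gcongr
  have h12 : t ^ 2 * (q₀ - ε / 2) ≤ t ^ 2 * qz := by gcongr
  have h13 : δ * t ^ 2 ≤ ε / 2 * t ^ 2 := by gcongr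
  rw [h10] at hsq
  linarith

end Support

section SupportEstimate

variable {V : Type*} [NormedAddCommGroup V] [InnerProductSpace ℝ V]
  {K : Set V} {ν : V → V}

/-- Completing the square. -/
theorem SmoothBody.complete_square (h : SmoothBody K ν) {x v w : V} (hx : x ∈ frontier K)
    (hv : ⟪v, ν x⟫ = 0) (hw : ⟪w, ν x⟫ = 0) {a t : ℝ} (ha : 0 < a) :
    0 ≤ a * ⟪fderiv ℝ ν x v, v⟫ - 2 * t * ⟪fderiv ℝ ν x w, v⟫
      + t ^ 2 / a * ⟪fderiv ℝ ν x w, w⟫ := by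
  have hs := h.fderiv_symm hx hv hw
  set D := fderiv ℝ ν x
  have hz : ⟪v - (t / a) • w, ν x⟫ = 0 := by
    rw [inner_sub_left, real_inner_smul_left, hv, hw]; ring
  have hnn : 0 ≤ ⟪D (v - (t / a) • w), v - (t / a) • w⟫ := by
    by_cases h0 : v - (t / a) • w = 0
    · rw [h0]; simp
    · exact (h.curv x hx _ hz h0).le
  rw [map_sub, map_smul, inner_sub_left, inner_sub_right, inner_sub_right, real_inner_smul_left,
    real_inner_smul_left, real_inner_smul_right, real_inner_smul_right, hs] at hnn
  have : a * (⟪D v, v⟫ - t / a * ⟪D w, v⟫ - (t / a * ⟪D w, v⟫ - t / a * (t / a * ⟪D w, w⟫)))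
    = a * ⟪D v, v⟫ - 2 * t * ⟪D w, v⟫ + t ^ 2 / a * ⟪D w, w⟫ := by
    field_simp; ring
  rw [← this]
  positivity

theorem exists_eta {q₀ ε : ℝ} (hε : 0 < ε) : ∃ η : ℝ, 0 < η ∧ η < 1 ∧
    q₀ / (1 - η) ≤ q₀ + ε / 2 := by
  have h1 : Tendsto (fun η : ℝ => q₀ / (1 - η)) (𝓝[>] 0) (𝓝 (q₀ / (1 - 0))) := by
    apply Tendsto.mono_left _ nhdsWithin_le_nhds
    apply ContinuousAt.tendsto
    apply ContinuousAt.div continuousAt_const (by fun_prop) (by norm_num)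
  rw [sub_zero, div_one] at h1
  have h2 := h1.eventually (ge_mem_nhds (show q₀ < q₀ + ε / 2 by linarith))
  have h3 : ∀ᶠ η : ℝ in 𝓝[>] 0, η ∈ Ioo (0 : ℝ) 1 := Ioo_mem_nhdsGT one_pos
  obtain ⟨η, hη⟩ := (h2.and h3).exists
  exact ⟨η, hη.2.1, hη.2.2, hη.1⟩

theorem one_sub_norm_sub_sq {u v : V} (hu : ‖u‖ = 1) (hv : ‖v‖ = 1) :
    ⟪u, v⟫ = 1 - ‖u - v‖ ^ 2 / 2 := by
  rw [norm_sub_sq_real, hu, hv]; ring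

/-- Uniform estimate of the support values of a normal perturbation of the boundary. -/
theorem SmoothBody.support_estimate [FiniteDimensional ℝ V] (h : SmoothBody K ν)
    {ψ : V → ℝ} (hψ : ContDiff ℝ 1 ψ)
    {q : V → ℝ} (hq : ContinuousOn q (frontier K)) {w : V → V}
    (hwt : ∀ x ∈ frontier K, ⟪w x, ν x⟫ = 0)
    (hwg : ∀ x ∈ frontier K, ∀ v, ⟪v, ν x⟫ = 0 → ⟪fderiv ℝ ν x (w x), v⟫ = fderiv ℝ ψ x v)
    (hwq : ∀ x ∈ frontier K, q x = ⟪fderiv ℝ ν x (w x), w x⟫)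
    (M : ℝ) {ε : ℝ} (hε : 0 < ε) :
    ∀ᶠ t : ℝ in 𝓝[>] 0, ∀ x ∈ frontier K, ∀ z ∈ frontier K, ∀ s : ℝ, s ≤ t * ψ x →
      |s| ≤ t * M → ⟪x - z, ν z⟫ + s * ⟪ν x, ν z⟫ ≤ t * ψ z + t ^ 2 * (q z / 2 + ε) := by
  have key : ∀ᶠ t : ℝ in 𝓝 0, ∀ p ∈ frontier K ×ˢ frontier K,
      0 < t → p ∈ frontier K ×ˢ frontier K → ∀ s : ℝ, s ≤ t * ψ p.1 →
      |s| ≤ t * M → ⟪p.1 - p.2, ν p.2⟫ + s * ⟪ν p.1, ν p.2⟫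
        ≤ t * ψ p.2 + t ^ 2 * (q p.2 / 2 + ε) := by
    apply (h.isCompact_frontier.prod h.isCompact_frontier).eventually_forall_of_forall_eventually
      (P := fun (t : ℝ) (p : V × V) => 0 < t → p ∈ frontier K ×ˢ frontier K →
        ∀ s : ℝ, s ≤ t * ψ p.1 →
        |s| ≤ t * M → ⟪p.1 - p.2, ν p.2⟫ + s * ⟪ν p.1, ν p.2⟫
          ≤ t * ψ p.2 + t ^ 2 * (q p.2 / 2 + ε))
    rintro ⟨x₀, z₀⟩ ⟨hx₀, hz₀⟩
    simp only at hx₀ hz₀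
    rw [nhds_prod_eq]
    by_cases hne : x₀ = z₀
    · subst hne
      obtain ⟨c₀, hc₀, hco⟩ := h.coercive hx₀
      obtain ⟨η, hη, hη1, hηq⟩ := exists_eta (q₀ := q x₀) hε
      set δ := min (ε / 2) (η * c₀ / 18) with hδdef
      have hδ : 0 < δ := lt_min (by linarith) (by positivity)
      have hδη : 9 * δ ≤ 2⁻¹ * η * c₀ := by
        have := min_le_right (ε / 2) (η * c₀ / 18)
        linarith
      obtain ⟨Lc, hLc⟩ := ((h.smooth x₀ hx₀).hasStrictFDerivAt one_ne_zero).isBigO_sub.bound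
      have e1 := Asymptotics.isLittleO_iff.1 (h.taylor hx₀) hδ
      have e2 := Asymptotics.isLittleO_iff.1 (h.normal_isLittleO hx₀) (c := 2⁻¹) (by norm_num)
      have e2' := Asymptotics.isLittleO_iff.1 (h.normal_isLittleO hx₀)
        (c := δ / 2 / (‖fderiv ℝ ψ x₀ (ν x₀)‖ + 1)) (by positivity)
      have e3 := Asymptotics.isLittleO_iff.1
        ((hψ.contDiffAt (x := x₀)).hasStrictFDerivAt one_ne_zero).isLittleO
        (c := δ / 2) (by positivity)
      have e4 : ∀ᶠ p : V × V in 𝓝[frontier K ×ˢ frontier K] (x₀, x₀),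
          q x₀ - ε / 2 ≤ q p.2 := by
        have t1 : Tendsto (fun p : V × V => p.2) (𝓝[frontier K ×ˢ frontier K] (x₀, x₀))
            (𝓝[frontier K] x₀) :=
          continuous_snd.continuousWithinAt.tendsto_nhdsWithin fun p hp => hp.2
        exact ((hq x₀ hx₀).tendsto.comp t1).eventually
          (le_mem_nhds (show q x₀ - ε / 2 < q x₀ by linarith))
      have e5 : ∀ᶠ t : ℝ in 𝓝 0, t * M * Lc ^ 2 / 2 ≤ δ := by
        have : Tendsto (fun t : ℝ => t * M * Lc ^ 2 / 2) (𝓝 0) (𝓝 (0 * M * Lc ^ 2 / 2)) := by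
          apply Continuous.tendsto; fun_prop
        apply this.eventually (ge_mem_nhds _)
        simpa using hδ
      have e6 : ∀ᶠ p : V × V in 𝓝[frontier K ×ˢ frontier K] (x₀, x₀),
          ‖ν p.1 - ν p.2‖ ≤ Lc * ‖p.1 - p.2‖ := hLc.filter_mono nhdsWithin_le_nhds
      have e7 := e3.filter_mono (nhdsWithin_le_nhds (s := frontier K ×ˢ frontier K))
      have e8 := eventually_nhdsWithin_iff.1 (e1.and (e2.and (e2'.and (e4.and (e6.and e7)))))
      refine (e5.prod_mk e8).mono ?_
      rintro ⟨t, x, z⟩ ⟨ht1, hp⟩ ht hxz s hs hsM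
      obtain ⟨f1, f2, f2', f4, f6, f7⟩ := hp hxz
      simp only at f1 f2 f2' f4 f6 f7 ht1 ht hs hsM ⊢
      have hu := h.unit x₀ hx₀
      have hv := tp_inner hu (x - z)
      set v := tp (ν x₀) (x - z) with hvdef
      have hdec : x - z = v + ⟪ν x₀, x - z⟫ • ν x₀ := by rw [hvdef, tp_apply]; abel
      refine support_local_aux (c₀ := c₀) (η := η) (δ := δ) (Lc := Lc) (M := M)
        (ψx := ψ x) (gv := ⟪fderiv ℝ ν x₀ (w x₀), v⟫) (nw := ‖x - z‖) (nv := ‖v‖) (q₀ := q x₀)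
        (nn := ‖ν x - ν z‖) (Dv := ⟪fderiv ℝ ν x₀ v, v⟫)
        hη hη1 hδ hδη ht ht1 hs hsM ?_
        (one_sub_norm_sub_sq (h.unit x hxz.1) (h.unit z hxz.2)) (norm_nonneg _) f6
        ?_ ?_ (norm_nonneg _) (hco v hv) ?_ hηq f4 (min_le_left _ _)
      · rw [norm_pow, norm_norm, Real.norm_eq_abs] at f1
        have := (abs_le.1 f1).2
        linarith
      · rw [hwg x₀ hx₀ v hv]
        rw [Real.norm_eq_abs] at f7
        have g1 := (abs_le.1 f7).2
        have g2 : fderiv ℝ ψ x₀ (x - z) = fderiv ℝ ψ x₀ v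
            + ⟪ν x₀, x - z⟫ * fderiv ℝ ψ x₀ (ν x₀) := by
          conv_lhs => rw [hdec]
          rw [map_add, map_smul, smul_eq_mul]
        have g3 : ⟪ν x₀, x - z⟫ * fderiv ℝ ψ x₀ (ν x₀) ≤ δ / 2 * ‖x - z‖ := by
          refine (le_abs_self _).trans ?_
          rw [norm_norm, Real.norm_eq_abs] at f2'
          rw [abs_mul]
          set m := ‖fderiv ℝ ψ x₀ (ν x₀)‖
          have hm : 0 ≤ m := norm_nonneg _
          calc |⟪ν x₀, x - z⟫| * |fderiv ℝ ψ x₀ (ν x₀)|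
              ≤ (δ / 2 / (m + 1) * ‖x - z‖) * (m + 1) := by
                gcongr
                change m ≤ m + 1
                linarith
            _ = _ := by field_simp
        linarith
      · have := norm_sq_tp hu (x - z)
        rw [norm_norm, Real.norm_eq_abs] at f2
        have g : ⟪ν x₀, x - z⟫ ^ 2 ≤ (2⁻¹ * ‖x - z‖) ^ 2 := by
          rw [← sq_abs]; gcongr
        refine le_of_sq_le_sq ?_ (by positivity)
        rw [mul_pow]
        rw [mul_pow] at g
        nlinarith [sq_nonneg ‖x - z‖]
      · rw [hwq x₀ hx₀]
        exact h.complete_square hx₀ hv (hwt x₀ hx₀) (by linarith)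
    · have hneg := h.inner_neg (h.frontier_subset hx₀) hz₀ hne
      set α := -⟪x₀ - z₀, ν z₀⟫ with hα
      have hα0 : 0 < α := by linarith
      have hcont : Tendsto (fun r : ℝ × V × V => ⟪r.2.1 - r.2.2, ν r.2.2⟫ + r.1 * M
          - r.1 * ψ r.2.2 - r.1 ^ 2 * (q r.2.2 / 2 + ε))
          (𝓝 0 ×ˢ 𝓝[frontier K ×ˢ frontier K] (x₀, z₀))
          (𝓝 (⟪x₀ - z₀, ν z₀⟫ + 0 * M - 0 * ψ z₀ - 0 ^ 2 * (q z₀ / 2 + ε))) := by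
        have c0 : Tendsto (fun r : ℝ × V × V => r.1)
          (𝓝 0 ×ˢ 𝓝[frontier K ×ˢ frontier K] (x₀, z₀)) (𝓝 0) := tendsto_fst
        have c1 : Tendsto (fun r : ℝ × V × V => r.2.1)
          (𝓝 0 ×ˢ 𝓝[frontier K ×ˢ frontier K] (x₀, z₀)) (𝓝 x₀) :=
          (continuousAt_fst.tendsto.mono_left nhdsWithin_le_nhds).comp tendsto_snd
        have c2 : Tendsto (fun r : ℝ × V × V => r.2.2)
          (𝓝 0 ×ˢ 𝓝[frontier K ×ˢ frontier K] (x₀, z₀)) (𝓝[frontier K] z₀) :=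
          Tendsto.comp (continuous_snd.continuousWithinAt.tendsto_nhdsWithin fun p hp => hp.2)
            tendsto_snd
        have c2' := c2.mono_right nhdsWithin_le_nhds
        have c3 := (h.smooth z₀ hz₀).continuousAt.tendsto.comp c2'
        have c4 := (hq z₀ hz₀).tendsto.comp c2
        have c5 := hψ.continuous.continuousAt.tendsto.comp c2'
        exact ((((c1.sub c2').inner c3).add (c0.mul_const M)).sub (c0.mul c5)).sub
          ((c0.pow 2).mul ((c4.div_const 2).add_const ε))
      have hlim : ⟪x₀ - z₀, ν z₀⟫ + 0 * M - 0 * ψ z₀ - 0 ^ 2 * (q z₀ / 2 + ε) < 0 := by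
        simpa using hneg
      have := hcont.eventually (gt_mem_nhds hlim)
      obtain ⟨pa, ha, pb, hb, hab⟩ := eventually_prod_iff.1 this
      refine (ha.prod_mk (eventually_nhdsWithin_iff.1 hb)).mono ?_
      rintro ⟨t, x, z⟩ ⟨h1, h2⟩ ht hxz s hs hsM
      have h3 := hab h1 (h2 hxz)
      simp only at h3 ⊢
      have h4 : s * ⟪ν x, ν z⟫ ≤ t * M := by
        refine (le_abs_self _).trans ?_
        rw [abs_mul]
        have := abs_real_inner_le_norm (ν x) (ν z)
        rw [h.unit x hxz.1, h.unit z hxz.2, one_mul] at this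
        calc |s| * |⟪ν x, ν z⟫| ≤ |s| * 1 := by gcongr
          _ ≤ _ := by rwa [mul_one]
      linarith
  rw [eventually_nhdsWithin_iff]
  filter_upwards [key] with t ht ht0 x hx z hz s hs hsM
  exact ht (x, z) ⟨hx, hz⟩ ht0 ⟨hx, hz⟩ s hs hsM

end SupportEstimate

section Shape

variable {V : Type*} [NormedAddCommGroup V] [InnerProductSpace ℝ V]
  {K : Set V} {ν : V → V}

/-- The Weingarten map extended by the identity in the normal direction. -/
def shapeExt (ν : V → V) (x : V) : V →L[ℝ] V :=
  (fderiv ℝ ν x).comp (tp (ν x)) + (innerSL ℝ (ν x)).smulRight (ν x)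

theorem SmoothBody.continuousOn_fderiv (h : SmoothBody K ν) :
    ContinuousOn (fderiv ℝ ν) (frontier K) := fun x hx =>
  ((h.smooth x hx).fderiv_right (m := 0) (by norm_num)).continuousAt.continuousWithinAt

theorem SmoothBody.continuousOn_tp (h : SmoothBody K ν) :
    ContinuousOn (fun x => tp (ν x)) (frontier K) := by
  have : Continuous (fun u : V => tp u) := by unfold tp; fun_prop
  exact this.comp_continuousOn h.continuousOn

theorem SmoothBody.continuousOn_weingarten (h : SmoothBody K ν) :
    ContinuousOn (fun x => (fderiv ℝ ν x).comp (tp (ν x))) (frontier K) :=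
  h.continuousOn_fderiv.clm_comp h.continuousOn_tp

theorem SmoothBody.continuousOn_shapeExt (h : SmoothBody K ν) :
    ContinuousOn (shapeExt ν) (frontier K) := by
  have : Continuous (fun u : V => (innerSL ℝ u).smulRight u) := by fun_prop
  exact h.continuousOn_weingarten.add (this.comp_continuousOn h.continuousOn)

theorem shapeExt_apply (x v : V) :
    shapeExt ν x v = fderiv ℝ ν x (tp (ν x) v) + ⟪ν x, v⟫ • ν x := by
  simp [shapeExt]

theorem SmoothBody.inner_shapeExt (h : SmoothBody K ν) {x : V} (hx : x ∈ frontier K) (v : V) :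
    ⟪shapeExt ν x v, ν x⟫ = ⟪ν x, v⟫ := by
  rw [shapeExt_apply, inner_add_left, h.fderiv_tangent hx (tp_inner (h.unit x hx) v),
    real_inner_smul_left, real_inner_self_eq_norm_sq, h.unit x hx]
  ring

theorem SmoothBody.isUnit_shapeExt [FiniteDimensional ℝ V] (h : SmoothBody K ν) {x : V}
    (hx : x ∈ frontier K) : IsUnit (shapeExt ν x) := by
  rw [ContinuousLinearMap.isUnit_iff_bijective]
  have hinj : Function.Injective (shapeExt ν x) := by
    rw [injective_iff_map_eq_zero]
    intro v hv
    have h1 := h.inner_shapeExt hx v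
    rw [hv, inner_zero_left] at h1
    rw [shapeExt_apply, ← h1, zero_smul, add_zero] at hv
    have h2 : ⟪v, ν x⟫ = 0 := by rw [real_inner_comm]; exact h1.symm
    rw [tp_of_inner h2] at hv
    by_contra hv0
    have := h.curv x hx v h2 hv0
    rw [hv, inner_zero_left] at this
    exact lt_irrefl _ this
  exact ⟨hinj, (LinearMap.injective_iff_surjective (f := (shapeExt ν x : V →ₗ[ℝ] V))).1 hinj⟩

/-- The solution `w` of `Dν w = ∇ψ` in the tangent space. -/
def tangentSol (ν : V → V) (g : V → V) (x : V) : V :=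
  Ring.inverse (shapeExt ν x) (tp (ν x) (g x))

theorem SmoothBody.shapeExt_tangentSol [FiniteDimensional ℝ V] (h : SmoothBody K ν) {x : V}
    (hx : x ∈ frontier K) (g : V → V) :
    shapeExt ν x (tangentSol ν g x) = tp (ν x) (g x) := by
  have := Ring.mul_inverse_cancel _ (h.isUnit_shapeExt hx)
  have h2 := DFunLike.congr_fun this (tp (ν x) (g x))
  simpa [tangentSol] using h2

theorem SmoothBody.tangentSol_inner [FiniteDimensional ℝ V] (h : SmoothBody K ν) {x : V}
    (hx : x ∈ frontier K) (g : V → V) : ⟪tangentSol ν g x, ν x⟫ = 0 := by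
  rw [real_inner_comm, ← h.inner_shapeExt hx, h.shapeExt_tangentSol hx, tp_inner (h.unit x hx)]

theorem SmoothBody.fderiv_tangentSol [FiniteDimensional ℝ V] (h : SmoothBody K ν) {x : V}
    (hx : x ∈ frontier K) (g : V → V) :
    fderiv ℝ ν x (tangentSol ν g x) = tp (ν x) (g x) := by
  have h1 := h.tangentSol_inner hx g
  have := h.shapeExt_tangentSol hx g
  rw [shapeExt_apply, tp_of_inner h1, real_inner_comm, h1, zero_smul, add_zero] at this
  exact this

theorem SmoothBody.continuousOn_tangentSol [FiniteDimensional ℝ V] (h : SmoothBody K ν)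
    {g : V → V} (hg : ContinuousOn g (frontier K)) :
    ContinuousOn (tangentSol ν g) (frontier K) := by
  have h1 : ContinuousOn (fun x => Ring.inverse (shapeExt ν x)) (frontier K) := by
    intro x hx
    obtain ⟨u, hu⟩ := h.isUnit_shapeExt hx
    have := NormedRing.inverse_continuousAt u
    rw [hu] at this
    exact ContinuousAt.comp_continuousWithinAt this (h.continuousOn_shapeExt x hx)
  exact h1.clm_apply (h.continuousOn_tp.clm_apply hg)

end Shape

section Normal

variable {V : Type*} [NormedAddCommGroup V] [InnerProductSpace ℝ V]
  {K : Set V} {ν : V → V}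

/-- The normal exponential map. -/
def normalMap (ν : V → V) (p : V × ℝ) : V := p.1 + p.2 • ν p.1

theorem SmoothBody.exists_lipschitz (h : SmoothBody K ν) :
    ∃ L : ℝ, 1 ≤ L ∧ ∀ x ∈ frontier K, ∀ y ∈ frontier K, ‖ν x - ν y‖ ≤ L * ‖x - y‖ := by
  have hl : LocallyLipschitzOn (frontier K) ν := by
    intro x hx
    obtain ⟨C, t, ht, hC⟩ := (h.smooth x hx).exists_lipschitzOnWith
    exact ⟨C, t, mem_nhdsWithin_of_mem_nhds ht, hC⟩
  obtain ⟨C, hC⟩ := hl.exists_lipschitzOnWith_of_compact h.isCompact_frontier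
  refine ⟨max 1 C, le_max_left _ _, fun x hx y hy => ?_⟩
  have := hC.dist_le_mul x hx y hy
  rw [dist_eq_norm, dist_eq_norm] at this
  refine this.trans ?_
  gcongr
  exact le_max_right _ _

theorem SmoothBody.flat (h : SmoothBody K ν) {L : ℝ}
    (hL : ∀ x ∈ frontier K, ∀ y ∈ frontier K, ‖ν x - ν y‖ ≤ L * ‖x - y‖)
    {x y : V} (hx : x ∈ frontier K) (hy : y ∈ frontier K) :
    |⟪x - y, ν x⟫| ≤ L * ‖x - y‖ ^ 2 := by
  have h1 := h.outer x hx y (h.frontier_subset hy)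
  have h2 := h.outer y hy x (h.frontier_subset hx)
  have h3 : ⟪x - y, ν x - ν y⟫ ≤ L * ‖x - y‖ ^ 2 := by
    refine (real_inner_le_norm _ _).trans ?_
    calc _ ≤ ‖x - y‖ * (L * ‖x - y‖) := by gcongr; exact hL x hx y hy
      _ = _ := by ring
  rw [inner_sub_right] at h3
  rw [← neg_sub, inner_neg_left] at h1
  rw [abs_le]
  constructor <;> linarith

theorem SmoothBody.injOn_normalMap (h : SmoothBody K ν) {L : ℝ} (hL1 : 1 ≤ L)
    (hL : ∀ x ∈ frontier K, ∀ y ∈ frontier K, ‖ν x - ν y‖ ≤ L * ‖x - y‖) :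
    InjOn (normalMap ν) (frontier K ×ˢ Ioo (-(1 / (8 * L))) (1 / (8 * L))) := by
  rintro ⟨x, s⟩ ⟨hx, hs⟩ ⟨y, r⟩ ⟨hy, hr⟩ hxy
  simp only [normalMap] at hx hs hy hr hxy
  set e := 1 / (8 * L) with he
  have he0 : 0 < e := by positivity
  have heL : e * L = 1 / 8 := by rw [he]; field_simp
  have hs' : |s| ≤ e := abs_le.2 ⟨hs.1.le, hs.2.le⟩
  have hr' : |r| ≤ e := abs_le.2 ⟨hr.1.le, hr.2.le⟩
  have hw : x - y = r • (ν y - ν x) + (r - s) • ν x := by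
    have : x = y + r • ν y - s • ν x := by rw [← hxy]; abel
    conv_lhs => rw [this]
    module
  have hnu := hL y hy x hx
  rw [norm_sub_rev y x] at hnu
  have h1 : ‖x - y‖ ≤ e * (L * ‖x - y‖) + |r - s| := by
    conv_lhs => rw [hw]
    refine (norm_add_le _ _).trans ?_
    rw [norm_smul, norm_smul, h.unit x hx, mul_one, Real.norm_eq_abs, Real.norm_eq_abs]
    gcongr
  have h2 : |r - s| ≤ 2 * e := (abs_sub r s).trans (by linarith)
  have h3 : ‖x - y‖ ≤ 3 * e := by
    rw [← mul_assoc, heL] at h1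
    linarith
  have h4 : ⟪ν y - ν x, ν x⟫ = - (‖ν y - ν x‖ ^ 2 / 2) := by
    rw [inner_sub_left, one_sub_norm_sub_sq (h.unit y hy) (h.unit x hx),
      real_inner_self_eq_norm_sq, h.unit x hx]
    ring
  have h5 : r - s = ⟪x - y, ν x⟫ + r * (‖ν y - ν x‖ ^ 2 / 2) := by
    conv_rhs => rw [hw]
    rw [inner_add_left, real_inner_smul_left, real_inner_smul_left, h4,
      real_inner_self_eq_norm_sq, h.unit x hx]
    ring
  have h6 : |r - s| ≤ L * ‖x - y‖ ^ 2 + e * ((L * ‖x - y‖) ^ 2 / 2) := by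
    rw [h5]
    refine (abs_add_le _ _).trans ?_
    rw [abs_mul, abs_of_nonneg (by positivity : 0 ≤ ‖ν y - ν x‖ ^ 2 / 2)]
    gcongr
    exact h.flat hL hx hy
  have h7 : |r - s| ≤ 17 / 16 * L * ‖x - y‖ ^ 2 := by
    have : e * ((L * ‖x - y‖) ^ 2 / 2) = (e * L) * L * ‖x - y‖ ^ 2 / 2 := by ring
    rw [this, heL] at h6
    linarith
  have h8 : L * ‖x - y‖ ^ 2 ≤ 3 / 8 * ‖x - y‖ := by
    calc L * ‖x - y‖ ^ 2 = L * ‖x - y‖ * ‖x - y‖ := by ring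
      _ ≤ L * (3 * e) * ‖x - y‖ := by gcongr
      _ = 3 * (e * L) * ‖x - y‖ := by ring
      _ = _ := by rw [heL]; ring
  have h9 : ‖x - y‖ = 0 := by
    rw [← mul_assoc, heL] at h1
    have := norm_nonneg (x - y)
    linarith
  have h10 : x = y := sub_eq_zero.1 (norm_eq_zero.1 h9)
  have h11 : r - s = 0 := by
    rw [h9] at h7
    exact abs_eq_zero.1 (le_antisymm (by linarith) (abs_nonneg _))
  rw [Prod.mk.injEq]
  exact ⟨h10, by linarith⟩

/-- A point outside of `K` lies on the outer normal of its nearest point. -/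
theorem SmoothBody.exists_normal_of_notMem (h : SmoothBody K ν) {y : V} (hy : y ∉ K) :
    ∃ z ∈ frontier K, ∃ d > 0, y = normalMap ν (z, d) ∧ ∀ k ∈ K, d ≤ ‖y - k‖ := by
  obtain ⟨z, hz, hmin⟩ := exists_norm_eq_iInf_of_complete_convex
    (h.int.mono interior_subset) h.compact.isComplete h.conv y
  have hle := (norm_eq_iInf_iff_real_inner_le_zero h.conv hz).1 hmin
  have hd : 0 < ‖y - z‖ := norm_pos_iff.2 (sub_ne_zero.2 fun e => hy (e ▸ hz))
  set u := ‖y - z‖⁻¹ • (y - z) with hu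
  have hu1 : ‖u‖ = 1 := by rw [hu, norm_smul, norm_inv, norm_norm, inv_mul_cancel₀ hd.ne']
  have hn : ∀ k ∈ K, ⟪k - z, u⟫ ≤ 0 := by
    intro k hk
    rw [hu, real_inner_smul_right, real_inner_comm]
    exact mul_nonpos_of_nonneg_of_nonpos (by positivity) (hle k hk)
  have hzf := mem_frontier_of_normal hz hu1 hn
  have hun := h.normal_unique hzf hu1 hn
  have hy2 : y = z + ‖y - z‖ • u := by
    rw [hu, smul_smul, mul_inv_cancel₀ hd.ne', one_smul, add_sub_cancel]
  refine ⟨z, hzf, ‖y - z‖, hd, ?_, ?_⟩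
  · rw [normalMap, ← hun]; exact hy2
  · intro k hk
    rw [hmin]
    exact ciInf_le ⟨0, by rintro _ ⟨w, rfl⟩; exact norm_nonneg _⟩ (⟨k, hk⟩ : K)

theorem SmoothBody.normalMap_notMem (h : SmoothBody K ν) {x : V} (hx : x ∈ frontier K) {s : ℝ}
    (hs : 0 < s) : normalMap ν (x, s) ∉ K := by
  intro hm
  have := h.outer x hx _ hm
  rw [normalMap, add_sub_cancel_left, real_inner_smul_left, real_inner_self_eq_norm_sq,
    h.unit x hx] at this
  linarith

theorem SmoothBody.normalMap_mem (h : SmoothBody K ν) {e : ℝ}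
    (hinj : InjOn (normalMap ν) (frontier K ×ˢ Ioo (-e) e))
    {x : V} (hx : x ∈ frontier K) {s : ℝ} (hs : -e < s) (hs0 : s ≤ 0) :
    normalMap ν (x, s) ∈ K := by
  by_contra hm
  obtain ⟨z, hz, d, hd, hy, hdist⟩ := h.exists_normal_of_notMem hm
  have h1 := hdist x (h.frontier_subset hx)
  rw [normalMap, add_sub_cancel_left, norm_smul, h.unit x hx, mul_one, Real.norm_eq_abs,
    abs_of_nonpos hs0] at h1
  have := @hinj (x, s) ⟨hx, hs, by simp only; linarith⟩ (z, d)
    ⟨hz, by simp only; linarith, by simp only; linarith⟩ hy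
  rw [Prod.mk.injEq] at this
  linarith [this.2]

theorem frontier_nonempty_of_body [Nontrivial V] (hc : IsCompact K) (hne : K.Nonempty) :
    (frontier K).Nonempty := by
  by_contra he
  rw [not_nonempty_iff_eq_empty, ← isClopen_iff_frontier_eq_empty, isClopen_iff] at he
  rcases he with he | he
  · exact hne.ne_empty he
  · rw [he] at hc
    exact (NormedSpace.noncompactSpace ℝ V).noncompact_univ hc

/-- A point of `K` lies on the inner normal of its nearest boundary point, and the corresponding
ball is contained in `K`. -/
theorem SmoothBody.exists_normal_of_mem [Nontrivial V] (h : SmoothBody K ν) {a : V} (ha : a ∈ K) :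
    ∃ x ∈ frontier K, ∃ d ≥ 0, a = normalMap ν (x, -d) ∧ closedBall a d ⊆ K := by
  obtain ⟨x, hx, hxd⟩ := h.isCompact_frontier.exists_infDist_eq_dist
    (frontier_nonempty_of_body h.compact ⟨a, ha⟩) a
  set d := dist a x with hd
  have hball : ball a d ⊆ K := by
    intro y hy
    by_contra hyK
    have hpc : IsPreconnected (ball a d) := (convex_ball a d).isPreconnected
    have hdpos : 0 < d := pos_of_mem_ball hy
    have hbf : ∀ z ∈ ball a d, z ∉ frontier K := by
      intro z hz hzf
      have := infDist_le_dist_of_mem (x := a) hzf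
      rw [hxd] at this
      rw [mem_ball, dist_comm] at hz
      linarith
    have hbi : ∀ z ∈ ball a d, z ∈ K → z ∈ interior K := by
      intro z hz hzK
      by_contra hzi
      exact hbf z hz ⟨subset_closure hzK, hzi⟩
    obtain ⟨z, -, hz1, hz2⟩ := hpc (interior K) Kᶜ isOpen_interior h.isClosed.isOpen_compl
      (fun z hz => (em (z ∈ K)).imp (hbi z hz) id)
      ⟨a, mem_ball_self hdpos, hbi a (mem_ball_self hdpos) ha⟩ ⟨y, hy, hyK⟩
    exact hz2 (interior_subset hz1)
  have hcb : closedBall a d ⊆ K := by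
    rcases eq_or_ne d 0 with h0 | h0
    · rw [h0, closedBall_zero]; simpa using ha
    · rw [← closure_ball a h0]
      exact h.isClosed.closure_subset_iff.2 hball
  refine ⟨x, hx, d, dist_nonneg, ?_, hcb⟩
  have hm : a + d • ν x ∈ K := by
    apply hcb
    rw [mem_closedBall_iff_norm, add_sub_cancel_left, norm_smul, h.unit x hx, mul_one,
      Real.norm_eq_abs, abs_of_nonneg dist_nonneg]
  have h1 := h.outer x hx _ hm
  have hd' : ‖x - a‖ = d := by rw [hd, dist_comm, dist_eq_norm]
  have h2 : d ≤ ⟪x - a, ν x⟫ := by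
    rw [show a + d • ν x - x = d • ν x - (x - a) by abel, inner_sub_left, real_inner_smul_left,
      real_inner_self_eq_norm_sq, h.unit x hx] at h1
    linarith
  have h3 : ‖(x - a) - d • ν x‖ ^ 2 ≤ 0 := by
    rw [norm_sub_sq_real, real_inner_smul_right, norm_smul, h.unit x hx, hd', Real.norm_eq_abs,
      mul_one, sq_abs]
    have : 0 ≤ d := dist_nonneg
    nlinarith
  have h4 : (x - a) - d • ν x = 0 := by
    rw [← norm_eq_zero]
    exact pow_eq_zero_iff (two_ne_zero) |>.1 (le_antisymm h3 (sq_nonneg _))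
  rw [normalMap]
  have : a = x - d • ν x := by
    rw [sub_right_comm, sub_eq_zero] at h4
    exact h4.symm
  simpa [sub_eq_add_neg] using this

end Normal

section Cylinder

open MeasureTheory.Measure

variable {m : ℕ}

theorem volume_eq_lintegral_slice {u : E (m + 1)} (hu : ‖u‖ = 1) {A : Set (E (m + 1))}
    (hA : MeasurableSet A) :
    volume A = ∫⁻ s : ℝ, μHE[m] (A ∩ {y | ⟪u, y⟫ = s}) := by
  have hu0 : u ≠ 0 := fun h0 => by simp [h0] at hu
  have h1 := EuclideanGeometry.euclideanHausdorffMeasure_eq_lintegral (0 : E (m + 1)) hu0 hA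
  have hen : ‖u‖ₑ = 1 := by rw [← ofReal_norm, hu, ENNReal.ofReal_one]
  rw [finrank_euclideanSpace_fin, EuclideanSpace.euclideanHausdorffMeasure_eq_volume, hen,
    one_mul] at h1
  rw [h1]
  refine lintegral_congr fun s => ?_
  congr 2
  ext y
  rw [SetLike.mem_coe, AffineSubspace.mem_mk', Submodule.mem_orthogonal_singleton_iff_inner_right,
    mem_ofPred_eq, vsub_eq_sub, vadd_eq_add, add_zero, inner_sub_right, real_inner_smul_right,
    real_inner_self_eq_norm_sq, hu, one_pow, mul_one, sub_eq_zero]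

theorem SmoothBody.exists_nhds_le_tp {V : Type*} [NormedAddCommGroup V] [InnerProductSpace ℝ V]
    {K : Set V} {ν : V → V} (h : SmoothBody K ν) {x₀ : V} (hx : x₀ ∈ frontier K) {Λ : ℝ}
    (hΛ : 1 < Λ) :
    ∃ N ∈ 𝓝 x₀, ∀ x ∈ frontier K ∩ N, ∀ y ∈ frontier K ∩ N,
      ‖x - y‖ ≤ Λ * ‖tp (ν x₀) (x - y)‖ := by
  set c := Real.sqrt (1 - (Λ ^ 2)⁻¹) with hc
  have hΛ2 : (Λ ^ 2)⁻¹ < 1 := inv_lt_one_of_one_lt₀ (by nlinarith)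
  have hc0 : 0 < c := Real.sqrt_pos.2 (by linarith)
  have hc2 : c ^ 2 = 1 - (Λ ^ 2)⁻¹ := Real.sq_sqrt (by linarith)
  have h1 := (h.normal_isLittleO hx).def hc0
  rw [nhdsWithin_prod_eq, eventually_iff_exists_mem] at h1
  obtain ⟨v, hv, hvv⟩ := h1
  obtain ⟨t, ht, t', ht', htt⟩ := mem_prod_iff.1 hv
  obtain ⟨N, hN, hNt⟩ := mem_nhdsWithin_iff_exists_mem_nhds_inter.1 (inter_mem ht ht')
  refine ⟨N, hN, fun x hxN y hyN => ?_⟩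
  have h2 := hvv (x, y) (htt ⟨(hNt ⟨hxN.2, hxN.1⟩).1, (hNt ⟨hyN.2, hyN.1⟩).2⟩)
  simp only [Real.norm_eq_abs, abs_norm] at h2
  have h3 := norm_sq_tp (h.unit x₀ hx) (x - y)
  have h4 : ⟪ν x₀, x - y⟫ ^ 2 ≤ c ^ 2 * ‖x - y‖ ^ 2 := by
    rw [← sq_abs, ← mul_pow]
    exact pow_le_pow_left₀ (abs_nonneg _) h2 2
  rw [hc2] at h4
  have hΛ0 : 0 < Λ := by linarith
  have h5 : ‖x - y‖ ^ 2 ≤ (Λ * ‖tp (ν x₀) (x - y)‖) ^ 2 := by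
    have h6 : (Λ ^ 2)⁻¹ * ‖x - y‖ ^ 2 ≤ ‖tp (ν x₀) (x - y)‖ ^ 2 := by linarith
    rw [inv_mul_le_iff₀ (by positivity)] at h6
    rw [mul_pow]
    exact h6
  exact (sq_le_sq₀ (norm_nonneg _) (by positivity)).1 h5

/-- Cylindrical coordinates with axis `u`. -/
def cylMap {V : Type*} [NormedAddCommGroup V] [InnerProductSpace ℝ V] (u : V) (p : V × ℝ) : V :=
  tp u p.1 + p.2 • u

theorem continuous_cylMap {V : Type*} [NormedAddCommGroup V] [InnerProductSpace ℝ V] (u : V) :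
    Continuous (cylMap u) := by
  unfold cylMap
  fun_prop

theorem inner_cylMap {V : Type*} [NormedAddCommGroup V] [InnerProductSpace ℝ V] {u : V}
    (hu : ‖u‖ = 1) (p : V × ℝ) : ⟪u, cylMap u p⟫ = p.2 := by
  rw [cylMap, inner_add_right, real_inner_comm, tp_inner hu, real_inner_smul_right,
    real_inner_self_eq_norm_sq, hu]
  ring

variable {u : E (m + 1)} {Y : Set (E (m + 1))} {Λ : ℝ}

theorem injOn_cylMap {V : Type*} [NormedAddCommGroup V] [InnerProductSpace ℝ V] {u : V}
    {Y : Set V} {Λ : ℝ} (hu : ‖u‖ = 1)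
    (hY : ∀ x ∈ Y, ∀ y ∈ Y, ‖x - y‖ ≤ Λ * ‖tp u (x - y)‖) :
    InjOn (cylMap u) (Y ×ˢ univ) := by
  rintro ⟨x, s⟩ hx ⟨y, r⟩ hy hxy
  have h1 : s = r := by
    have := congrArg (fun z => ⟪u, z⟫) hxy
    simpa only [inner_cylMap hu] using this
  subst h1
  have h2 : tp u (x - y) = 0 := by
    rw [map_sub, sub_eq_zero]
    exact add_right_cancel hxy
  have h3 := hY x hx.1 y hy.1
  rw [h2, norm_zero, mul_zero] at h3
  rw [sub_eq_zero.1 (norm_le_zero_iff.1 h3)]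

theorem volume_cylMap_image (hu : ‖u‖ = 1)
    (hY : ∀ x ∈ Y, ∀ y ∈ Y, ‖x - y‖ ≤ Λ * ‖tp u (x - y)‖)
    {S : Set (E (m + 1) × ℝ)} (hS : MeasurableSet S) (hSY : S ⊆ Y ×ˢ univ) :
    volume (cylMap u '' S)
      = ∫⁻ s : ℝ, μHE[m] ((fun x => tp u x + s • u) '' {x | (x, s) ∈ S}) := by
  rw [volume_eq_lintegral_slice hu
    (hS.image_of_continuousOn_injOn (continuous_cylMap u).continuousOn
      ((injOn_cylMap hu hY).mono hSY))]
  refine lintegral_congr fun s => ?_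
  congr 1
  ext y
  constructor
  · rintro ⟨⟨⟨x, r⟩, hx, rfl⟩, hy⟩
    rw [mem_ofPred_eq, inner_cylMap hu] at hy
    simp only at hy
    subst hy
    exact ⟨x, hx, rfl⟩
  · rintro ⟨x, hx, rfl⟩
    exact ⟨⟨(x, s), hx, rfl⟩, inner_cylMap hu (x, s)⟩

theorem euclideanHausdorffMeasure_image_le {X Z : Type*} [EMetricSpace X] [MeasurableSpace X]
    [BorelSpace X] [EMetricSpace Z] [MeasurableSpace Z] [BorelSpace Z] {f : X → Z} {s : Set X}
    {C : NNReal} (hf : LipschitzOnWith C f s) (d : ℕ) :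
    μHE[d] (f '' s) ≤ (C : ℝ≥0∞) ^ d * μHE[d] s := by
  simp_rw [euclideanHausdorffMeasure_def, Measure.smul_apply, ENNReal.smul_def, smul_eq_mul]
  have := hf.hausdorffMeasure_image_le (d := d) (by positivity)
  rw [ENNReal.rpow_natCast] at this
  rw [mul_left_comm]
  gcongr

theorem slice_image_le (hu : ‖u‖ = 1) (s : ℝ) (T : Set (E (m + 1))) :
    μHE[m] ((fun x => tp u x + s • u) '' T) ≤ μHE[m] T := by
  have : LipschitzOnWith 1 (fun x => tp u x + s • u) T := by
    refine LipschitzOnWith.of_dist_le_mul fun x _ y _ => ?_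
    rw [dist_add_right, dist_eq_norm, dist_eq_norm, ← map_sub, NNReal.coe_one, one_mul]
    exact norm_tp_le hu _
  simpa using euclideanHausdorffMeasure_image_le this m

theorem le_slice_image (hΛ : 0 ≤ Λ)
    (hY : ∀ x ∈ Y, ∀ y ∈ Y, ‖x - y‖ ≤ Λ * ‖tp u (x - y)‖) (s : ℝ) {T : Set (E (m + 1))}
    (hT : T ⊆ Y) :
    μHE[m] T ≤ ENNReal.ofReal Λ ^ m * μHE[m] ((fun x => tp u x + s • u) '' T) := by
  rcases T.eq_empty_or_nonempty with rfl | hne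
  · simp
  set f : E (m + 1) → E (m + 1) := fun x => tp u x + s • u with hf
  have hinj : InjOn f T := by
    intro x hx y hy hxy
    have h2 : tp u (x - y) = 0 := by
      rw [map_sub, sub_eq_zero]
      exact add_right_cancel hxy
    have h3 := hY x (hT hx) y (hT hy)
    rw [h2, norm_zero, mul_zero] at h3
    exact sub_eq_zero.1 (norm_le_zero_iff.1 h3)
  have : LipschitzOnWith Λ.toNNReal (Function.invFunOn f T) (f '' T) := by
    refine LipschitzOnWith.of_dist_le_mul ?_
    rintro _ ⟨x, hx, rfl⟩ _ ⟨y, hy, rfl⟩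
    rw [hinj.leftInvOn_invFunOn hx, hinj.leftInvOn_invFunOn hy, Real.coe_toNNReal _ hΛ,
      dist_eq_norm, dist_eq_norm]
    refine (hY x (hT hx) y (hT hy)).trans_eq ?_
    rw [hf, add_sub_add_right_eq_sub, map_sub]
  have h2 := euclideanHausdorffMeasure_image_le this m
  rwa [hinj.leftInvOn_invFunOn.image_image] at h2

end Cylinder

section Finite

variable {m : ℕ} {K : Set (E (m + 1))} {ν : E (m + 1) → E (m + 1)}

theorem hyperplane_measure_lt_top {u : E (m + 1)} (hu : ‖u‖ = 1) (R : ℝ) :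
    μHE[m] ({x | ⟪x, u⟫ = 0} ∩ closedBall (0 : E (m + 1)) R) < ⊤ := by
  set Y : Set (E (m + 1)) := {x | ⟪x, u⟫ = 0} ∩ closedBall (0 : E (m + 1)) R with hYdef
  have hYc : IsClosed Y := (isClosed_eq (by fun_prop) continuous_const).inter isClosed_closedBall
  have htp : ∀ x ∈ Y, tp u x = x := fun x hx => tp_of_inner hx.1
  have hY : ∀ x ∈ Y, ∀ y ∈ Y, ‖x - y‖ ≤ 1 * ‖tp u (x - y)‖ := by
    intro x hx y hy
    rw [map_sub, htp x hx, htp y hy, one_mul]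
  have h1 := volume_cylMap_image hu hY (S := Y ×ˢ Icc (0 : ℝ) 1)
    (hYc.measurableSet.prod measurableSet_Icc) (prod_mono subset_rfl (subset_univ _))
  have hb : volume (cylMap u '' (Y ×ˢ Icc (0 : ℝ) 1)) < ⊤ := by
    have hYk : IsCompact Y := (isCompact_closedBall 0 R).inter_left
      (isClosed_eq (by fun_prop) continuous_const)
    exact ((hYk.prod isCompact_Icc).image (continuous_cylMap u)).measure_lt_top
  rw [h1] at hb
  refine lt_of_le_of_lt ?_ hb
  calc μHE[m] Y = ∫⁻ _ in Icc (0 : ℝ) 1, μHE[m] Y := by simp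
    _ = ∫⁻ s, (Icc (0 : ℝ) 1).indicator (fun _ => μHE[m] Y) s :=
      (lintegral_indicator measurableSet_Icc _).symm
    _ ≤ _ := by
      refine lintegral_mono fun s => ?_
      by_cases hs : s ∈ Icc (0 : ℝ) 1
      · rw [indicator_of_mem hs]
        have h2 := le_slice_image zero_le_one hY s (T := Y) subset_rfl
        rw [ENNReal.ofReal_one, one_pow, one_mul] at h2
        have h3 : {x | (x, s) ∈ Y ×ˢ Icc (0 : ℝ) 1} = Y := by
          ext x
          simp only [mem_ofPred_eq, mem_prod, and_iff_left hs]
        simp only [h3]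
        exact h2
      · rw [indicator_of_notMem hs]
        exact bot_le

theorem SmoothBody.surface_lt_top (h : SmoothBody K ν) : μHE[m] (frontier K) < ⊤ := by
  refine h.isCompact_frontier.measure_lt_top_of_nhdsWithin fun x₀ hx => ?_
  obtain ⟨N, hN, hNN⟩ := h.exists_nhds_le_tp hx one_lt_two
  refine ⟨frontier K ∩ (N ∩ ball x₀ 1), ?_, ?_⟩
  · exact inter_mem_nhdsWithin _ (inter_mem hN (ball_mem_nhds x₀ one_pos))
  have hu := h.unit x₀ hx
  refine (le_slice_image (u := ν x₀) zero_le_two (Y := frontier K ∩ N) hNN 0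
    (T := frontier K ∩ (N ∩ ball x₀ 1)) (fun x hx => ⟨hx.1, hx.2.1⟩)).trans_lt ?_
  refine ENNReal.mul_lt_top (by simp) ?_
  refine (measure_mono ?_).trans_lt (hyperplane_measure_lt_top hu (‖x₀‖ + 1))
  rintro _ ⟨x, hx, rfl⟩
  simp only [zero_smul, add_zero]
  refine ⟨tp_inner hu x, ?_⟩
  rw [mem_closedBall_zero_iff]
  refine (norm_tp_le hu x).trans ?_
  have h1 := hx.2.2
  rw [mem_ball, dist_eq_norm] at h1
  calc ‖x‖ = ‖x₀ + (x - x₀)‖ := by rw [add_sub_cancel]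
    _ ≤ _ := (norm_add_le _ _).trans (by linarith)

/-- The surface measure of `K`. -/
def surfaceMeasure (K : Set (E (m + 1))) : Measure (E (m + 1)) := (μHE[m]).restrict (frontier K)

theorem SmoothBody.isFiniteMeasure (h : SmoothBody K ν) : IsFiniteMeasure (surfaceMeasure K) :=
  ⟨by rw [surfaceMeasure, Measure.restrict_apply_univ]; exact h.surface_lt_top⟩

/-- The product of the surface measure with Lebesgue measure on the normal lines. -/
def tubeMeasure (K : Set (E (m + 1))) : Measure (E (m + 1) × ℝ) := (surfaceMeasure K).prod volume

theorem SmoothBody.cylMap_image_comparison (h : SmoothBody K ν) {u : E (m + 1)}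
    {Y : Set (E (m + 1))} {Λ : ℝ} (hu : ‖u‖ = 1) (hΛ : 0 ≤ Λ)
    (hY : ∀ x ∈ Y, ∀ y ∈ Y, ‖x - y‖ ≤ Λ * ‖tp u (x - y)‖) (hYK : Y ⊆ frontier K)
    {S : Set (E (m + 1) × ℝ)} (hS : MeasurableSet S) (hSY : S ⊆ Y ×ˢ univ) :
    volume (cylMap u '' S) ≤ tubeMeasure K S ∧
      tubeMeasure K S ≤ ENNReal.ofReal Λ ^ m * volume (cylMap u '' S) := by
  have := h.isFiniteMeasure
  rw [tubeMeasure, Measure.prod_apply_symm hS, volume_cylMap_image hu hY hS hSY,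
    ← lintegral_const_mul' _ _ (by finiteness)]
  have hsl : ∀ s : ℝ, surfaceMeasure K ((fun x => (x, s)) ⁻¹' S) = μHE[m] {x | (x, s) ∈ S} := by
    intro s
    rw [surfaceMeasure, Measure.restrict_apply (hS.preimage (by fun_prop)),
      inter_eq_left.2 (show (fun x => (x, s)) ⁻¹' S ⊆ frontier K from
        fun x hx => hYK (hSY hx).1)]
    rfl
  simp_rw [hsl]
  exact ⟨lintegral_mono fun s => slice_image_le hu s _,
    lintegral_mono fun s => le_slice_image hΛ hY s fun x hx => (hSY hx).1⟩

end Finite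

section LocalTube

theorem exists_nhds_of_eventually_pairs {X : Type*} [TopologicalSpace X] {s : Set X} {x₀ : X}
    {P : X → X → Prop} (h : ∀ᶠ p in 𝓝[s ×ˢ s] (x₀, x₀), P p.1 p.2) :
    ∃ N ∈ 𝓝 x₀, ∀ x ∈ s ∩ N, ∀ y ∈ s ∩ N, P x y := by
  rw [nhdsWithin_prod_eq, eventually_iff_exists_mem] at h
  obtain ⟨v, hv, hvv⟩ := h
  obtain ⟨t, ht, t', ht', htt⟩ := mem_prod_iff.1 hv
  obtain ⟨N, hN, hNt⟩ := mem_nhdsWithin_iff_exists_mem_nhds_inter.1 (inter_mem ht ht')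
  exact ⟨N, hN, fun x hx y hy => hvv (x, y) (htt ⟨(hNt ⟨hx.2, hx.1⟩).1, (hNt ⟨hy.2, hy.1⟩).2⟩)⟩

/-- The differential of the normal map in cylindrical coordinates. -/
def normalDeriv {V : Type*} [NormedAddCommGroup V] [InnerProductSpace ℝ V] (ν : V → V)
    (p : V × ℝ) : V →L[ℝ] V :=
  ContinuousLinearMap.id ℝ V + p.2 • (fderiv ℝ ν p.1).comp (tp (ν p.1))

theorem SmoothBody.normalMap_approx {V : Type*} [NormedAddCommGroup V] [InnerProductSpace ℝ V]
    {K : Set V} {ν : V → V} (h : SmoothBody K ν) {x₀ : V} (hx : x₀ ∈ frontier K) (s₀ : ℝ)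
    {δ : ℝ} (hδ : 0 < δ) :
    ∃ N ∈ 𝓝 (x₀, s₀), ∀ p ∈ (frontier K ×ˢ univ) ∩ N, ∀ q ∈ (frontier K ×ˢ univ) ∩ N,
      ‖normalMap ν p - normalMap ν q - normalDeriv ν (x₀, s₀) (cylMap (ν x₀) p - cylMap (ν x₀) q)‖
        ≤ δ * ‖cylMap (ν x₀) p - cylMap (ν x₀) q‖ := by
  have hu := h.unit x₀ hx
  set u := ν x₀ with hudef
  set D := fderiv ℝ ν x₀ with hD
  set R := |s₀| + 1 with hR
  have hR0 : 0 < R := by positivity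
  set M := 2 + 1 + 2 * R + 2 * R * ‖D‖ + ‖D‖ with hM
  have hM0 : 0 < M := by positivity
  set η := δ / M with hη
  have hη0 : 0 < η := by positivity
  obtain ⟨N₁, hN₁, h₁⟩ := h.exists_nhds_le_tp hx one_lt_two
  obtain ⟨N₂, hN₂, h₂⟩ := exists_nhds_of_eventually_pairs
    (P := fun x y => ‖⟪u, x - y⟫‖ ≤ η * ‖‖x - y‖‖) ((h.normal_isLittleO hx).def hη0)
  have hst : HasStrictFDerivAt ν D x₀ := (h.smooth x₀ hx).hasStrictFDerivAt one_ne_zero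
  have hst2 := hst.isLittleO.def hη0
  obtain ⟨N₃, hN₃, h₃⟩ := exists_nhds_of_eventually_pairs
    (P := fun x y => ‖ν x - ν y - D (x - y)‖ ≤ η * ‖x - y‖)
    (hst2.filter_mono (nhdsWithin_le_nhds (s := frontier K ×ˢ frontier K)))
  have h₄ : ∀ᶠ x in 𝓝 x₀, ‖ν x - u‖ < η := by
    have := (h.smooth x₀ hx).continuousAt.tendsto (ball_mem_nhds u hη0)
    filter_upwards [this] with x hx
    rwa [← dist_eq_norm]
  refine ⟨(N₁ ∩ N₂ ∩ N₃ ∩ {x | ‖ν x - u‖ < η}) ×ˢ ball s₀ (min 1 η),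
    prod_mem_nhds (by filter_upwards [hN₁, hN₂, hN₃, h₄] with x a b c d using ⟨⟨⟨a, b⟩, c⟩, d⟩)
      (ball_mem_nhds _ (by positivity)), ?_⟩
  rintro ⟨x, s⟩ ⟨⟨hxK, -⟩, ⟨⟨⟨hx1, hx2⟩, hx3⟩, hx4⟩, hs⟩
    ⟨y, r⟩ ⟨⟨hyK, -⟩, ⟨⟨⟨hy1, hy2⟩, hy3⟩, hy4⟩, hr⟩
  simp only at hxK hx1 hx2 hx3 hx4 hyK hy1 hy2 hy3 hy4 hs hr
  set w := x - y with hw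
  set c := cylMap u (x, s) - cylMap u (y, r) with hc
  have hcw : c = tp u w + (s - r) • u := by
    rw [hc, hw, cylMap, cylMap, map_sub, sub_smul]
    simp only
    abel
  have hPu : tp u u = 0 := tp_self hu
  have hPP : tp u (tp u w) = tp u w := tp_of_inner (tp_inner hu w)
  have hPc : tp u c = tp u w := by
    rw [hcw, map_add, hPP, map_smul, hPu, smul_zero, add_zero]
  have hPwc : ‖tp u w‖ ≤ ‖c‖ := by rw [← hPc]; exact norm_tp_le hu c
  have hsr : |s - r| ≤ ‖c‖ := by
    have : s - r = ⟪u, c⟫ := by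
      rw [hc, inner_sub_right, inner_cylMap hu, inner_cylMap hu]
    rw [this]
    exact (abs_real_inner_le_norm _ _).trans_eq (by rw [hu, one_mul])
  have hwc : ‖w‖ ≤ 2 * ‖c‖ := (h₁ x ⟨hxK, hx1⟩ y ⟨hyK, hy1⟩).trans (by gcongr)
  have hwP : ‖w - tp u w‖ ≤ η * (2 * ‖c‖) := by
    rw [tp_apply, sub_sub_cancel, norm_smul, hu, mul_one]
    refine (h₂ x ⟨hxK, hx2⟩ y ⟨hyK, hy2⟩).trans ?_
    rw [norm_norm]
    gcongr
  have hstr : ‖ν x - ν y - D w‖ ≤ η * (2 * ‖c‖) :=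
    (h₃ x ⟨hxK, hx3⟩ y ⟨hyK, hy3⟩).trans (by gcongr)
  rw [Real.ball_eq_Ioo] at hr
  have hrs : |r - s₀| ≤ min 1 η := by
    rw [abs_le]; constructor <;> linarith [hr.1, hr.2]
  have hrR : |r| ≤ R := by
    have : r = s₀ + (r - s₀) := by ring
    rw [this]
    exact (abs_add_le _ _).trans (by rw [hR]; gcongr; exact hrs.trans (min_le_left _ _))
  have key : normalMap ν (x, s) - normalMap ν (y, r) - normalDeriv ν (x₀, s₀) c
      = (w - tp u w) + (s - r) • (ν x - u) + r • (ν x - ν y - D w) + r • D (w - tp u w)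
        + (r - s₀) • D (tp u w) := by
    have : normalDeriv ν (x₀, s₀) c = tp u w + (s - r) • u + s₀ • D (tp u w) := by
      rw [normalDeriv, _root_.add_apply, _root_.smul_apply, ContinuousLinearMap.comp_apply,
        ← hudef, hPc, ← hD, ContinuousLinearMap.id_apply, ← hcw]
    rw [this, normalMap, normalMap, map_sub D w]
    simp only
    rw [show x = y + w by rw [hw]; abel]
    module
  rw [key]
  have e1 : ‖(s - r) • (ν x - u)‖ ≤ ‖c‖ * η := by
    rw [norm_smul, Real.norm_eq_abs]
    gcongr
    exact hx4.le
  have e2 : ‖r • (ν x - ν y - D w)‖ ≤ R * (η * (2 * ‖c‖)) := by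
    rw [norm_smul, Real.norm_eq_abs]
    gcongr
  have e3 : ‖r • D (w - tp u w)‖ ≤ R * (‖D‖ * (η * (2 * ‖c‖))) := by
    rw [norm_smul, Real.norm_eq_abs]
    gcongr
    exact D.le_opNorm_of_le hwP
  have e4 : ‖(r - s₀) • D (tp u w)‖ ≤ η * (‖D‖ * ‖c‖) := by
    rw [norm_smul, Real.norm_eq_abs]
    gcongr
    · exact hrs.trans (min_le_right _ _)
    · exact D.le_opNorm_of_le hPwc
  have hηM : η * M = δ := div_mul_cancel₀ _ hM0.ne'
  calc _ ≤ ‖w - tp u w‖ + ‖(s - r) • (ν x - u)‖ + ‖r • (ν x - ν y - D w)‖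
        + ‖r • D (w - tp u w)‖ + ‖(r - s₀) • D (tp u w)‖ :=
      (norm_add_le _ _).trans <| add_le_add_left ((norm_add_le _ _).trans <|
        add_le_add_left ((norm_add_le _ _).trans <| add_le_add_left (norm_add_le _ _) _) _) _
    _ ≤ η * (2 * ‖c‖) + ‖c‖ * η + R * (η * (2 * ‖c‖)) + R * (‖D‖ * (η * (2 * ‖c‖)))
        + η * (‖D‖ * ‖c‖) := by gcongr
    _ = η * M * ‖c‖ := by rw [hM]; ring
    _ = δ * ‖c‖ := by rw [hηM]

theorem SmoothBody.exists_chart {V : Type*} [NormedAddCommGroup V] [InnerProductSpace ℝ V]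
    {K : Set V} {ν : V → V} (h : SmoothBody K ν) {x₀ : V} (hx : x₀ ∈ frontier K) (s₀ : ℝ)
    {Λ : ℝ} (hΛ : 1 < Λ) {δ : NNReal} (hδ : 0 < δ) :
    ∃ N ∈ 𝓝 (x₀, s₀), ∃ Y ⊆ frontier K, (frontier K ×ˢ univ) ∩ N ⊆ Y ×ˢ univ ∧
      (∀ x ∈ Y, ∀ y ∈ Y, ‖x - y‖ ≤ Λ * ‖tp (ν x₀) (x - y)‖) ∧
      ∃ F : V → V, ∀ S ⊆ (frontier K ×ˢ univ) ∩ N,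
        ApproximatesLinearOn F (normalDeriv ν (x₀, s₀)) (cylMap (ν x₀) '' S) δ ∧
        F '' (cylMap (ν x₀) '' S) = normalMap ν '' S := by
  obtain ⟨N₁, hN₁, h₁⟩ := h.exists_nhds_le_tp hx hΛ
  obtain ⟨N₂, hN₂, h₂⟩ := h.normalMap_approx hx s₀ (δ := δ) hδ
  set Y := frontier K ∩ N₁ with hY
  have hinj := injOn_cylMap (h.unit x₀ hx) h₁
  refine ⟨(N₁ ×ˢ univ) ∩ N₂, inter_mem (prod_mem_nhds hN₁ univ_mem) hN₂, Y, inter_subset_left,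
    fun p hp => ⟨⟨hp.1.1, hp.2.1.1⟩, trivial⟩, h₁,
    normalMap ν ∘ Function.invFunOn (cylMap (ν x₀)) (Y ×ˢ univ), fun S hS => ?_⟩
  have hSY : ∀ p ∈ S, p ∈ Y ×ˢ (univ : Set ℝ) := fun p hp =>
    ⟨⟨(hS hp).1.1, (hS hp).2.1.1⟩, trivial⟩
  have hinv : ∀ p ∈ S, Function.invFunOn (cylMap (ν x₀)) (Y ×ˢ univ) (cylMap (ν x₀) p) = p :=
    fun p hp => hinj.leftInvOn_invFunOn (hSY p hp)
  constructor
  · rintro _ ⟨p, hp, rfl⟩ _ ⟨q, hq, rfl⟩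
    rw [Function.comp_apply, Function.comp_apply, hinv p hp, hinv q hq]
    exact h₂ p ⟨(hS hp).1, (hS hp).2.2⟩ q ⟨(hS hq).1, (hS hq).2.2⟩
  · rw [image_image]
    exact image_congr fun p hp => by rw [Function.comp_apply, hinv p hp]

variable {m : ℕ} {K : Set (E (m + 1))} {ν : E (m + 1) → E (m + 1)}

theorem SmoothBody.volume_image_le_local (h : SmoothBody K ν) {x₀ : E (m + 1)}
    (hx : x₀ ∈ frontier K) (s₀ : ℝ) {b : NNReal}
    (hb : ENNReal.ofReal |(normalDeriv ν (x₀, s₀)).det| < b) :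
    ∃ N ∈ 𝓝 (x₀, s₀), ∀ S, MeasurableSet S → S ⊆ (frontier K ×ˢ univ) ∩ N →
      volume (normalMap ν '' S) ≤ b * tubeMeasure K S := by
  obtain ⟨δ, hδ, hδ0⟩ := ((addHaar_image_le_mul_of_det_lt volume _ hb).and
    self_mem_nhdsWithin).exists
  obtain ⟨N, hN, Y, hYK, hNY, hY, F, hF⟩ := h.exists_chart hx s₀ one_lt_two hδ0
  refine ⟨N, hN, fun S hS hSN => ?_⟩
  obtain ⟨hF1, hF2⟩ := hF S hSN
  rw [← hF2]
  refine (hδ _ _ hF1).trans ?_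
  gcongr
  exact (h.cylMap_image_comparison (h.unit x₀ hx) zero_le_two hY hYK hS (hSN.trans hNY)).1

theorem SmoothBody.le_volume_image_local (h : SmoothBody K ν) {x₀ : E (m + 1)}
    (hx : x₀ ∈ frontier K) (s₀ : ℝ) {a : NNReal}
    (ha : a < ENNReal.ofReal |(normalDeriv ν (x₀, s₀)).det|) :
    ∃ N ∈ 𝓝 (x₀, s₀), ∀ S, MeasurableSet S → S ⊆ (frontier K ×ˢ univ) ∩ N →
      a * tubeMeasure K S ≤ volume (normalMap ν '' S) := by
  obtain ⟨a', haa', ha'⟩ := ENNReal.lt_iff_exists_nnreal_btwn.1 ha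
  have hΛ : ∃ Λ : ℝ, 1 < Λ ∧ a * ENNReal.ofReal Λ ^ m ≤ a' := by
    have haa : (a : ℝ) < a' := by exact_mod_cast haa'
    have hc : Tendsto (fun Λ : ℝ => (a : ℝ) * Λ ^ m) (𝓝[>] 1) (𝓝 (a * 1 ^ m)) :=
      (Continuous.tendsto (by fun_prop) 1).mono_left nhdsWithin_le_nhds
    rw [one_pow, mul_one] at hc
    obtain ⟨Λ, h1, h2⟩ := ((hc.eventually_lt_const haa).and self_mem_nhdsWithin).exists
    refine ⟨Λ, h2, ?_⟩
    have h3 : (0 : ℝ) ≤ Λ := zero_le_one.trans (le_of_lt h2)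
    rw [← ENNReal.ofReal_pow h3, ← ENNReal.ofReal_coe_nnreal, ← ENNReal.ofReal_mul a.coe_nonneg,
      ← ENNReal.ofReal_coe_nnreal]
    exact ENNReal.ofReal_le_ofReal h1.le
  obtain ⟨Λ, hΛ1, hΛ2⟩ := hΛ
  obtain ⟨δ, hδ, hδ0⟩ := ((mul_le_addHaar_image_of_lt_det volume _ ha').and
    self_mem_nhdsWithin).exists
  obtain ⟨N, hN, Y, hYK, hNY, hY, F, hF⟩ := h.exists_chart hx s₀ hΛ1 hδ0
  refine ⟨N, hN, fun S hS hSN => ?_⟩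
  obtain ⟨hF1, hF2⟩ := hF S hSN
  rw [← hF2]
  refine le_trans ?_ (hδ _ _ hF1)
  have := (h.cylMap_image_comparison (h.unit x₀ hx) (by linarith) hY hYK hS (hSN.trans hNY)).2
  calc (a : ℝ≥0∞) * tubeMeasure K S
      ≤ a * (ENNReal.ofReal Λ ^ m * volume (cylMap (ν x₀) '' S)) := by gcongr
    _ = a * ENNReal.ofReal Λ ^ m * volume (cylMap (ν x₀) '' S) := by rw [mul_assoc]
    _ ≤ _ := by gcongr

end LocalTube

section GlobalTube

variable {m : ℕ} {K : Set (E (m + 1))} {ν : E (m + 1) → E (m + 1)}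

theorem SmoothBody.continuousOn_normalDeriv (h : SmoothBody K ν) :
    ContinuousOn (normalDeriv ν) (frontier K ×ˢ univ) := by
  unfold normalDeriv
  refine continuousOn_const.add (continuousOn_snd.smul ?_)
  exact h.continuousOn_weingarten.comp continuousOn_fst fun p hp => hp.1

/-- The Jacobian of the normal map. -/
def normalJac {V : Type*} [NormedAddCommGroup V] [InnerProductSpace ℝ V] (ν : V → V)
    (p : V × ℝ) : ℝ := |(normalDeriv ν p).det|

theorem normalJac_nonneg {V : Type*} [NormedAddCommGroup V] [InnerProductSpace ℝ V] (ν : V → V)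
    (p : V × ℝ) : 0 ≤ normalJac ν p := abs_nonneg _

theorem SmoothBody.continuousOn_normalJac (h : SmoothBody K ν) :
    ContinuousOn (normalJac ν) (frontier K ×ˢ univ) :=
  (ContinuousLinearMap.continuous_det.comp_continuousOn h.continuousOn_normalDeriv).abs

theorem SmoothBody.exists_nhds_volume_image (h : SmoothBody K ν) {p : E (m + 1) × ℝ}
    (hp : p ∈ frontier K ×ˢ (univ : Set ℝ)) {ε : NNReal} (hε : 0 < ε) :
    ∃ N ∈ 𝓝 p, ∀ S, MeasurableSet S → S ⊆ (frontier K ×ˢ univ) ∩ N →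
      volume (normalMap ν '' S)
        ≤ (∫⁻ z in S, ENNReal.ofReal (normalJac ν z) ∂tubeMeasure K) + ε * tubeMeasure K S ∧
      ∫⁻ z in S, ENNReal.ofReal (normalJac ν z) ∂tubeMeasure K
        ≤ volume (normalMap ν '' S) + ε * tubeMeasure K S := by
  obtain ⟨x₀, s₀⟩ := p
  have hx : x₀ ∈ frontier K := hp.1
  set J := normalJac ν (x₀, s₀) with hJ
  have hJ0 : 0 ≤ J := normalJac_nonneg _ _
  have hε' : (0 : ℝ) < ε := hε
  set b : NNReal := J.toNNReal + ε / 2 with hb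
  have hJr : ((J.toNNReal : NNReal) : ℝ) = J := Real.coe_toNNReal _ hJ0
  obtain ⟨N₁, hN₁, h₁⟩ := h.volume_image_le_local hx s₀ (b := b) (by
    change ENNReal.ofReal J < b
    rw [ENNReal.ofReal, ENNReal.coe_lt_coe, hb]
    exact lt_add_of_pos_right _ (by positivity))
  obtain ⟨N₂, hN₂, h₂⟩ : ∃ N₂ ∈ 𝓝 (x₀, s₀), ∀ S, MeasurableSet S →
      S ⊆ (frontier K ×ˢ univ) ∩ N₂ →
      ((J.toNNReal - ε / 2 : NNReal) : ℝ≥0∞) * tubeMeasure K S ≤ volume (normalMap ν '' S) := by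
    by_cases hJz : J = 0
    · refine ⟨univ, univ_mem, fun S _ _ => ?_⟩
      rw [hJz]
      simp
    · refine h.le_volume_image_local hx s₀ ?_
      change _ < ENNReal.ofReal J
      rw [ENNReal.ofReal, ENNReal.coe_lt_coe]
      exact tsub_lt_self (Real.toNNReal_pos.2 (lt_of_le_of_ne hJ0 (Ne.symm hJz))) (by positivity)
  have hc := (h.continuousOn_normalJac (x₀, s₀) hp).tendsto (ball_mem_nhds J (half_pos hε'))
  obtain ⟨N₃, hN₃, h₃⟩ := mem_nhdsWithin_iff_exists_mem_nhds_inter.1 hc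
  refine ⟨N₁ ∩ N₂ ∩ N₃, inter_mem (inter_mem hN₁ hN₂) hN₃, fun S hS hSN => ?_⟩
  have hJS : ∀ z ∈ S, |normalJac ν z - J| < ε / 2 := by
    intro z hz
    have := h₃ ⟨(hSN hz).2.2, (hSN hz).1⟩
    rwa [mem_preimage, mem_ball, Real.dist_eq] at this
  have e1 := h₁ S hS fun z hz => ⟨(hSN hz).1, (hSN hz).2.1.1⟩
  have e2 := h₂ S hS fun z hz => ⟨(hSN hz).1, (hSN hz).2.1.2⟩
  constructor
  · refine e1.trans ?_
    rw [← setLIntegral_const, ← setLIntegral_const, ← lintegral_add_right _ measurable_const]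
    refine setLIntegral_mono' hS fun z hz => ?_
    rw [ENNReal.ofReal, ← ENNReal.coe_add, ENNReal.coe_le_coe, ← NNReal.coe_le_coe]
    push_cast [hb]
    rw [hJr, Real.coe_toNNReal _ (normalJac_nonneg ν z)]
    have := (abs_lt.1 (hJS z hz)).1
    linarith
  · refine le_trans ?_ (add_le_add_left e2 _)
    rw [← add_mul, ← ENNReal.coe_add, ← setLIntegral_const]
    refine setLIntegral_mono' hS fun z hz => ?_
    rw [ENNReal.ofReal, ENNReal.coe_le_coe, ← NNReal.coe_le_coe]
    push_cast [NNReal.coe_sub_def]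
    rw [hJr, Real.coe_toNNReal _ (normalJac_nonneg ν z)]
    have := (abs_lt.1 (hJS z hz)).2
    have := le_max_left (J - ε / 2) 0
    linarith

theorem SmoothBody.continuousOn_normalMap (h : SmoothBody K ν) :
    ContinuousOn (normalMap ν) (frontier K ×ˢ univ) := by
  unfold normalMap
  exact continuousOn_fst.add (continuousOn_snd.smul
    (h.continuousOn.comp continuousOn_fst fun p hp => hp.1))

theorem SmoothBody.measurableSet_normalMap_image (h : SmoothBody K ν) {S : Set (E (m + 1) × ℝ)}
    (hS : MeasurableSet S) (hSK : S ⊆ frontier K ×ˢ univ) (hinj : InjOn (normalMap ν) S) :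
    MeasurableSet (normalMap ν '' S) :=
  hS.image_of_continuousOn_injOn (h.continuousOn_normalMap.mono hSK) hinj

theorem SmoothBody.volume_image_approx (h : SmoothBody K ν) {S : Set (E (m + 1) × ℝ)}
    (hS : MeasurableSet S) (hSK : S ⊆ frontier K ×ˢ univ) (hinj : InjOn (normalMap ν) S)
    {ε : NNReal} (hε : 0 < ε) :
    volume (normalMap ν '' S)
        ≤ (∫⁻ z in S, ENNReal.ofReal (normalJac ν z) ∂tubeMeasure K) + ε * tubeMeasure K S ∧
      ∫⁻ z in S, ENNReal.ofReal (normalJac ν z) ∂tubeMeasure K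
        ≤ volume (normalMap ν '' S) + ε * tubeMeasure K S := by
  choose! N hN hN2 using fun p (hp : p ∈ frontier K ×ˢ (univ : Set ℝ)) =>
    h.exists_nhds_volume_image hp hε
  obtain ⟨t, htK, htc, htU⟩ := TopologicalSpace.countable_cover_nhdsWithin
    (s := frontier K ×ˢ (univ : Set ℝ)) (f := fun p => interior (N p))
    fun p hp => mem_nhdsWithin_of_mem_nhds (interior_mem_nhds.2 (hN p hp))
  rcases t.eq_empty_or_nonempty with rfl | hne
  · have : S = ∅ := by
      rw [eq_empty_iff_forall_notMem]
      intro z hz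
      simpa using htU (hSK hz)
    subst this
    simp
  obtain ⟨g, rfl⟩ := htc.exists_eq_range hne
  have hgK : ∀ i, g i ∈ frontier K ×ˢ (univ : Set ℝ) := fun i => htK ⟨i, rfl⟩
  set T : ℕ → Set (E (m + 1) × ℝ) := fun i => S ∩ disjointed (fun i => interior (N (g i))) i with hT
  have hTm : ∀ i, MeasurableSet (T i) := fun i =>
    hS.inter (MeasurableSet.disjointed (fun i => isOpen_interior.measurableSet) i)
  have hTd : Pairwise (Function.onFun Disjoint T) := fun i j hij =>
    (disjoint_disjointed _ hij).mono inter_subset_right inter_subset_right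
  have hTS : ∀ i, T i ⊆ S := fun i => inter_subset_left
  have hTU : ⋃ i, T i = S := by
    rw [hT, ← inter_iUnion, iUnion_disjointed, inter_eq_left]
    intro z hz
    simpa using htU (hSK hz)
  have hTN : ∀ i, T i ⊆ (frontier K ×ˢ univ) ∩ N (g i) := fun i z hz =>
    ⟨hSK hz.1, interior_subset (disjointed_subset (fun i => interior (N (g i))) i hz.2)⟩
  have hloc := fun i => hN2 (g i) (hgK i) (T i) (hTm i) (hTN i)
  have a1 : volume (normalMap ν '' S) = ∑' i, volume (normalMap ν '' (T i)) := by
    rw [← hTU, image_iUnion]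
    refine measure_iUnion (fun i j hij => ?_) fun i =>
      h.measurableSet_normalMap_image (hTm i) ((hTS i).trans hSK) (hinj.mono (hTS i))
    exact (hTd hij).image hinj (hTS i) (hTS j)
  have a2 : tubeMeasure K S = ∑' i, tubeMeasure K (T i) := by
    conv_lhs => rw [← hTU]
    exact measure_iUnion hTd hTm
  have a3 : ∫⁻ z in S, ENNReal.ofReal (normalJac ν z) ∂tubeMeasure K
      = ∑' i, ∫⁻ z in T i, ENNReal.ofReal (normalJac ν z) ∂tubeMeasure K := by
    conv_lhs => rw [← hTU]
    exact lintegral_iUnion hTm hTd _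
  rw [a1, a2, a3, ← ENNReal.tsum_mul_left, ← ENNReal.tsum_add, ← ENNReal.tsum_add]
  exact ⟨ENNReal.tsum_le_tsum fun i => (hloc i).1, ENNReal.tsum_le_tsum fun i => (hloc i).2⟩

/-- The area formula for the normal map. -/
theorem SmoothBody.volume_normalMap_image (h : SmoothBody K ν) {S : Set (E (m + 1) × ℝ)}
    (hS : MeasurableSet S) (hSK : S ⊆ frontier K ×ˢ univ) (hinj : InjOn (normalMap ν) S)
    (hfin : tubeMeasure K S ≠ ⊤) :
    volume (normalMap ν '' S) = ∫⁻ z in S, ENNReal.ofReal (normalJac ν z) ∂tubeMeasure K := by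
  have hlim : ∀ A : ℝ≥0∞, Tendsto (fun ε : NNReal => A + ε * tubeMeasure K S) (𝓝[>] 0) (𝓝 A) := by
    intro A
    have h1 : Tendsto (fun ε : NNReal => (ε : ℝ≥0∞)) (𝓝[>] 0) (𝓝 0) :=
      (ENNReal.continuous_coe.tendsto' 0 0 rfl).mono_left nhdsWithin_le_nhds
    have h2 := ENNReal.Tendsto.mul_const h1 (Or.inr hfin)
    rw [zero_mul] at h2
    simpa using tendsto_const_nhds.add h2
  refine le_antisymm ?_ ?_
  · refine ge_of_tendsto (hlim _) ?_
    filter_upwards [self_mem_nhdsWithin] with ε hε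
    exact (h.volume_image_approx hS hSK hinj hε).1
  · refine ge_of_tendsto (hlim _) ?_
    filter_upwards [self_mem_nhdsWithin] with ε hε
    exact (h.volume_image_approx hS hSK hinj hε).2

end GlobalTube

section Determinant

variable {V : Type*} [NormedAddCommGroup V] [InnerProductSpace ℝ V] [FiniteDimensional ℝ V]

theorem hasFDerivAt_det_id_add :
    ∃ T : (V →L[ℝ] V) →L[ℝ] ℝ, (∀ A : V →L[ℝ] V, T A = LinearMap.trace ℝ V (A : V →ₗ[ℝ] V)) ∧
      HasFDerivAt (fun A : V →L[ℝ] V => (ContinuousLinearMap.id ℝ V + A).det) T 0 := by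
  classical
  let b := Module.finBasis ℝ V
  have hdet : ∀ A : V →L[ℝ] V, (ContinuousLinearMap.id ℝ V + A).det
      = (1 + LinearMap.toMatrix b b (A : V →ₗ[ℝ] V)).det := by
    intro A
    rw [ContinuousLinearMap.det, ← LinearMap.det_toMatrix b]
    congr 1
    rw [ContinuousLinearMap.toLinearMap_add, map_add, ContinuousLinearMap.coe_id,
      LinearMap.toMatrix_id]
  let entry : ∀ i j, (V →L[ℝ] V) →L[ℝ] ℝ := fun i j =>
    LinearMap.toContinuousLinearMap
      ((b.coord i).comp ((LinearMap.applyₗ (b j)).comp (ContinuousLinearMap.coeLM ℝ)))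
  have hentry : ∀ A : V →L[ℝ] V, ∀ i j,
      LinearMap.toMatrix b b (A : V →ₗ[ℝ] V) i j = entry i j A := by
    intro A i j
    rw [LinearMap.toMatrix_apply]
    rfl
  have hdiff : DifferentiableAt ℝ
      (fun A : V →L[ℝ] V => (ContinuousLinearMap.id ℝ V + A).det) 0 := by
    simp_rw [hdet, Matrix.det_apply', Matrix.add_apply, hentry]
    fun_prop
  refine ⟨_, fun A => ?_, hdiff.hasFDerivAt⟩
  have hline : HasDerivAt (fun r : ℝ => r • A) A 0 := by
    simpa using (hasDerivAt_id (0 : ℝ)).smul_const A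
  have h1 := (hdiff.hasFDerivAt.congr_fderiv rfl).comp_hasDerivAt_of_eq (0 : ℝ) hline
    (by rw [zero_smul])
  set M := LinearMap.toMatrix b b (A : V →ₗ[ℝ] V) with hM
  set P := (Matrix.det (1 + (Polynomial.X : Polynomial ℝ) • M.map Polynomial.C)).divX.divX
  have h2 : HasDerivAt (fun r : ℝ => 1 + M.trace * r + P.eval r * r ^ 2) M.trace 0 := by
    have ha : HasDerivAt (fun r : ℝ => 1 + M.trace * r) M.trace 0 := by
      simpa using ((hasDerivAt_id (0 : ℝ)).const_mul M.trace).const_add 1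
    have hb := (P.hasDerivAt 0).mul ((hasDerivAt_id (0 : ℝ)).pow 2)
    exact HasDerivAt.congr_deriv (ha.add hb) (by simp)
  have h3 : ((fun A : V →L[ℝ] V => (ContinuousLinearMap.id ℝ V + A).det) ∘ fun r : ℝ => r • A)
      = fun r : ℝ => 1 + M.trace * r + P.eval r * r ^ 2 := by
    funext r
    rw [Function.comp_apply, hdet, ContinuousLinearMap.toLinearMap_smul, map_smul,
      Matrix.det_one_add_smul]
  rw [h3] at h1
  rw [h1.unique h2, LinearMap.trace_eq_matrix_trace ℝ b]

/-- The sum of the principal curvatures. -/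
def meanCurv (ν : V → V) (x : V) : ℝ :=
  LinearMap.trace ℝ V ((fderiv ℝ ν x).comp (tp (ν x)) : V →L[ℝ] V).toLinearMap

theorem SmoothBody.continuousOn_meanCurv {K : Set V} {ν : V → V} (h : SmoothBody K ν) :
    ContinuousOn (meanCurv ν) (frontier K) := by
  obtain ⟨T, hT, -⟩ := hasFDerivAt_det_id_add (V := V)
  refine (T.continuous.comp_continuousOn h.continuousOn_weingarten).congr fun x _ => ?_
  rw [Function.comp_apply, hT]
  rfl

theorem SmoothBody.normalJac_expansion {K : Set V} {ν : V → V} (h : SmoothBody K ν) {δ : ℝ}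
    (hδ : 0 < δ) : ∃ e > 0, ∀ x ∈ frontier K, ∀ s : ℝ, |s| < e →
      |normalJac ν (x, s) - (1 + s * meanCurv ν x)| ≤ δ * |s| := by
  obtain ⟨T, hT, hd⟩ := hasFDerivAt_det_id_add (V := V)
  obtain ⟨C, hC⟩ := h.isCompact_frontier.exists_bound_of_continuousOn h.continuousOn_weingarten
  set M := max C 1 with hM
  have hM0 : 0 < M := lt_of_lt_of_le one_pos (le_max_right _ _)
  have h1 := hd.isLittleO.def (show 0 < δ / M by positivity)
  have h2 : ∀ᶠ A : V →L[ℝ] V in 𝓝 0, 0 < (ContinuousLinearMap.id ℝ V + A).det := by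
    have hc := hd.continuousAt.tendsto
    refine hc.eventually (lt_mem_nhds ?_)
    rw [add_zero]
    simp [ContinuousLinearMap.det]
  obtain ⟨r, hr, hball⟩ := Metric.eventually_nhds_iff.1 (h1.and h2)
  refine ⟨r / M, by positivity, fun x hx s hs => ?_⟩
  set B := (fderiv ℝ ν x).comp (tp (ν x)) with hB
  have hBM : ‖B‖ ≤ M := (hC x hx).trans (le_max_left _ _)
  have hsB : ‖s • B‖ ≤ |s| * M := by
    rw [norm_smul, Real.norm_eq_abs]
    gcongr
  obtain ⟨h3, h4⟩ := hball (y := s • B) (by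
    rw [dist_zero_right]
    exact hsB.trans_lt ((lt_div_iff₀ hM0).1 hs))
  have h5 : normalJac ν (x, s) = (ContinuousLinearMap.id ℝ V + s • B).det := abs_of_pos h4
  have h6 : T (s • B) = s * meanCurv ν x := by
    rw [map_smul, hT, smul_eq_mul]
    rfl
  rw [h5]
  simp only [sub_zero, add_zero] at h3
  rw [h6, Real.norm_eq_abs] at h3
  have h7 : (ContinuousLinearMap.id ℝ V).det = 1 := by simp [ContinuousLinearMap.det]
  rw [h7] at h3
  calc _ = |(ContinuousLinearMap.id ℝ V + s • B).det - 1 - s * meanCurv ν x| := by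
        rw [sub_sub]
    _ ≤ δ / M * ‖s • B‖ := h3
    _ ≤ δ / M * (|s| * M) := by gcongr
    _ = δ * |s| := by field_simp

end Determinant

section Layer

/-- The points of the tube over `X` between the heights `f` (excluded) and `g` (included). -/
def layer {V : Type*} (X : Set V) (f g : V → ℝ) : Set (V × ℝ) :=
  {z | z.1 ∈ X ∧ z.2 ∈ Ioc (f z.1) (g z.1)}

variable {m : ℕ} {K : Set (E (m + 1))} {ν : E (m + 1) → E (m + 1)}

theorem SmoothBody.lintegral_layer (h : SmoothBody K ν) {f g c : E (m + 1) → ℝ}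
    (hf : Measurable f) (hg : Measurable g) (hc : Measurable c)
    (hfg : ∀ x ∈ frontier K, f x ≤ g x)
    (hnn : ∀ x ∈ frontier K, ∀ s ∈ Ioc (f x) (g x), 0 ≤ 1 + s * c x)
    (hgint : Integrable (fun x => g x - f x + (g x ^ 2 - f x ^ 2) / 2 * c x) (surfaceMeasure K)) :
    ∫⁻ z in layer (frontier K) f g, ENNReal.ofReal (1 + z.2 * c z.1) ∂tubeMeasure K
      = ENNReal.ofReal
        (∫ x, (g x - f x + (g x ^ 2 - f x ^ 2) / 2 * c x) ∂surfaceMeasure K) := by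
  have := h.isFiniteMeasure
  have hX : MeasurableSet (frontier K) := isClosed_frontier.measurableSet
  have hL : MeasurableSet (layer (frontier K) f g) := measurableSet_region_between_oc hf hg hX
  have hF : Measurable fun z : E (m + 1) × ℝ => ENNReal.ofReal (1 + z.2 * c z.1) := by fun_prop
  rw [← lintegral_indicator hL, tubeMeasure, lintegral_prod _ (hF.indicator hL).aemeasurable]
  have hin : ∀ᵐ x ∂surfaceMeasure K,
      ∫⁻ s : ℝ, (layer (frontier K) f g).indicator
        (fun z : E (m + 1) × ℝ => ENNReal.ofReal (1 + z.2 * c z.1)) (x, s)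
      = ENNReal.ofReal (g x - f x + (g x ^ 2 - f x ^ 2) / 2 * c x) ∧
      0 ≤ g x - f x + (g x ^ 2 - f x ^ 2) / 2 * c x := by
    filter_upwards [ae_restrict_mem hX] with x hx
    have e0 : ∫ s in Ioc (f x) (g x), (1 + s * c x)
        = g x - f x + (g x ^ 2 - f x ^ 2) / 2 * c x := by
      rw [← intervalIntegral.integral_of_le (hfg x hx), intervalIntegral.integral_add
        (by simp) (Continuous.intervalIntegrable (by fun_prop) _ _),
        intervalIntegral.integral_mul_const, integral_id]
      simp
    have e1 : ∀ s, (layer (frontier K) f g).indicator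
        (fun z : E (m + 1) × ℝ => ENNReal.ofReal (1 + z.2 * c z.1)) (x, s)
        = (Ioc (f x) (g x)).indicator (fun s => ENNReal.ofReal (1 + s * c x)) s := by
      intro s
      by_cases hs : s ∈ Ioc (f x) (g x)
      · rw [indicator_of_mem hs, indicator_of_mem (show (x, s) ∈ layer (frontier K) f g from
          ⟨hx, hs⟩)]
      · rw [indicator_of_notMem hs, indicator_of_notMem fun hm => hs hm.2]
    have enn : 0 ≤ᵐ[volume.restrict (Ioc (f x) (g x))] fun s => 1 + s * c x := by
      filter_upwards [ae_restrict_mem measurableSet_Ioc] with s hs using hnn x hx s hs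
    constructor
    · simp_rw [e1]
      rw [lintegral_indicator measurableSet_Ioc, ← e0, ofReal_integral_eq_lintegral_ofReal _ enn]
      exact (Continuous.integrableOn_Icc (by fun_prop)).mono_set Ioc_subset_Icc_self
    · rw [← e0]
      exact integral_nonneg_of_ae enn
  rw [ofReal_integral_eq_lintegral_ofReal hgint (hin.mono fun x hx => hx.2)]
  exact lintegral_congr_ae (hin.mono fun x hx => hx.1)

theorem measurable_indicator_frontier {f : E (m + 1) → ℝ}
    (hf : ContinuousOn f (frontier K)) : Measurable ((frontier K).indicator f) := by
  classical
  have := hf.measurable_piecewise (g := 0) continuousOn_const isClosed_frontier.measurableSet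
  rwa [piecewise_eq_indicator] at this

theorem SmoothBody.integrable_of_continuousOn (h : SmoothBody K ν) {f : E (m + 1) → ℝ}
    (hf : ContinuousOn f (frontier K)) : Integrable f (surfaceMeasure K) := by
  have := h.isFiniteMeasure
  obtain ⟨C, hC⟩ := h.isCompact_frontier.exists_bound_of_continuousOn hf
  refine Integrable.of_bound (hf.aestronglyMeasurable isClosed_frontier.measurableSet) C ?_
  filter_upwards [ae_restrict_mem isClosed_frontier.measurableSet] with x hx using hC x hx

theorem SmoothBody.layer_bounds (h : SmoothBody K ν) {δ : ℝ} (hδ : 0 < δ) :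
    ∃ e > 0, InjOn (normalMap ν) (frontier K ×ˢ Ioo (-e) e) ∧
      ∀ f g : E (m + 1) → ℝ, ContinuousOn f (frontier K) → ContinuousOn g (frontier K) →
        (∀ x ∈ frontier K, f x ≤ g x) → (∀ x ∈ frontier K, -e < f x) →
        (∀ x ∈ frontier K, g x < e) →
        MeasurableSet (normalMap ν '' layer (frontier K) f g) ∧
        volume (normalMap ν '' layer (frontier K) f g) ≠ ⊤ ∧
        (∀ c : E (m + 1) → ℝ, ContinuousOn c (frontier K) →
          (∀ x ∈ frontier K, ∀ s ∈ Ioc (f x) (g x), s * meanCurv ν x + δ * |s| ≤ s * c x) →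
          volume.real (normalMap ν '' layer (frontier K) f g)
            ≤ ∫ x, (g x - f x + (g x ^ 2 - f x ^ 2) / 2 * c x) ∂surfaceMeasure K) ∧
        (∀ c : E (m + 1) → ℝ, ContinuousOn c (frontier K) →
          (∀ x ∈ frontier K, |c x| ≤ |meanCurv ν x| + δ) →
          (∀ x ∈ frontier K, ∀ s ∈ Ioc (f x) (g x), s * c x ≤ s * meanCurv ν x - δ * |s|) →
          ∫ x, (g x - f x + (g x ^ 2 - f x ^ 2) / 2 * c x) ∂surfaceMeasure K
            ≤ volume.real (normalMap ν '' layer (frontier K) f g)) := by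
  have hfin := h.isFiniteMeasure
  have hX : MeasurableSet (frontier K) := isClosed_frontier.measurableSet
  obtain ⟨L, hL1, hL⟩ := h.exists_lipschitz
  obtain ⟨e₀, he₀, hexp⟩ := h.normalJac_expansion hδ
  have hinj₀ := h.injOn_normalMap hL1 hL
  obtain ⟨M, hM⟩ := h.isCompact_frontier.exists_bound_of_continuousOn h.continuousOn_meanCurv
  set e := min (min e₀ (1 / (8 * L))) (1 / (|M| + δ)) with he
  have hepos : 0 < e := lt_min (lt_min he₀ (by positivity)) (by positivity)
  have heL : e ≤ 1 / (8 * L) := (min_le_left _ _).trans (min_le_right _ _)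
  have heM : e * (|M| + δ) ≤ 1 := by
    rw [← le_div_iff₀ (by positivity)]
    exact min_le_right _ _
  have hinj : InjOn (normalMap ν) (frontier K ×ˢ Ioo (-e) e) := hinj₀.mono
    (prod_mono subset_rfl (Ioo_subset_Ioo (neg_le_neg heL) heL))
  refine ⟨e, hepos, hinj, fun f g hf hg hfg hfe hge => ?_⟩
  set f' := (frontier K).indicator f
  set g' := (frontier K).indicator g
  have hf' : ∀ x ∈ frontier K, f' x = f x := fun x hx => indicator_of_mem hx _
  have hg' : ∀ x ∈ frontier K, g' x = g x := fun x hx => indicator_of_mem hx _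
  have hlay : layer (frontier K) f g = layer (frontier K) f' g' := by
    ext z
    simp only [layer, mem_ofPred_eq]
    refine and_congr_right fun hz => ?_
    rw [hf' _ hz, hg' _ hz]
  set S := layer (frontier K) f g with hSdef
  have hS : MeasurableSet S := by
    rw [hlay]
    exact measurableSet_region_between_oc (measurable_indicator_frontier hf)
      (measurable_indicator_frontier hg) hX
  have hSe : S ⊆ frontier K ×ˢ Ioo (-e) e := fun z hz =>
    ⟨hz.1, (hfe _ hz.1).trans hz.2.1, hz.2.2.trans_lt (hge _ hz.1)⟩
  have hSK : S ⊆ frontier K ×ˢ univ := hSe.trans (prod_mono subset_rfl (subset_univ _))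
  have hτ : tubeMeasure K S ≠ ⊤ := by
    refine ((measure_mono (hSe.trans (prod_mono (subset_univ _) subset_rfl))).trans_lt ?_).ne
    rw [tubeMeasure, Measure.prod_prod]
    exact ENNReal.mul_lt_top (measure_lt_top _ _) (by simp)
  have hvol := h.volume_normalMap_image hS hSK (hinj.mono hSe) hτ
  have hJ : ∀ z ∈ S, |normalJac ν z - (1 + z.2 * meanCurv ν z.1)| ≤ δ * |z.2| := fun z hz =>
    hexp z.1 hz.1 z.2 ((abs_lt.2 (hSe hz).2).trans_le ((min_le_left _ _).trans (min_le_left _ _)))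
  have key : ∀ c : E (m + 1) → ℝ, ContinuousOn c (frontier K) →
      (∀ x ∈ frontier K, ∀ s ∈ Ioc (f x) (g x), 0 ≤ 1 + s * c x) →
      ∫⁻ z in S, ENNReal.ofReal (1 + z.2 * c z.1) ∂tubeMeasure K
        = ENNReal.ofReal
          (∫ x, (g x - f x + (g x ^ 2 - f x ^ 2) / 2 * c x) ∂surfaceMeasure K) ∧
      0 ≤ ∫ x, (g x - f x + (g x ^ 2 - f x ^ 2) / 2 * c x) ∂surfaceMeasure K := by
    intro c hc hnn
    have hc' : ∀ x ∈ frontier K, (frontier K).indicator c x = c x := fun x hx =>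
      indicator_of_mem hx _
    have hcongr : (fun x => g' x - f' x + (g' x ^ 2 - f' x ^ 2) / 2 * (frontier K).indicator c x)
        =ᵐ[surfaceMeasure K] fun x => g x - f x + (g x ^ 2 - f x ^ 2) / 2 * c x := by
      filter_upwards [ae_restrict_mem hX] with x hx
      rw [hf' x hx, hg' x hx, hc' x hx]
    have h1 := h.lintegral_layer (measurable_indicator_frontier hf)
      (measurable_indicator_frontier hg)
      (measurable_indicator_frontier hc) (fun x hx => by
        change f' x ≤ g' x
        rw [hf' x hx, hg' x hx]
        exact hfg x hx)
      (fun x hx s hs => by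
        change s ∈ Ioc (f' x) (g' x) at hs
        rw [hf' x hx, hg' x hx] at hs
        rw [hc' x hx]
        exact hnn x hx s hs)
      ((h.integrable_of_continuousOn (by fun_prop)).congr hcongr.symm)
    rw [← hlay, integral_congr_ae hcongr] at h1
    constructor
    · rw [← h1]
      refine setLIntegral_congr_fun hS fun z hz => ?_
      simp only [hc' _ hz.1]
    · refine integral_nonneg_of_ae ?_
      filter_upwards [ae_restrict_mem hX] with x hx
      have := setIntegral_nonneg (μ := volume) measurableSet_Ioc (hnn x hx)
      rw [← intervalIntegral.integral_of_le (hfg x hx), intervalIntegral.integral_add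
        (by simp) (Continuous.intervalIntegrable (by fun_prop) _ _),
        intervalIntegral.integral_mul_const, integral_id] at this
      simpa using this
  have hup : ∀ c : E (m + 1) → ℝ, ContinuousOn c (frontier K) →
      (∀ x ∈ frontier K, ∀ s ∈ Ioc (f x) (g x), s * meanCurv ν x + δ * |s| ≤ s * c x) →
      volume (normalMap ν '' S) ≤ ENNReal.ofReal
        (∫ x, (g x - f x + (g x ^ 2 - f x ^ 2) / 2 * c x) ∂surfaceMeasure K) ∧
      0 ≤ ∫ x, (g x - f x + (g x ^ 2 - f x ^ 2) / 2 * c x) ∂surfaceMeasure K := by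
    intro c hc hcs
    have hle : ∀ z ∈ S, normalJac ν z ≤ 1 + z.2 * c z.1 := by
      intro z hz
      have h1 := (abs_le.1 (hJ z hz)).2
      have h2 := hcs z.1 hz.1 z.2 hz.2
      linarith
    obtain ⟨h1, h2⟩ := key c hc fun x hx s hs =>
      (normalJac_nonneg ν (x, s)).trans (hle (x, s) ⟨hx, hs⟩)
    refine ⟨?_, h2⟩
    rw [hvol, ← h1]
    exact setLIntegral_mono' hS fun z hz => ENNReal.ofReal_le_ofReal (hle z hz)
  have htop : volume (normalMap ν '' S) ≠ ⊤ := by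
    refine (measure_mono (image_mono (hSe.trans (prod_mono subset_rfl Ioo_subset_Icc_self)))
      |>.trans_lt ?_).ne
    exact ((h.isCompact_frontier.prod isCompact_Icc).image_of_continuousOn
      (h.continuousOn_normalMap.mono (prod_mono subset_rfl (subset_univ _)))).measure_lt_top
  refine ⟨h.measurableSet_normalMap_image hS hSK (hinj.mono hSe), htop, fun c hc hcs => ?_,
    fun c hc hce hcs => ?_⟩
  · obtain ⟨h1, h2⟩ := hup c hc hcs
    exact ENNReal.toReal_le_of_le_ofReal h2 h1
  · have hnn : ∀ x ∈ frontier K, ∀ s ∈ Ioc (f x) (g x), 0 ≤ 1 + s * c x := by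
      intro x hx s hs
      have h1 : |s| < e := abs_lt.2 (hSe (show (x, s) ∈ S from ⟨hx, hs⟩)).2
      have h2 : |s * c x| ≤ e * (|M| + δ) := by
        rw [abs_mul]
        refine mul_le_mul h1.le ((hce x hx).trans ?_) (abs_nonneg _) hepos.le
        exact add_le_add_left ((hM x hx).trans (le_abs_self M)) δ
      linarith [(abs_le.1 h2).1]
    obtain ⟨h1, h2⟩ := key c hc hnn
    refine (ENNReal.ofReal_le_iff_le_toReal htop).1 ?_
    rw [← h1, hvol]
    refine setLIntegral_mono' hS fun z hz => ENNReal.ofReal_le_ofReal ?_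
    have h1 := (abs_le.1 (hJ z hz)).1
    have h2 := hcs z.1 hz.1 z.2 hz.2
    linarith

end Layer

section Perturb

variable {V : Type*} [NormedAddCommGroup V] [InnerProductSpace ℝ V]
  {K : Set V} {ν : V → V}

/-- The body `K` with its boundary moved by `t * ψ` in the normal direction. -/
def perturb (K : Set V) (ν : V → V) (ψ : V → ℝ) (t : ℝ) : Set V :=
  (K \ normalMap ν '' layer (frontier K) (fun x => min (t * ψ x) 0) 0) ∪
    normalMap ν '' layer (frontier K) 0 (fun x => max (t * ψ x) 0)

theorem SmoothBody.inner_perturb_le [FiniteDimensional ℝ V] [Nontrivial V] (h : SmoothBody K ν)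
    {ψ p : V → ℝ} {M t : ℝ} (ht : 0 < t) (hM : ∀ x ∈ frontier K, |ψ x| ≤ M)
    (hp : ∀ x ∈ frontier K, 0 ≤ p x)
    (hest : ∀ x ∈ frontier K, ∀ z ∈ frontier K, ∀ s : ℝ, s ≤ t * ψ x → |s| ≤ t * M →
      ⟪x - z, ν z⟫ + s * ⟪ν x, ν z⟫ ≤ t * ψ z + t ^ 2 * p z)
    {a : V} (ha : a ∈ perturb K ν ψ t) {z : V} (hz : z ∈ frontier K) :
    ⟪a - z, ν z⟫ ≤ t * ψ z + t ^ 2 * p z := by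
  have hform : ∀ x s, ⟪normalMap ν (x, s) - z, ν z⟫ = ⟪x - z, ν z⟫ + s * ⟪ν x, ν z⟫ := by
    intro x s
    rw [normalMap, ← real_inner_smul_left, ← inner_add_left]
    congr 1
    abel
  rcases ha with ⟨haK, har⟩ | ⟨⟨x, s⟩, ⟨hx, hs⟩, rfl⟩
  · obtain ⟨x, hx, d, hd, rfl, hball⟩ := h.exists_normal_of_mem haK
    have hd1 : -d ≤ t * ψ x := by
      by_contra! hlt
      exact har ⟨(x, -d), ⟨hx, min_lt_of_left_lt hlt, neg_nonpos.2 hd⟩, rfl⟩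
    by_cases hdM : d ≤ t * M
    · rw [hform]
      exact hest x hx z hz _ hd1 (by rwa [abs_neg, abs_of_nonneg hd])
    · have hmem : normalMap ν (x, -d) + d • ν z ∈ K := hball (by
        rw [mem_closedBall, dist_self_add_left, norm_smul, h.unit z hz, mul_one,
          Real.norm_of_nonneg hd])
      have h1 := h.outer z hz _ hmem
      rw [add_sub_right_comm, inner_add_left, real_inner_smul_left, real_inner_self_eq_norm_sq,
        h.unit z hz] at h1
      have h2 := mul_le_mul_of_nonneg_left (neg_le_of_abs_le (hM z hz)) ht.le
      have h3 := mul_nonneg (sq_nonneg t) (hp z hz)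
      linarith
  · have hs1 : 0 < s := hs.1
    have hs2 : s ≤ max (t * ψ x) 0 := hs.2
    have hs3 : s ≤ t * ψ x := (le_max_iff.1 hs2).resolve_right (not_le.2 hs1)
    rw [hform]
    refine hest x hx z hz s hs3 ?_
    rw [abs_of_pos hs1]
    exact hs3.trans (mul_le_mul_of_nonneg_left ((le_abs_self _).trans (hM x hx)) ht.le)

theorem SmoothBody.midpoint_perturb_mem [FiniteDimensional ℝ V] [Nontrivial V]
    (h : SmoothBody K ν) {ψ p : V → ℝ} {M t : ℝ} (ht : 0 < t)
    (hM : ∀ x ∈ frontier K, |ψ x| ≤ M) (hp : ∀ x ∈ frontier K, 0 ≤ p x)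
    (hest : ∀ x ∈ frontier K, ∀ z ∈ frontier K, ∀ s : ℝ, s ≤ t * ψ x → |s| ≤ t * M →
      ⟪x - z, ν z⟫ + s * ⟪ν x, ν z⟫ ≤ t * ψ z + t ^ 2 * p z)
    (hest' : ∀ x ∈ frontier K, ∀ z ∈ frontier K, ∀ s : ℝ, s ≤ t * -ψ x → |s| ≤ t * M →
      ⟪x - z, ν z⟫ + s * ⟪ν x, ν z⟫ ≤ t * -ψ z + t ^ 2 * p z)
    {a b : V} (ha : a ∈ perturb K ν ψ t) (hb : b ∈ perturb K ν (fun x => -ψ x) t) :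
    (2⁻¹ : ℝ) • (a + b) ∈
      K ∪ normalMap ν '' layer (frontier K) 0 (fun x => t ^ 2 * p x) := by
  by_cases hy : (2⁻¹ : ℝ) • (a + b) ∈ K
  · exact Or.inl hy
  obtain ⟨z, hz, d, hd, hyz, -⟩ := h.exists_normal_of_notMem hy
  refine Or.inr ⟨(z, d), ⟨hz, hd, ?_⟩, hyz.symm⟩
  have h1 := h.inner_perturb_le ht hM hp hest ha hz
  have h2 := h.inner_perturb_le (ψ := fun x => -ψ x) ht
    (fun x hx => by rw [abs_neg]; exact hM x hx) hp hest' hb hz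
  have h3 : ⟪(2⁻¹ : ℝ) • (a + b) - z, ν z⟫ = d := by
    rw [hyz, normalMap, add_sub_cancel_left, real_inner_smul_left, real_inner_self_eq_norm_sq,
      h.unit z hz]
    ring
  have h4 : (2⁻¹ : ℝ) • (a + b) - z = (2⁻¹ : ℝ) • (a - z) + (2⁻¹ : ℝ) • (b - z) := by
    module
  rw [h4, inner_add_left, real_inner_smul_left, real_inner_smul_left] at h3
  change d ≤ t ^ 2 * p z
  linarith

end Perturb

section Volume

variable {m : ℕ} {K : Set (E (m + 1))} {ν : E (m + 1) → E (m + 1)}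

theorem SmoothBody.eventually_small (h : SmoothBody K ν) {ψ : E (m + 1) → ℝ}
    (hψ : ContinuousOn ψ (frontier K)) {e : ℝ} (he : 0 < e) :
    ∀ᶠ t : ℝ in 𝓝[>] 0, ∀ x ∈ frontier K, |t * ψ x| < e := by
  obtain ⟨C, hC⟩ := h.isCompact_frontier.exists_bound_of_continuousOn hψ
  have h1 : Tendsto (fun t : ℝ => t * |C|) (𝓝[>] 0) (𝓝 0) := by
    have : Tendsto (fun t : ℝ => t * |C|) (𝓝 0) (𝓝 (0 * |C|)) :=
      (continuous_id.mul continuous_const).tendsto 0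
    rw [zero_mul] at this
    exact this.mono_left nhdsWithin_le_nhds
  filter_upwards [h1.eventually_lt_const he, self_mem_nhdsWithin] with t ht ht0 x hx
  rw [abs_mul, abs_of_pos ht0]
  exact (mul_le_mul_of_nonneg_left ((hC x hx).trans (le_abs_self C)) (le_of_lt ht0)).trans_lt ht

theorem SmoothBody.volume_perturb_ge (h : SmoothBody K ν) {ψ : E (m + 1) → ℝ}
    (hψ : ContinuousOn ψ (frontier K)) {δ : ℝ} (hδ : 0 < δ) :
    ∀ᶠ t : ℝ in 𝓝[>] 0, MeasurableSet (perturb K ν ψ t) ∧ volume (perturb K ν ψ t) ≠ ⊤ ∧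
      volume.real K + t * ∫ x, ψ x ∂surfaceMeasure K
        + t ^ 2 / 2 * ∫ x, ψ x ^ 2 * (meanCurv ν x - δ) ∂surfaceMeasure K
        ≤ volume.real (perturb K ν ψ t) := by
  obtain ⟨e, he, hinj, hb⟩ := h.layer_bounds hδ
  have hH := h.continuousOn_meanCurv
  filter_upwards [h.eventually_small hψ he, self_mem_nhdsWithin] with t hsm (ht : 0 < t)
  have hup : ContinuousOn (fun x => max (t * ψ x) 0) (frontier K) := by fun_prop
  have hdn : ContinuousOn (fun x => min (t * ψ x) 0) (frontier K) := by fun_prop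
  obtain ⟨mu, fu, -, lu⟩ := hb 0 (fun x => max (t * ψ x) 0) continuousOn_const hup
    (fun x _ => le_max_right _ _) (fun x _ => neg_lt_zero.2 he)
    (fun x hx => max_lt (lt_of_abs_lt (hsm x hx)) he)
  obtain ⟨md, fd, ld, -⟩ := hb (fun x => min (t * ψ x) 0) 0 hdn continuousOn_const
    (fun x _ => min_le_right _ _) (fun x hx => lt_min (neg_lt_of_abs_lt (hsm x hx))
      (neg_lt_zero.2 he)) (fun x _ => he)
  have lu' := lu (fun x => meanCurv ν x - δ) (by fun_prop)
    (fun x _ => (abs_sub _ _).trans (by rw [abs_of_pos hδ])) fun x _ s hs => by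
      rw [abs_of_pos (show 0 < s from hs.1)]
      linarith
  have ld' := ld (fun x => meanCurv ν x - δ) (by fun_prop) fun x _ s hs => by
      rw [abs_of_nonpos (show s ≤ 0 from hs.2)]
      linarith
  set U := normalMap ν '' layer (frontier K) 0 (fun x => max (t * ψ x) 0)
  set D := normalMap ν '' layer (frontier K) (fun x => min (t * ψ x) 0) 0
  have hDK : D ⊆ K := by
    rintro _ ⟨⟨x, s⟩, ⟨hx, hs⟩, rfl⟩
    exact h.normalMap_mem hinj hx
      ((lt_min (neg_lt_of_abs_lt (hsm x hx)) (neg_lt_zero.2 he)).trans hs.1) hs.2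
  have hUK : Disjoint (K \ D) U := by
    rw [Set.disjoint_left]
    rintro _ ⟨hk, -⟩ ⟨⟨x, s⟩, ⟨hx, hs⟩, rfl⟩
    exact h.normalMap_notMem hx hs.1 hk
  have hKm : MeasurableSet K := h.isClosed.measurableSet
  have hKf : volume K ≠ ⊤ := h.compact.measure_lt_top.ne
  have hKD : volume (K \ D) ≠ ⊤ := ((measure_mono sdiff_subset).trans_lt hKf.lt_top).ne
  refine ⟨(hKm.diff md).union mu, ?_, ?_⟩
  · exact ((measure_union_le _ _).trans_lt (ENNReal.add_lt_top.2 ⟨hKD.lt_top, fu.lt_top⟩)).ne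
  · have e1 : volume.real (perturb K ν ψ t) = volume.real K - volume.real D + volume.real U := by
      rw [perturb, measureReal_union hUK mu hKD fu, measureReal_sdiff hDK md hKf]
    have i1 : ∀ f : E (m + 1) → ℝ, ContinuousOn f (frontier K) →
      Integrable f (surfaceMeasure K) := fun f hf => h.integrable_of_continuousOn hf
    have e2 : t * ∫ x, ψ x ∂surfaceMeasure K
        + t ^ 2 / 2 * ∫ x, ψ x ^ 2 * (meanCurv ν x - δ) ∂surfaceMeasure K
        = (∫ x, (max (t * ψ x) 0 - (0 : E (m + 1) → ℝ) x
            + (max (t * ψ x) 0 ^ 2 - (0 : E (m + 1) → ℝ) x ^ 2) / 2 * (meanCurv ν x - δ))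
            ∂surfaceMeasure K)
          - ∫ x, ((0 : E (m + 1) → ℝ) x - min (t * ψ x) 0
            + ((0 : E (m + 1) → ℝ) x ^ 2 - min (t * ψ x) 0 ^ 2) / 2 * (meanCurv ν x - δ))
            ∂surfaceMeasure K := by
      simp only [Pi.zero_apply]
      rw [← integral_sub (i1 _ (by fun_prop)) (i1 _ (by fun_prop)), ← integral_const_mul,
        ← integral_const_mul, ← integral_add (i1 _ (by fun_prop)) (i1 _ (by fun_prop))]
      refine integral_congr_ae (.of_forall fun x => ?_)
      rcases le_total (t * ψ x) 0 with h0 | h0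
      · simp only [max_eq_right h0, min_eq_left h0]
        ring
      · simp only [max_eq_left h0, min_eq_right h0]
        ring
    rw [e1, add_assoc, e2]
    linarith

theorem SmoothBody.volume_outer_le (h : SmoothBody K ν) {p : E (m + 1) → ℝ}
    (hp : ContinuousOn p (frontier K)) (hp0 : ∀ x ∈ frontier K, 0 ≤ p x) :
    ∀ᶠ t : ℝ in 𝓝[>] 0,
      MeasurableSet (K ∪ normalMap ν '' layer (frontier K) 0 (fun x => t ^ 2 * p x)) ∧
      volume (K ∪ normalMap ν '' layer (frontier K) 0 (fun x => t ^ 2 * p x)) ≠ ⊤ ∧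
      volume.real (K ∪ normalMap ν '' layer (frontier K) 0 (fun x => t ^ 2 * p x))
        ≤ volume.real K + t ^ 2 * ∫ x, p x ∂surfaceMeasure K
          + t ^ 4 / 2 * ∫ x, p x ^ 2 * (meanCurv ν x + 1) ∂surfaceMeasure K := by
  obtain ⟨e, he, hinj, hb⟩ := h.layer_bounds one_pos
  have hH := h.continuousOn_meanCurv
  filter_upwards [h.eventually_small hp he, self_mem_nhdsWithin,
    mem_nhdsWithin_of_mem_nhds (Iio_mem_nhds one_pos)] with t hsm (ht : 0 < t) (ht1 : t < 1)
  have hlt : ∀ x ∈ frontier K, t ^ 2 * p x < e := by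
    intro x hx
    have h1 := lt_of_abs_lt (hsm x hx)
    have h2 : t ^ 2 * p x ≤ t * p x :=
      mul_le_mul_of_nonneg_right (by nlinarith) (hp0 x hx)
    linarith
  obtain ⟨mu, fu, lu, -⟩ := hb 0 (fun x => t ^ 2 * p x) continuousOn_const (by fun_prop)
    (fun x hx => mul_nonneg (sq_nonneg t) (hp0 x hx)) (fun x _ => neg_lt_zero.2 he) hlt
  have lu' := lu (fun x => meanCurv ν x + 1) (by fun_prop) fun x _ s hs => by
      rw [abs_of_pos (show 0 < s from hs.1)]
      linarith
  have hKf : volume K ≠ ⊤ := h.compact.measure_lt_top.ne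
  refine ⟨h.isClosed.measurableSet.union mu, ?_, ?_⟩
  · exact ((measure_union_le _ _).trans_lt (ENNReal.add_lt_top.2 ⟨hKf.lt_top, fu.lt_top⟩)).ne
  · refine (measureReal_union_le _ _).trans ?_
    have i1 : ∀ f : E (m + 1) → ℝ, ContinuousOn f (frontier K) →
      Integrable f (surfaceMeasure K) := fun f hf => h.integrable_of_continuousOn hf
    have e2 : t ^ 2 * ∫ x, p x ∂surfaceMeasure K
          + t ^ 4 / 2 * ∫ x, p x ^ 2 * (meanCurv ν x + 1) ∂surfaceMeasure K
        = ∫ x, (t ^ 2 * p x - (0 : E (m + 1) → ℝ) x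
            + ((t ^ 2 * p x) ^ 2 - (0 : E (m + 1) → ℝ) x ^ 2) / 2 * (meanCurv ν x + 1))
            ∂surfaceMeasure K := by
      simp only [Pi.zero_apply]
      rw [← integral_const_mul, ← integral_const_mul,
        ← integral_add (i1 _ (by fun_prop)) (i1 _ (by fun_prop))]
      refine integral_congr_ae (.of_forall fun x => ?_)
      ring
    rw [add_assoc, e2]
    linarith

end Volume

section Poincare

variable {m : ℕ} {K : Set (E (m + 1))} {ν : E (m + 1) → E (m + 1)}

theorem SmoothBody.integral_meanCurv_le_add [Nontrivial (E (m + 1))] (h : SmoothBody K ν)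
    {ψ : E (m + 1) → ℝ} (hψ : ContDiff ℝ 1 ψ) (hmean : ∫ x, ψ x ∂surfaceMeasure K = 0)
    {q : E (m + 1) → ℝ} (hq : ContinuousOn q (frontier K)) {w : E (m + 1) → E (m + 1)}
    (hwt : ∀ x ∈ frontier K, ⟪w x, ν x⟫ = 0)
    (hwg : ∀ x ∈ frontier K, ∀ v, ⟪v, ν x⟫ = 0 → ⟪fderiv ℝ ν x (w x), v⟫ = fderiv ℝ ψ x v)
    (hwq : ∀ x ∈ frontier K, q x = ⟪fderiv ℝ ν x (w x), w x⟫) {ε : ℝ} (hε : 0 < ε) :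
    ∫ x, ψ x ^ 2 * (meanCurv ν x - ε) ∂surfaceMeasure K
      ≤ ∫ x, (q x + 2 * ε) ∂surfaceMeasure K := by
  have hψc : ContinuousOn ψ (frontier K) := hψ.continuous.continuousOn
  obtain ⟨M, hM⟩ := h.isCompact_frontier.exists_bound_of_continuousOn hψc
  set p : E (m + 1) → ℝ := fun x => q x / 2 + ε with hpdef
  have hpc : ContinuousOn p (frontier K) := by fun_prop
  have hp0 : ∀ x ∈ frontier K, 0 ≤ p x := by
    intro x hx
    have : 0 ≤ q x := by
      rw [hwq x hx]
      by_cases hw : w x = 0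
      · simp [hw]
      · exact (h.curv x hx (w x) (hwt x hx) hw).le
    simp only [hpdef]
    positivity
  set a := ∫ x, ψ x ^ 2 * (meanCurv ν x - ε) ∂surfaceMeasure K with ha
  set b := ∫ x, p x ∂surfaceMeasure K with hb
  set c := ∫ x, p x ^ 2 * (meanCurv ν x + 1) ∂surfaceMeasure K
  have hV : 0 < volume.real K := by
    refine ENNReal.toReal_pos ?_ h.compact.measure_lt_top.ne
    exact (Measure.measure_pos_of_nonempty_interior _ h.int).ne'
  have hsm : ∀ᶠ t : ℝ in 𝓝[>] 0, 0 < volume.real K + t ^ 2 / 2 * a := by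
    have : Tendsto (fun t : ℝ => volume.real K + t ^ 2 / 2 * a) (𝓝 0)
        (𝓝 (volume.real K + (0 : ℝ) ^ 2 / 2 * a)) :=
      Continuous.tendsto (by fun_prop) 0
    refine (this.mono_left nhdsWithin_le_nhds).eventually_const_lt ?_
    simpa using hV
  have hmain : ∀ᶠ t : ℝ in 𝓝[>] 0, a / 2 ≤ b + t ^ 2 / 2 * c := by
    have hs1 := h.support_estimate hψ hq hwt hwg hwq M hε
    have hs2 := h.support_estimate (ψ := fun x => -ψ x) hψ.neg hq (w := fun x => -w x)
      (fun x hx => by rw [inner_neg_left, hwt x hx, neg_zero])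
      (fun x hx v hv => by
        rw [map_neg, inner_neg_left, hwg x hx v hv, fderiv_fun_neg]
        rfl)
      (fun x hx => by rw [map_neg, inner_neg_neg, hwq x hx]) M hε
    filter_upwards [hsm, hs1, hs2, h.volume_perturb_ge hψc hε, h.volume_perturb_ge hψc.neg hε,
      h.volume_outer_le hpc hp0, self_mem_nhdsWithin]
      with t ht h1 h2 ⟨m1, f1, v1⟩ ⟨m2, f2, v2⟩ ⟨m3, f3, v3⟩ (ht0 : 0 < t)
    have hbm := volume_mul_volume_le_sq m1 m2 m3 fun x hx y hy =>
      h.midpoint_perturb_mem ht0 hM hp0 h1 h2 hx hy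
    have hbm' := ENNReal.toReal_mono (ENNReal.pow_ne_top f3) hbm
    rw [ENNReal.toReal_mul, ENNReal.toReal_pow] at hbm'
    simp only [← measureReal_def] at hbm'
    rw [hmean, mul_zero, add_zero] at v1
    simp only [Pi.neg_apply, neg_sq, integral_neg, hmean, neg_zero, mul_zero, add_zero] at v2
    have hle : (volume.real K + t ^ 2 / 2 * a) ^ 2
        ≤ (volume.real K + t ^ 2 * b + t ^ 4 / 2 * c) ^ 2 := by
      calc (volume.real K + t ^ 2 / 2 * a) ^ 2
          = (volume.real K + t ^ 2 / 2 * a) * (volume.real K + t ^ 2 / 2 * a) := sq _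
        _ ≤ _ := mul_le_mul v1 v2 ht.le measureReal_nonneg
        _ ≤ _ := hbm'
        _ ≤ _ := pow_le_pow_left₀ measureReal_nonneg v3 2
    have hle' := (sq_le_sq₀ ht.le (measureReal_nonneg.trans v3)).1 hle
    refine le_of_mul_le_mul_left ?_ (pow_pos ht0 2)
    linarith
  have hlim : Tendsto (fun t : ℝ => b + t ^ 2 / 2 * c) (𝓝[>] 0) (𝓝 b) := by
    have : Tendsto (fun t : ℝ => b + t ^ 2 / 2 * c) (𝓝 0) (𝓝 (b + (0 : ℝ) ^ 2 / 2 * c)) :=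
      Continuous.tendsto (by fun_prop) 0
    refine (this.mono_left nhdsWithin_le_nhds).trans_eq ?_
    simp
  have hab : a / 2 ≤ b := ge_of_tendsto hlim hmain
  have e2 : ∫ x, (q x + 2 * ε) ∂surfaceMeasure K = 2 * b := by
    rw [hb, ← integral_const_mul]
    refine integral_congr_ae (.of_forall fun x => ?_)
    simp only [hpdef]
    ring
  rw [e2]
  linarith

theorem SmoothBody.integral_meanCurv_le [Nontrivial (E (m + 1))] (h : SmoothBody K ν)
    {ψ : E (m + 1) → ℝ} (hψ : ContDiff ℝ 1 ψ) (hmean : ∫ x, ψ x ∂surfaceMeasure K = 0) :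
    ∫ x, meanCurv ν x * ψ x ^ 2 ∂surfaceMeasure K
      ≤ ∫ x, ⟪tangentSol ν (gradient ψ) x, tp (ν x) (gradient ψ x)⟫ ∂surfaceMeasure K := by
  have hfin := h.isFiniteMeasure
  have hψc : ContinuousOn ψ (frontier K) := hψ.continuous.continuousOn
  have hH := h.continuousOn_meanCurv
  have hgc : ContinuousOn (gradient ψ) (frontier K) :=
    ((InnerProductSpace.toDual ℝ _).symm.continuous.comp
      (hψ.continuous_fderiv one_ne_zero)).continuousOn
  have hwc := h.continuousOn_tangentSol hgc
  have hq : ContinuousOn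
      (fun x => ⟪tangentSol ν (gradient ψ) x, tp (ν x) (gradient ψ x)⟫) (frontier K) :=
    hwc.inner (𝕜 := ℝ) (h.continuousOn_tp.clm_apply hgc)
  have i1 : ∀ f : E (m + 1) → ℝ, ContinuousOn f (frontier K) →
      Integrable f (surfaceMeasure K) := fun f hf => h.integrable_of_continuousOn hf
  have key : ∀ ε > 0, ∫ x, meanCurv ν x * ψ x ^ 2 ∂surfaceMeasure K
      ≤ ∫ x, ⟪tangentSol ν (gradient ψ) x, tp (ν x) (gradient ψ x)⟫ ∂surfaceMeasure K
        + ε * ∫ x, (ψ x ^ 2 + 2) ∂surfaceMeasure K := by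
    intro ε hε
    have h1 := h.integral_meanCurv_le_add hψ hmean hq (w := tangentSol ν (gradient ψ))
      (fun x hx => h.tangentSol_inner hx _)
      (fun x hx v hv => by
        rw [h.fderiv_tangentSol hx, tp_apply, inner_sub_left, real_inner_smul_left,
          real_inner_comm v (ν x), hv, mul_zero, sub_zero]
        exact inner_gradient_left ..)
      (fun x hx => by rw [h.fderiv_tangentSol hx, real_inner_comm]) hε
    have e1 : ∫ x, ψ x ^ 2 * (meanCurv ν x - ε) ∂surfaceMeasure K
        = ∫ x, meanCurv ν x * ψ x ^ 2 ∂surfaceMeasure K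
          - ∫ x, ε * ψ x ^ 2 ∂surfaceMeasure K := by
      rw [← integral_sub (i1 _ (by fun_prop)) (i1 _ (by fun_prop))]
      refine integral_congr_ae (.of_forall fun x => ?_)
      ring
    have e2 : ε * ∫ x, (ψ x ^ 2 + 2) ∂surfaceMeasure K
        = ∫ x, ε * ψ x ^ 2 ∂surfaceMeasure K + ∫ _, 2 * ε ∂surfaceMeasure K := by
      rw [← integral_const_mul, ← integral_add (i1 _ (by fun_prop)) (i1 _ (by fun_prop))]
      refine integral_congr_ae (.of_forall fun x => ?_)
      ring
    rw [e1, integral_add (i1 _ hq) (i1 _ (by fun_prop))] at h1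
    rw [e2]
    linarith
  have hlim : Tendsto (fun ε : ℝ =>
      ∫ x, ⟪tangentSol ν (gradient ψ) x, tp (ν x) (gradient ψ x)⟫ ∂surfaceMeasure K
        + ε * ∫ x, (ψ x ^ 2 + 2) ∂surfaceMeasure K) (𝓝[>] 0)
      (𝓝 (∫ x, ⟪tangentSol ν (gradient ψ) x, tp (ν x) (gradient ψ x)⟫ ∂surfaceMeasure K)) := by
    have : Tendsto (fun ε : ℝ =>
      ∫ x, ⟪tangentSol ν (gradient ψ) x, tp (ν x) (gradient ψ x)⟫ ∂surfaceMeasure K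
        + ε * ∫ x, (ψ x ^ 2 + 2) ∂surfaceMeasure K) (𝓝 0) (𝓝 (_ + (0 : ℝ) * _)) :=
      Continuous.tendsto (by fun_prop) 0
    refine (this.mono_left nhdsWithin_le_nhds).trans_eq ?_
    rw [zero_mul, add_zero]
  exact ge_of_tendsto hlim (by filter_upwards [self_mem_nhdsWithin] with ε hε using key ε hε)

end Poincare

section Hausdorff

theorem exists_pos_surfaceMeasure_eq {m : ℕ} (K : Set (E (m + 1))) :
    ∃ κ : NNReal, 0 < κ ∧ surfaceMeasure K
      = κ • (μH[((m + 1 : ℕ) : ℝ) - 1] : Measure (E (m + 1))).restrict (frontier K) := by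
  have e : ((m + 1 : ℕ) : ℝ) - 1 = m := by push_cast; ring
  rw [e, surfaceMeasure, Measure.euclideanHausdorffMeasure_def, Measure.restrict_smul]
  exact ⟨_, pos_iff_ne_zero.2
    (Measure.addHaarScalarFactor_volume_hausdorffMeasure_ne_zero _), rfl⟩

end Hausdorff

end BrunnMinkowski

/-- From the Brunn-Minkowski inequality to a class of Poincaré type inequalities,
Theorem 1.1:  Let `K ⊂ ℝⁿ` be a convex body (compact convex set with nonempty interior)
of class `C²₊`, i.e. whose Gauss map `ν` (outer unit normal field) is `C¹` on a
neighbourhood of `∂K` and whose Weingarten map `Dν` is positive definite on each tangent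
space (positive Gauss curvature).  Let `W x` be the inverse of the Weingarten map on the
tangent space at `x` (extended by `0` on the normal direction).  Then for every
`ψ ∈ C¹(∂K)` (represented by a `C¹` extension to `ℝⁿ`) with
`∫_{∂K} ψ dℋ^{n-1} = 0` one has
`∫_{∂K} tr(Dν) ψ² dℋ^{n-1} ≤ ∫_{∂K} ⟨(Dν)⁻¹ ∇ψ, ∇ψ⟩ dℋ^{n-1}`,
where `∇ψ` is the tangential gradient of `ψ` on `∂K`. -/
theorem brunn_minkowski_poincare
    {n : ℕ} (hn : 2 ≤ n) (K : Set (E n))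
    (hKconv : Convex ℝ K) (hKcomp : IsCompact K) (hKint : (interior K).Nonempty)
    -- the Gauss map (outer unit normal field), of class C¹ near ∂K :
    (ν : E n → E n) (U : Set (E n)) (hU : IsOpen U) (hKU : frontier K ⊆ U)
    (hνC1 : ContDiffOn ℝ 1 ν U)
    (hνunit : ∀ x ∈ frontier K, ‖ν x‖ = 1)
    (hνouter : ∀ x ∈ frontier K, ∀ y ∈ K, ⟪y - x, ν x⟫ ≤ 0)
    -- positive Gauss curvature: the Weingarten map `Dν` is positive definite on tangent spaces:
    (hcurv : ∀ x ∈ frontier K, ∀ v ∈ (ℝ ∙ (ν x))ᗮ, v ≠ 0 → 0 < ⟪fderiv ℝ ν x v, v⟫)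
    -- `W x` is the inverse of the Weingarten map on the tangent space at `x` :
    (W : E n → E n →L[ℝ] E n)
    (hWtan : ∀ x ∈ frontier K, ∀ v : E n, W x v ∈ (ℝ ∙ (ν x))ᗮ)
    (hWinv : ∀ x ∈ frontier K, ∀ v : E n,
      W x (fderiv ℝ ν x (tproj (ν x) v)) = tproj (ν x) v)
    -- a function `ψ ∈ C¹(∂K)`, represented by a `C¹` extension :
    (ψ : E n → ℝ) (hψ : ContDiff ℝ 1 ψ)
    -- vanishing mean on `∂K` :
    (hmean : (∫ x in frontier K, ψ x ∂μH[(n : ℝ) - 1]) = 0) :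
    (∫ x in frontier K,
        (LinearMap.trace ℝ (E n)
          (((tproj (ν x)).comp ((fderiv ℝ ν x).comp (tproj (ν x)))) : E n →ₗ[ℝ] E n))
          * (ψ x) ^ 2 ∂μH[(n : ℝ) - 1])
      ≤ ∫ x in frontier K,
          ⟪W x (tproj (ν x) (gradient ψ x)), tproj (ν x) (gradient ψ x)⟫
            ∂μH[(n : ℝ) - 1] := by
  obtain ⟨m, rfl⟩ : ∃ m, n = m + 1 := ⟨n - 1, by omega⟩
  have : Nontrivial (Fin (m + 1)) := Fin.nontrivial_iff_two_le.2 hn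
  have : Nontrivial (E (m + 1)) := inferInstance
  have hX : MeasurableSet (frontier K) := isClosed_frontier.measurableSet
  have h : SmoothBody K ν :=
    { conv := hKconv
      compact := hKcomp
      int := hKint
      smooth := fun x hx => hνC1.contDiffAt (hU.mem_nhds (hKU hx))
      unit := hνunit
      outer := hνouter
      curv := fun x hx v hv =>
        hcurv x hx v (Submodule.mem_orthogonal_singleton_iff_inner_left.2 hv) }
  obtain ⟨κ, hκ, hσ⟩ := exists_pos_surfaceMeasure_eq K
  have hmean' : ∫ x, ψ x ∂surfaceMeasure K = 0 := by
    rw [hσ, integral_smul_nnreal_measure, hmean, smul_zero]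
  have hmain := h.integral_meanCurv_le hψ hmean'
  rw [hσ, integral_smul_nnreal_measure, integral_smul_nnreal_measure] at hmain
  have hmain' := le_of_smul_le_smul_left hmain hκ
  have htr : ∀ x ∈ frontier K, (tproj (ν x)).comp ((fderiv ℝ ν x).comp (tproj (ν x)))
      = (fderiv ℝ ν x).comp (tp (ν x)) := by
    intro x hx
    ext1 v
    exact tp_of_inner (h.fderiv_tangent hx (tp_inner (h.unit x hx) v))
  have hW : ∀ x ∈ frontier K, W x (tproj (ν x) (gradient ψ x)) = tangentSol ν (gradient ψ) x := by
    intro x hx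
    have h1 : tproj (ν x) (tangentSol ν (gradient ψ) x) = tangentSol ν (gradient ψ) x :=
      tp_of_inner (h.tangentSol_inner hx _)
    have h2 := hWinv x hx (tangentSol ν (gradient ψ) x)
    rwa [h1, h.fderiv_tangentSol hx] at h2
  refine (Eq.trans_le ?_ hmain').trans_eq ?_
  · refine setIntegral_congr_fun hX fun x hx => ?_
    simp only [htr x hx]
    rfl
  · refine setIntegral_congr_fun hX fun x hx => ?_
    simp only [hW x hx]
    rfl
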